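/- Let σ ∈ 𝔖_s and 𝐈 ∈ Subsets(r,n,s). Then 𝐈 ∈ Intersecting^0(r,n,s)^σ if and only if (Γ(𝐈), n−r) ∈ 𝒦(r,s)^σ. -/

import Mathlib

open Module

noncomputable section

/-- A complete flag on `ℂ^m`: an increasing family of subspaces with
`dim (F i) = i + 1` (`0`-based indexing, so `F i` is the `i+1`-st step). -/
structure Flagg (m : ℕ) where
  F : Fin m → Submodule ℂ (Fin m → ℂ)
  mono : Monotone F
  rank_eq : ∀ i : Fin m, finrank ℂ (F i) = (i : ℕ) + 1

/-- An `s`-tuple `J` of (strictly increasing) maps `[d] → [r]` is *intersecting* if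
for every `s`-tuple of complete flags on `ℂ^r` the corresponding intersection of
Schubert varieties in the Grassmannian `Gr(d, ℂ^r)` is nonempty. -/
def Intersecting {s d r : ℕ} (J : Fin s → Fin d → Fin r) : Prop :=
  ∀ F : Fin s → Flagg r, ∃ V : Submodule ℂ (Fin r → ℂ), finrank ℂ V = d ∧
    ∀ (l : Fin s) (k : Fin d), (k : ℕ) + 1 ≤ finrank ℂ ↥(V ⊓ (F l).F (J l k))

/-- `dim I = ∑_j (I(j) - j)`. -/
def dimI {d r : ℕ} (J : Fin d → Fin r) : ℤ := ∑ k, ((J k : ℤ) - (k : ℤ))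

/-- Expected dimension of a tuple `J ∈ Subsets(d,r,s)`. -/
def edim {s d r : ℕ} (J : Fin s → Fin d → Fin r) : ℤ :=
  (d : ℤ) * ((r : ℤ) - (d : ℤ)) - ∑ l, ((d : ℤ) * ((r : ℤ) - (d : ℤ)) - dimI (J l))

/-- `dim` for raw `ℕ`-valued increasing sequences. -/
def dimN {d : ℕ} (f : Fin d → ℕ) : ℤ := ∑ k, ((f k : ℤ) - (k : ℤ))

/-- Expected dimension for raw `ℕ`-valued tuples, with ambient dimension `n` explicit. -/
def edimN {s d : ℕ} (n : ℕ) (f : Fin s → Fin d → ℕ) : ℤ :=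
  (d : ℤ) * ((n : ℤ) - (d : ℤ)) - ∑ l, ((d : ℤ) * ((n : ℤ) - (d : ℤ)) - dimN (f l))

/-- `T(Λ) = ∑_l ∑_j Λ_l(j)`. -/
def TT {s r : ℕ} (Λ : Fin s → Fin r → ℝ) : ℝ := ∑ l, ∑ j, Λ l j

/-- `T_J(Λ) = ∑_l ∑_{j ∈ J_l} Λ_l(j)`. -/
def TJ {s d r : ℕ} (J : Fin s → Fin d → Fin r) (Λ : Fin s → Fin r → ℝ) : ℝ :=
  ∑ l, ∑ k, Λ l (J l k)

/-- `Γ(J)_l(k) = k - J_l(k) + (r - d)`, a weakly decreasing real `d`-tuple. -/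
def GammaT {s d r : ℕ} (J : Fin s → Fin d → Fin r) : Fin s → Fin d → ℝ :=
  fun l k => (k : ℝ) - (J l k : ℝ) + ((r : ℝ) - (d : ℝ))

/-- Membership of `(Λ, t)` in the Kirwan cone `𝒦(r,s)`: each `Λ_l` is weakly
decreasing and there are Hermitian matrices `A_1, …, A_s` summing to `t·I_r`
whose decreasingly-ordered spectra are the `Λ_l`. -/
def KirwanMem {s r : ℕ} (Λ : Fin s → Fin r → ℝ) (t : ℝ) : Prop :=
  (∀ l, Antitone (Λ l)) ∧
  ∃ (A : Fin s → Matrix (Fin r) (Fin r) ℂ) (hA : ∀ l, (A l).IsHermitian),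
    (∑ l, A l) = (t : ℂ) • (1 : Matrix (Fin r) (Fin r) ℂ) ∧
    ∀ l, ∃ e : Equiv.Perm (Fin r), ∀ i, Λ l i = (hA l).eigenvalues (e i)

/-- The subspace of a flag with `k` elements (so `flagAt G 0 = ⊥`). -/
def flagAt {m : ℕ} (G : Flagg m) : ℕ → Submodule ℂ (Fin m → ℂ)
  | 0 => ⊥
  | (k + 1) => if h : k < m then G.F ⟨k, h⟩ else ⊤

/-- The space `ℒ_I(F,G)` of linear maps `φ : ℂ^r → ℂ^q` with
`φ(F_l(j)) ⊆ G_l(I_l(j) - j)` for all `l, j`. -/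
def LSpace {s r q : ℕ} (I : Fin s → Fin r → ℕ) (F : Fin s → Flagg r) (G : Fin s → Flagg q) :
    Submodule ℂ ((Fin r → ℂ) →ₗ[ℂ] (Fin q → ℂ)) where
  carrier := {φ | ∀ (l : Fin s) (j : Fin r), ∀ v ∈ (F l).F j,
    φ v ∈ flagAt (G l) (I l j - (j : ℕ))}
  add_mem' := by
    intro a b ha hb l j v hv
    simpa using add_mem (ha l j v hv) (hb l j v hv)
  zero_mem' := by
    intro l j v hv
    simp
  smul_mem' := by
    intro c a ha l j v hv
    simpa using Submodule.smul_mem _ c (ha l j v hv)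

/-- The true dimension `tdim I`, for a raw tuple `I ∈ Subsets(r, r + q, s)`
(here `q = n - r`). -/
def tdim {s : ℕ} (r q : ℕ) (I : Fin s → Fin r → ℕ) : ℕ :=
  sInf {m : ℕ | ∃ (F : Fin s → Flagg r) (G : Fin s → Flagg q), finrank ℂ (LSpace I F G) = m}

/-- The kernel dimension `kdim I`. -/
def kdim {s : ℕ} (r q : ℕ) (I : Fin s → Fin r → ℕ) : ℕ :=
  sInf {m : ℕ | ∃ (F : Fin s → Flagg r) (G : Fin s → Flagg q)
      (φ : (Fin r → ℂ) →ₗ[ℂ] (Fin q → ℂ)), φ ∈ LSpace I F G ∧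
      finrank ℂ (LSpace I F G) = tdim r q I ∧ finrank ℂ (LinearMap.ker φ) = m}

/-- The (`0`-based) Schubert position of a subspace `W` w.r.t. a flag:
`posN Fl W k` is the least `j` with `dim (Fl(j) ⊓ W) = k + 1`. -/
def posN {m : ℕ} (Fl : Flagg m) (W : Submodule ℂ (Fin m → ℂ)) (k : ℕ) : ℕ :=
  sInf {j : ℕ | ∃ h : j < m, finrank ℂ ↥(Fl.F ⟨j, h⟩ ⊓ W) = k + 1}

/-- The (`0`-based, `ℕ`-valued) kernel position `kPos(I)_l(k)`. -/
def kPosFun {s : ℕ} (r q : ℕ) (I : Fin s → Fin r → ℕ) (l : Fin s) (k : ℕ) : ℕ :=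
  sInf {p : ℕ | ∃ (F : Fin s → Flagg r) (G : Fin s → Flagg q)
      (φ : (Fin r → ℂ) →ₗ[ℂ] (Fin q → ℂ)), φ ∈ LSpace I F G ∧
      finrank ℂ (LSpace I F G) = tdim r q I ∧
      finrank ℂ (LinearMap.ker φ) = kdim r q I ∧ posN (F l) (LinearMap.ker φ) k = p}

/-- Apply an `r`-tuple of reals at a natural index (junk value `0` out of range). -/
def applyI {r : ℕ} (f : Fin r → ℝ) (j : ℕ) : ℝ := if h : j < r then f ⟨j, h⟩ else 0

/-- Apply an `r`-tuple of naturals at a natural index (junk value `0` out of range). -/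
def applyN {r : ℕ} (f : Fin r → ℕ) (j : ℕ) : ℕ := if h : j < r then f ⟨j, h⟩ else 0

/-- The slope `slope_θ(J) = (1/d) ∑_l ∑_{j ∈ J_l} θ_l(j)` of a tuple. -/
def slopeT {s d r : ℕ} (θ : Fin s → Fin r → ℝ) (J : Fin s → Fin d → Fin r) : ℝ :=
  ((d : ℝ))⁻¹ * ∑ l, ∑ k, θ l (J l k)

/-- The slope `slope_θ(W, F) = slope_θ(Pos(W, F))` of a (nonzero) subspace. -/
def slopeW {s r : ℕ} (θ : Fin s → Fin r → ℝ) (F : Fin s → Flagg r)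
    (W : Submodule ℂ (Fin r → ℂ)) : ℝ :=
  ((finrank ℂ W : ℝ))⁻¹ * ∑ l, ∑ k ∈ Finset.range (finrank ℂ W), applyI (θ l) (posN (F l) W k)

end

open Module

namespace HK

/-- scalar polynomial functions -/
def PolyFn (f : ℂ → ℂ) : Prop := ∃ p : Polynomial ℂ, ∀ t, f t = p.eval t

namespace PolyFn
theorem const (c : ℂ) : PolyFn (fun _ => c) := ⟨Polynomial.C c, by simp⟩
theorem id' : PolyFn (fun t => t) := ⟨Polynomial.X, by simp⟩
theorem add {f g : ℂ → ℂ} (hf : PolyFn f) (hg : PolyFn g) : PolyFn (fun t => f t + g t) := by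
  obtain ⟨p, hp⟩ := hf; obtain ⟨q, hq⟩ := hg
  exact ⟨p + q, by simp [hp, hq]⟩
theorem mul {f g : ℂ → ℂ} (hf : PolyFn f) (hg : PolyFn g) : PolyFn (fun t => f t * g t) := by
  obtain ⟨p, hp⟩ := hf; obtain ⟨q, hq⟩ := hg
  exact ⟨p * q, by simp [hp, hq]⟩
theorem sum {ι : Type*} (s : Finset ι) {f : ι → ℂ → ℂ} (hf : ∀ i ∈ s, PolyFn (f i)) :
    PolyFn (fun t => ∑ i ∈ s, f i t) := by
  classical
  induction s using Finset.induction_on with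
  | empty => simpa using const 0
  | insert a s ha ih =>
    simp only [Finset.sum_insert ha]
    exact add (hf a (by simp)) (ih fun i hi => hf i (by simp [hi]))
theorem prod {ι : Type*} (s : Finset ι) {f : ι → ℂ → ℂ} (hf : ∀ i ∈ s, PolyFn (f i)) :
    PolyFn (fun t => ∏ i ∈ s, f i t) := by
  classical
  induction s using Finset.induction_on with
  | empty => simpa using const 1
  | insert a s ha ih =>
    simp only [Finset.prod_insert ha]
    exact mul (hf a (by simp)) (ih fun i hi => hf i (by simp [hi]))
theorem det {ι : Type*} [Fintype ι] [DecidableEq ι] {M : ℂ → Matrix ι ι ℂ}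
    (hM : ∀ i j, PolyFn (fun t => M t i j)) : PolyFn (fun t => (M t).det) := by
  simp only [Matrix.det_apply']
  exact sum _ fun σ _ => mul (const _) (prod _ fun i _ => hM _ _)
theorem ne_zero {f : ℂ → ℂ} (hf : PolyFn f) {t0 : ℂ} (h : f t0 ≠ 0) :
    ∀ᶠ t in Filter.cofinite, f t ≠ 0 := by
  obtain ⟨p, hp⟩ := hf
  have hp0 : p ≠ 0 := by rintro rfl; simp [hp] at h
  rw [Filter.eventually_cofinite]
  refine (Polynomial.finite_setOfPred_isRoot hp0).subset ?_
  intro t ht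
  simpa [hp, Polynomial.IsRoot] using ht
theorem continuous {f : ℂ → ℂ} (hf : PolyFn f) : Continuous f := by
  obtain ⟨p, hp⟩ := hf
  rw [show f = fun t => p.eval t from funext hp]
  exact p.continuous
theorem eq_zero {f : ℂ → ℂ} (hf : PolyFn f) (h : ∀ᶠ t in Filter.cofinite, f t = 0) (t : ℂ) :
    f t = 0 := by
  by_contra h0
  obtain ⟨u, hu⟩ := (h.and (hf.ne_zero h0)).exists
  exact hu.2 hu.1
end PolyFn

/-- rank factorization -/
theorem exists_rank_factor {m n : Type*} [Fintype m] [Fintype n] [DecidableEq m] [DecidableEq n]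
    (M : Matrix m n ℂ) : ∃ (P : Matrix m (Fin M.rank) ℂ) (Q : Matrix (Fin M.rank) n ℂ)
      (P' : Matrix (Fin M.rank) m ℂ) (Q' : Matrix n (Fin M.rank) ℂ),
      M = P * Q ∧ P' * P = 1 ∧ Q * Q' = 1 := by
  have hr : finrank ℂ (LinearMap.range M.mulVecLin) = M.rank := rfl
  let b := (finBasisOfFinrankEq ℂ _ hr).equivFun
  let f := M.mulVecLin
  let q : (n → ℂ) →ₗ[ℂ] (Fin M.rank → ℂ) := b.toLinearMap ∘ₗ f.rangeRestrict
  let p : (Fin M.rank → ℂ) →ₗ[ℂ] (m → ℂ) := (LinearMap.range f).subtype ∘ₗ b.symm.toLinearMap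
  have hpq : p ∘ₗ q = f := by ext x; simp [p, q]
  have hq : LinearMap.range q = ⊤ := by
    rw [LinearMap.range_eq_top]
    exact b.surjective.comp f.surjective_rangeRestrict
  have hp : LinearMap.ker p = ⊥ := by
    rw [LinearMap.ker_eq_bot]
    exact Subtype.val_injective.comp b.symm.injective
  obtain ⟨q', hq'⟩ := q.exists_rightInverse_of_surjective hq
  obtain ⟨p', hp'⟩ := p.exists_leftInverse_of_injective hp
  refine ⟨LinearMap.toMatrix' p, LinearMap.toMatrix' q, LinearMap.toMatrix' p',
    LinearMap.toMatrix' q', ?_, ?_, ?_⟩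
  · rw [← LinearMap.toMatrix'_comp, hpq]
    exact (LinearMap.toMatrix'_toLin' M).symm
  · rw [← LinearMap.toMatrix'_comp, hp', LinearMap.toMatrix'_id]
  · rw [← LinearMap.toMatrix'_comp, hq', LinearMap.toMatrix'_id]

theorem polyFn_mul_entry {m n l : Type*} [Fintype n] {M : ℂ → Matrix m n ℂ} {N : ℂ → Matrix n l ℂ}
    (hM : ∀ i j, PolyFn (fun t => M t i j)) (hN : ∀ i j, PolyFn (fun t => N t i j)) (i : m) (j : l) :
    PolyFn (fun t => (M t * N t) i j) := by
  simp only [Matrix.mul_apply]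
  exact PolyFn.sum _ fun k _ => (hM _ _).mul (hN _ _)

theorem polyFn_const_mul_mul {m n k l : Type*} [Fintype m] [Fintype n] {M : ℂ → Matrix m n ℂ}
    (hM : ∀ i j, PolyFn (fun t => M t i j)) (P : Matrix k m ℂ) (Q : Matrix n l ℂ) (i : k) (j : l) :
    PolyFn (fun t => (P * M t * Q) i j) := by
  have h1 : ∀ i j, PolyFn (fun t => (P * M t) i j) :=
    polyFn_mul_entry (M := fun _ => P) (fun _ _ => PolyFn.const _) hM
  exact polyFn_mul_entry (N := fun _ => Q) h1 (fun _ _ => PolyFn.const _) i j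

theorem rank_semicont {m n : Type*} [Fintype m] [Fintype n]
    {M : ℂ → Matrix m n ℂ} (hM : ∀ i j, PolyFn (fun t => M t i j)) (t0 : ℂ) :
    ∀ᶠ t in Filter.cofinite, (M t0).rank ≤ (M t).rank := by
  classical
  obtain ⟨P, Q, P', Q', h, hP, hQ⟩ := exists_rank_factor (M t0)
  have h1 : PolyFn (fun t => (P' * M t * Q').det) := by
    exact PolyFn.det fun i j => polyFn_const_mul_mul hM P' Q' i j
  have h2 : (P' * M t0 * Q').det ≠ 0 := by
    have : P' * M t0 * Q' = 1 := by
      have h0 := congrArg (fun X => P' * X * Q') h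
      refine h0.trans ?_
      rw [← Matrix.mul_assoc, hP, Matrix.one_mul, hQ]
    rw [this]; simp
  filter_upwards [h1.ne_zero h2] with t ht
  have h3 : (P' * M t * Q').rank = (M t0).rank := by
    rw [Matrix.rank_of_isUnit _ ((Matrix.isUnit_iff_isUnit_det _).2 (isUnit_iff_ne_zero.2 ht))]
    simp
  calc (M t0).rank = (P' * M t * Q').rank := h3.symm
    _ ≤ (P' * M t).rank := Matrix.rank_mul_le_left _ _
    _ ≤ (M t).rank := Matrix.rank_mul_le_right _ _

end HK

open Module

namespace HK

def PolyC {U : Type*} [AddCommGroup U] [Module ℂ U] (N : ℂ → U) : Prop :=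
  ∀ l : U →ₗ[ℂ] ℂ, PolyFn (fun t => l (N t))

theorem exists_gen_inv {U W : Type*} [AddCommGroup U] [Module ℂ U] [AddCommGroup W] [Module ℂ W]
    (D : U →ₗ[ℂ] W) : ∃ G : W →ₗ[ℂ] U, ∀ u, D (G (D u)) = D u := by
  obtain ⟨g, hg⟩ := D.rangeRestrict.exists_rightInverse_of_surjective D.range_rangeRestrict
  obtain ⟨G, hG⟩ := LinearMap.exists_extend g
  refine ⟨G, fun u => ?_⟩
  have h1 : G (D u) = g (D.rangeRestrict u) := by
    rw [← hG]; rfl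
  rw [h1]
  have := congrArg Subtype.val (LinearMap.congr_fun hg (D.rangeRestrict u))
  simpa using this

theorem pencil {U W : Type*} [AddCommGroup U] [Module ℂ U] [FiniteDimensional ℂ U]
    [AddCommGroup W] [Module ℂ W] [FiniteDimensional ℂ W] (D0 D1 : U →ₗ[ℂ] W)
    (h : ∀ t : ℂ, finrank ℂ (LinearMap.ker D0) ≤ finrank ℂ (LinearMap.ker (D0 + t • D1)))
    (v0 : U) (hv : D0 v0 = 0) :
    ∃ N : ℂ → U, PolyC N ∧ (∀ᶠ t in Filter.cofinite, (D0 + t • D1) (v0 + t • N t) = 0) ∧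
      D0 (N 0) + D1 v0 = 0 := by
  obtain ⟨G, hG⟩ := exists_gen_inv D0
  set H : U →ₗ[ℂ] U := G ∘ₗ D1 with hH
  let b := finBasis ℂ U
  let A := LinearMap.toMatrix b b H
  let PA : Matrix _ _ (Polynomial ℂ) := 1 + (Polynomial.X : Polynomial ℂ) • A.map Polynomial.C
  let y := PA.adjugate.mulVec (fun i => Polynomial.C (b.repr v0 i))
  have hPA : ∀ t : ℂ, (Polynomial.evalRingHom t).mapMatrix PA = 1 + t • A := by
    intro t
    ext i j
    by_cases hij : i = j <;> simp [PA, hij] <;> ring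
  have hy : ∀ t : ℂ, (fun i => (y i).eval t) = (1 + t • A).adjugate.mulVec (fun i => b.repr v0 i) := by
    intro t
    rw [← hPA t, ← RingHom.map_adjugate]
    ext i
    have := RingHom.map_mulVec (Polynomial.evalRingHom t) PA.adjugate
      (fun i => Polynomial.C (b.repr v0 i)) i
    simp only [Polynomial.coe_evalRingHom] at this
    rw [this]
    congr 1
    ext i
    simp
  let c : ℂ → U := fun t => ∑ i, (y i).eval t • b i
  let N : ℂ → U := fun t => ∑ i, (y i).divX.eval t • b i
  have hN : PolyC N := by
    intro l
    simp only [N, map_sum, map_smul, smul_eq_mul]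
    exact PolyFn.sum _ fun i _ => PolyFn.mul ⟨_, fun t => rfl⟩ (PolyFn.const _)
  have hy0 : ∀ i, (y i).coeff 0 = b.repr v0 i := by
    intro i
    rw [Polynomial.coeff_zero_eq_eval_zero]
    have := congrFun (hy 0) i
    simpa using this
  have hc : ∀ t, v0 + t • N t = c t := by
    intro t
    conv_lhs => rw [← b.sum_repr v0]
    simp only [N, c, Finset.smul_sum, ← Finset.sum_add_distrib]
    refine Finset.sum_congr rfl fun i _ => ?_
    rw [smul_smul, ← add_smul]
    congr 1
    conv_rhs => rw [← Polynomial.X_mul_divX_add (y i)]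
    simp [hy0]
    ring
  have hcrep : ∀ t, c t + t • H (c t) = (1 + t • A).det • v0 := by
    intro t
    apply b.repr.injective
    ext i
    have e1 : ∀ u : U, b.repr (H u) i = A.mulVec (fun j => b.repr u j) i := by
      intro u
      have := LinearMap.toMatrix_mulVec_repr b b H u
      exact (congrFun this i).symm
    have e2 : (fun j => b.repr (c t) j) = fun i => (y i).eval t := by
      ext j
      simp [c, Finsupp.single_apply]
    have e3 : (b.repr (c t + t • H (c t))) i
        = ((1 + t • A).mulVec (fun i => (y i).eval t)) i := by
      rw [Matrix.add_mulVec, Matrix.one_mulVec, Matrix.smul_mulVec]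
      simp only [map_add, map_smul, Finsupp.coe_add, Finsupp.coe_smul, Pi.add_apply, Pi.smul_apply]
      have e2i : b.repr (c t) i = (y i).eval t := congrFun e2 i
      rw [e1, e2, e2i]
    rw [e3, hy, Matrix.mulVec_mulVec, Matrix.mul_adjugate, Matrix.smul_mulVec, Matrix.one_mulVec]
    simp
  have hdet : ∀ᶠ t : ℂ in Filter.cofinite, (1 + t • A).det ≠ 0 := by
    have : PolyFn (fun t : ℂ => (1 + t • A).det) := by
      apply PolyFn.det
      intro i j
      simp only [Matrix.add_apply, Matrix.smul_apply, smul_eq_mul]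
      exact (PolyFn.const _).add (PolyFn.id'.mul (PolyFn.const _))
    exact this.ne_zero (t0 := 0) (by simp)
  have hmain : ∀ᶠ t : ℂ in Filter.cofinite, (D0 + t • D1) (v0 + t • N t) = 0 := by
    filter_upwards [hdet] with t ht
    rw [hc]
    let E : U →ₗ[ℂ] U := LinearMap.id + t • H
    have hE : LinearMap.range E = ⊤ := by
      have : IsUnit (LinearMap.toMatrix b b E).det := by
        have : LinearMap.toMatrix b b E = 1 + t • A := by simp [E, A]
        rw [this]; exact isUnit_iff_ne_zero.2 ht
      have h2 := LinearEquiv.ofIsUnitDet this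
      rw [LinearMap.range_eq_top]
      exact (LinearEquiv.ofIsUnitDet this).surjective
    have e1 : D0 ∘ₗ G ∘ₗ (D0 + t • D1) = D0 ∘ₗ E := by
      ext u
      simp [E, hH, hG]
    have e2 : finrank ℂ (LinearMap.ker (D0 ∘ₗ E)) = finrank ℂ (LinearMap.ker D0) := by
      have a1 := LinearMap.finrank_range_add_finrank_ker (D0 ∘ₗ E)
      have a2 := LinearMap.finrank_range_add_finrank_ker D0
      rw [LinearMap.range_comp_of_range_eq_top _ hE] at a1
      omega
    have e3 : LinearMap.ker (D0 + t • D1) ≤ LinearMap.ker (D0 ∘ₗ E) := by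
      intro u hu
      rw [LinearMap.mem_ker] at hu ⊢
      rw [← e1]
      simp only [LinearMap.comp_apply, hu, map_zero]
    have e4 : LinearMap.ker (D0 + t • D1) = LinearMap.ker (D0 ∘ₗ E) :=
      Submodule.eq_of_le_of_finrank_le e3 (e2 ▸ h t)
    have e5 : c t ∈ LinearMap.ker (D0 ∘ₗ E) := by
      rw [LinearMap.mem_ker]
      have : E (c t) = (1 + t • A).det • v0 := by simpa [E] using hcrep t
      rw [LinearMap.comp_apply, this, map_smul, hv, smul_zero]
    rw [← e4] at e5
    exact e5
  refine ⟨N, hN, hmain, ?_⟩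
  rw [← Module.forall_dual_apply_eq_zero_iff ℂ]
  intro l
  have hp : PolyFn (fun t => l (D0 (N t) + D1 v0) + t * l (D1 (N t))) := by
    simp only [map_add]
    refine ((hN (l ∘ₗ D0)).add (PolyFn.const _)).add (PolyFn.id'.mul (hN (l ∘ₗ D1)))
  have hz := hp.eq_zero (by
    have hne : ∀ᶠ t : ℂ in Filter.cofinite, t ≠ 0 := PolyFn.id'.ne_zero (t0 := 1) one_ne_zero
    filter_upwards [hmain, hne] with t ht ht0
    have h1 : t • (D0 (N t) + D1 v0 + t • D1 (N t)) = 0 := by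
      rw [← ht]
      simp [hv]
      module
    rw [smul_eq_zero] at h1
    have h2 := h1.resolve_left ht0
    simpa using congrArg l h2) 0
  simpa using hz

theorem tangent {m n : Type*} [Fintype m] [Fintype n] (M0 : Matrix m n ℂ) (N : ℂ → Matrix m n ℂ)
    (hN : ∀ i j, PolyFn (fun t => N t i j))
    (hr : ∀ᶠ t in Filter.cofinite, (M0 + t • N t).rank ≤ M0.rank)
    (v : n → ℂ) (hv : M0.mulVec v = 0) : ∃ u, M0.mulVec u = (N 0).mulVec v := by
  classical
  let Z : ℂ → Matrix m (n ⊕ Unit) ℂ := fun t =>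
    Matrix.fromCols (M0 + t • N t) (Matrix.replicateCol Unit ((N t).mulVec v))
  have hZ : ∀ i j, PolyFn (fun t => Z t i j) := by
    intro i j
    rcases j with j | j
    · simp only [Z, Matrix.fromCols_apply_inl, Matrix.add_apply, Matrix.smul_apply, smul_eq_mul]
      exact (PolyFn.const _).add (PolyFn.id'.mul (hN _ _))
    · simp only [Z, Matrix.fromCols_apply_inr, Matrix.replicateCol_apply, Matrix.mulVec, dotProduct]
      exact PolyFn.sum _ fun k _ => (hN _ _).mul (PolyFn.const _)
  have hne : ∀ᶠ t : ℂ in Filter.cofinite, t ≠ 0 := PolyFn.id'.ne_zero (t0 := 1) one_ne_zero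
  obtain ⟨t, ⟨h1, h2⟩, h3⟩ := (((rank_semicont hZ 0).and hr).and hne).exists
  have hZt : Z t = (M0 + t • N t) * Matrix.fromCols 1 (Matrix.replicateCol Unit (t⁻¹ • v)) := by
    rw [Matrix.mul_fromCols, Matrix.mul_one, ← Matrix.replicateCol_mulVec, Matrix.mulVec_smul,
      Matrix.add_mulVec, hv, Matrix.smul_mulVec, zero_add, smul_smul, inv_mul_cancel₀ h3, one_smul]
  have h4 : (Z 0).rank ≤ M0.rank := by
    refine h1.trans (le_trans ?_ h2)
    rw [hZt]
    exact Matrix.rank_mul_le_left _ _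
  have h5 : LinearMap.range M0.mulVecLin ≤ LinearMap.range (Z 0).mulVecLin := by
    rintro _ ⟨x, rfl⟩
    refine ⟨Sum.elim x 0, ?_⟩
    simp [Z, Matrix.fromCols_mulVec]
  have h6 := Submodule.eq_of_le_of_finrank_le h5 h4
  have h7 : (N 0).mulVec v ∈ LinearMap.range (Z 0).mulVecLin := by
    refine ⟨Sum.elim 0 1, ?_⟩
    ext i
    simp [Z, Matrix.fromCols_mulVec, Matrix.mulVec, dotProduct]
  rw [← h6] at h7
  obtain ⟨u, hu⟩ := h7
  exact ⟨u, by simpa using hu⟩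

end HK

open Module

set_option linter.unusedSectionVars false
noncomputable section
namespace HK

section ortho
open scoped MatrixOrder ComplexOrder Matrix.Norms.L2Operator
open Matrix

theorem exists_orthonormalize {m k : Type} [Fintype m] [Fintype k] [DecidableEq m] [DecidableEq k]
    (B : Matrix m k ℂ) (L : Matrix k m ℂ) (h : L * B = 1) :
    ∃ C C' : Matrix k k ℂ, C * C' = 1 ∧ C' * C = 1 ∧ (B * C)ᴴ * (B * C) = 1 := by
  have h1 : (Bᴴ * B).PosSemidef := Matrix.posSemidef_conjTranspose_mul_self B
  obtain ⟨D, hD⟩ := CStarAlgebra.nonneg_iff_eq_star_mul_self.mp h1.nonneg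
  have hD' : Bᴴ * B = Dᴴ * D := hD
  have hinj : ∀ v, D.mulVec v = 0 → v = 0 := by
    intro v hv
    have h2 : (Bᴴ * B).mulVec v = 0 := by
      rw [hD', ← Matrix.mulVec_mulVec, hv, Matrix.mulVec_zero]
    have h3 : B.mulVec v = 0 := by
      rw [← Matrix.mulVec_mulVec] at h2
      have h4 : star (B.mulVec v) ⬝ᵥ B.mulVec v = 0 := by
        rw [Matrix.star_mulVec, ← Matrix.dotProduct_mulVec, h2, dotProduct_zero]
      exact dotProduct_star_self_eq_zero.1 h4
    calc v = (L * B).mulVec v := by rw [h, Matrix.one_mulVec]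
      _ = 0 := by rw [← Matrix.mulVec_mulVec, h3, Matrix.mulVec_zero]
  have hu : IsUnit D := by
    rw [← Matrix.mulVec_injective_iff_isUnit]
    intro v w hvw
    have : D.mulVec (v - w) = 0 := by rw [Matrix.mulVec_sub]; exact sub_eq_zero.2 hvw
    exact sub_eq_zero.1 (hinj _ this)
  have hdet := (Matrix.isUnit_iff_isUnit_det _).1 hu
  refine ⟨D⁻¹, D, Matrix.nonsing_inv_mul _ hdet, Matrix.mul_nonsing_inv _ hdet, ?_⟩
  calc (B * D⁻¹)ᴴ * (B * D⁻¹) = (D⁻¹)ᴴ * (Bᴴ * B) * D⁻¹ := by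
        simp only [Matrix.conjTranspose_mul, Matrix.mul_assoc]
    _ = (D * D⁻¹)ᴴ * (D * D⁻¹) := by
        rw [hD']; simp only [Matrix.conjTranspose_mul, Matrix.mul_assoc]
    _ = 1 := by rw [Matrix.mul_nonsing_inv _ hdet]; simp
end ortho

theorem closed_line {X : Type*} [TopologicalSpace X] {C : Set X} (hC : IsClosed C) {f : ℂ → X}
    (hf : Continuous f) (h : ∀ᶠ t in Filter.cofinite, f t ∈ C) (t : ℂ) : f t ∈ C := by
  have h1 : ∀ᶠ u in nhdsWithin t {t}ᶜ, f u ∈ C := h.filter_mono (nhdsNE_le_cofinite t)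
  exact hC.mem_of_tendsto ((hf.tendsto t).mono_left nhdsWithin_le_nhds) h1

theorem ker_semicont {U W : Type*} [AddCommGroup U] [Module ℂ U] [FiniteDimensional ℂ U]
    [AddCommGroup W] [Module ℂ W] [FiniteDimensional ℂ W] (D0 D1 : U →ₗ[ℂ] W) (t0 : ℂ) :
    ∀ᶠ t : ℂ in Filter.cofinite, finrank ℂ (LinearMap.ker (D0 + t • D1)) ≤
      finrank ℂ (LinearMap.ker (D0 + t0 • D1)) := by
  let b := finBasis ℂ U
  let c := finBasis ℂ W
  have hr : ∀ E : U →ₗ[ℂ] W, (LinearMap.toMatrix b c E).rank = finrank ℂ (LinearMap.range E) := by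
    intro E
    rw [Matrix.rank_eq_finrank_range_toLin _ c b, Matrix.toLin_toMatrix]
  have h := rank_semicont (M := fun t : ℂ => LinearMap.toMatrix b c (D0 + t • D1)) (by
    intro i j
    simp only [map_add, map_smul, Matrix.add_apply, Matrix.smul_apply, smul_eq_mul]
    exact (PolyFn.const _).add (PolyFn.id'.mul (PolyFn.const _))) t0
  filter_upwards [h] with t ht
  rw [hr, hr] at ht
  have a1 := LinearMap.finrank_range_add_finrank_ker (D0 + t • D1)
  have a2 := LinearMap.finrank_range_add_finrank_ker (D0 + t0 • D1)
  omega

section quiver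
variable {V A : Type} (tl hd : A → V)

abbrev Rep (ι : V → Type) : Type := ∀ a, Matrix (ι (hd a)) (ι (tl a)) ℂ

variable {tl hd} {M N : V → Type} [∀ x, Fintype (M x)] [∀ x, Fintype (N x)]

def Dm (R : Rep tl hd M) (S : Rep tl hd N) :
    (∀ x, Matrix (N x) (M x) ℂ) →ₗ[ℂ] (∀ a, Matrix (N (hd a)) (M (tl a)) ℂ) where
  toFun φ a := φ (hd a) * R a - S a * φ (tl a)
  map_add' φ ψ := by
    funext a; simp only [Pi.add_apply, Matrix.add_mul, Matrix.mul_add]; abel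
  map_smul' c φ := by
    funext a; simp [smul_sub]

@[simp] theorem Dm_apply (R : Rep tl hd M) (S : Rep tl hd N) (φ : ∀ x, Matrix (N x) (M x) ℂ) (a : A) :
    Dm R S φ a = φ (hd a) * R a - S a * φ (tl a) := rfl

theorem Dm_line (R0 R1 : Rep tl hd M) (S0 S1 : Rep tl hd N) (t : ℂ) :
    Dm (R0 + t • R1) (S0 + t • S1) = Dm R0 S0 + t • Dm R1 S1 := by
  ext φ a : 2
  simp [Matrix.mul_add, Matrix.add_mul, smul_sub]
  abel

def hom (R : Rep tl hd M) (S : Rep tl hd N) : ℕ := finrank ℂ (LinearMap.ker (Dm R S))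

def euler (tl hd : A → V) [Fintype V] [Fintype A] (k c : V → ℕ) : ℤ :=
  ∑ x, (k x : ℤ) * c x - ∑ a, (k (tl a) : ℤ) * c (hd a)

def crd (M : V → Type) [∀ x, Fintype (M x)] : V → ℕ := fun x => Fintype.card (M x)

variable [Fintype V] [Fintype A]

theorem finrank_U (M N : V → Type) [∀ x, Fintype (M x)] [∀ x, Fintype (N x)] :
    finrank ℂ (∀ x, Matrix (N x) (M x) ℂ) = ∑ x, crd M x * crd N x := by
  rw [Module.finrank_pi_fintype]
  refine Finset.sum_congr rfl fun x _ => ?_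
  rw [Module.finrank_matrix]; simp [crd, mul_comm]

theorem finrank_W (M N : V → Type) [∀ x, Fintype (M x)] [∀ x, Fintype (N x)] :
    finrank ℂ (∀ a, Matrix (N (hd a)) (M (tl a)) ℂ) = ∑ a, crd M (tl a) * crd N (hd a) := by
  rw [Module.finrank_pi_fintype]
  refine Finset.sum_congr rfl fun x _ => ?_
  rw [Module.finrank_matrix]; simp [crd, mul_comm]

theorem euler_eq (M N : V → Type) [∀ x, Fintype (M x)] [∀ x, Fintype (N x)] :
    euler tl hd (crd M) (crd N) = (finrank ℂ (∀ x, Matrix (N x) (M x) ℂ) : ℤ) -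
      finrank ℂ (∀ a, Matrix (N (hd a)) (M (tl a)) ℂ) := by
  rw [finrank_U, finrank_W, euler]; push_cast; rfl

theorem euler_le_hom (R : Rep tl hd M) (S : Rep tl hd N) :
    euler tl hd (crd M) (crd N) ≤ hom R S := by
  rw [euler_eq, hom]
  have h1 := LinearMap.finrank_range_add_finrank_ker (Dm R S)
  have h2 := Submodule.finrank_le (LinearMap.range (Dm R S))
  omega

theorem hom_semicont (R0 R1 : Rep tl hd M) (S0 S1 : Rep tl hd N) (t0 : ℂ) :
    ∀ᶠ t : ℂ in Filter.cofinite, hom (R0 + t • R1) (S0 + t • S1) ≤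
      hom (R0 + t0 • R1) (S0 + t0 • S1) := by
  have h := ker_semicont (Dm R0 S0) (Dm R1 S1) t0
  filter_upwards [h] with t ht
  unfold hom
  rw [Dm_line, Dm_line]
  exact ht

variable {ι : V → Type} [∀ x, Fintype (ι x)] [∀ x, DecidableEq (ι x)]

def HasSub (κ : V → Type) [∀ x, Fintype (κ x)] [∀ x, DecidableEq (κ x)] (R : Rep tl hd ι) : Prop :=
  ∃ (Y : Rep tl hd κ) (B : ∀ x, Matrix (ι x) (κ x) ℂ) (L : ∀ x, Matrix (κ x) (ι x) ℂ),
    (∀ x, L x * B x = 1) ∧ ∀ a, R a * B (tl a) = B (hd a) * Y a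

variable {κ : V → Type} [∀ x, Fintype (κ x)] [∀ x, DecidableEq (κ x)]
open Matrix in
theorem HasSub.ortho {R : Rep tl hd ι} (h : HasSub κ R) :
    ∃ (Y : Rep tl hd κ) (B : ∀ x, Matrix (ι x) (κ x) ℂ),
    (∀ x, (B x)ᴴ * B x = 1) ∧ ∀ a, R a * B (tl a) = B (hd a) * Y a := by
  obtain ⟨Y, B, L, h1, h2⟩ := h
  choose C C' h3 h4 h5 using fun x => exists_orthonormalize (B x) (L x) (h1 x)
  refine ⟨fun a => C' (hd a) * Y a * C (tl a), fun x => B x * C x, h5, fun a => ?_⟩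
  rw [← Matrix.mul_assoc, h2, Matrix.mul_assoc (B (hd a)) (C (hd a)),
    ← Matrix.mul_assoc (C (hd a)), ← Matrix.mul_assoc (C (hd a)), h3, Matrix.one_mul,
    Matrix.mul_assoc]

theorem HasSub.trans {M' : V → Type} [∀ x, Fintype (M' x)] [∀ x, DecidableEq (M' x)]
    {R : Rep tl hd ι} {Y : Rep tl hd κ} (B : ∀ x, Matrix (ι x) (κ x) ℂ)
    (L : ∀ x, Matrix (κ x) (ι x) ℂ) (h1 : ∀ x, L x * B x = 1)
    (h2 : ∀ a, R a * B (tl a) = B (hd a) * Y a) (h : HasSub M' Y) : HasSub M' R := by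
  obtain ⟨Y', B', L', h3, h4⟩ := h
  refine ⟨Y', fun x => B x * B' x, fun x => L' x * L x, fun x => ?_, fun a => ?_⟩
  · rw [Matrix.mul_assoc, ← Matrix.mul_assoc (L x), h1, Matrix.one_mul, h3]
  · rw [← Matrix.mul_assoc, h2, Matrix.mul_assoc, h4, Matrix.mul_assoc]

open Matrix in
theorem HasSub.card_le {R : Rep tl hd ι} (h : HasSub κ R) (x : V) : crd κ x ≤ crd ι x := by
  obtain ⟨Y, B, L, h1, h2⟩ := h
  have h3 : (L x * B x).rank = Fintype.card (κ x) := by rw [h1]; simp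
  have h4 := Matrix.rank_mul_le_left (L x) (B x)
  have h6 := (L x).rank_le_card_width
  unfold crd; omega

open Matrix in
theorem hasSub_closed : IsClosed {R : Rep tl hd ι | HasSub κ R} := by
  let K : Set (∀ x, Matrix (ι x) (κ x) ℂ) := {B | ∀ x, (B x)ᴴ * B x = 1}
  have hK : IsCompact K := by
    have h1 : IsCompact (Set.pi Set.univ (fun x : V => (Set.pi Set.univ (fun _ : ι x =>
        Set.pi Set.univ fun _ : κ x => Metric.closedBall (0:ℂ) 1) : Set (Matrix (ι x) (κ x) ℂ)))) :=
      isCompact_univ_pi fun x => isCompact_univ_pi fun i => isCompact_univ_pi fun j =>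
        isCompact_closedBall _ _
    refine h1.of_isClosed_subset ?_ ?_
    · have : K = ⋂ x, {B : ∀ x, Matrix (ι x) (κ x) ℂ | (B x)ᴴ * B x = 1} := by ext; simp [K]
      rw [this]
      refine isClosed_iInter fun x => isClosed_eq ?_ continuous_const
      fun_prop
    · intro (B : ∀ x, Matrix (ι x) (κ x) ℂ) hB x _ i _ j _
      have h2 := congrFun (congrFun (hB x) j) j
      rw [Matrix.mul_apply, Matrix.one_apply_eq] at h2
      have h3 : ∑ i, ‖B x i j‖ ^ 2 = 1 := by
        have : ∀ i, (B x)ᴴ j i * B x i j = ((‖B x i j‖ ^ 2 : ℝ) : ℂ) := by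
          intro i
          rw [Matrix.conjTranspose_apply, Complex.star_def, Complex.conj_mul']
          simp
        simp only [this] at h2
        exact_mod_cast h2
      have h4 : ‖B x i j‖ ^ 2 ≤ 1 := by
        rw [← h3]
        exact Finset.single_le_sum (f := fun i => ‖B x i j‖ ^ 2) (fun i _ => by positivity) (Finset.mem_univ i)
      rw [mem_closedBall_zero_iff]
      nlinarith [norm_nonneg (B x i j)]
  have : CompactSpace K := isCompact_iff_compactSpace.1 hK
  let Z : Set (Rep tl hd ι × K) := {p | ∀ a, p.1 a * p.2.1 (tl a) =
    p.2.1 (hd a) * (p.2.1 (hd a))ᴴ * p.1 a * p.2.1 (tl a)}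
  have hZ : IsClosed Z := by
    have : Z = ⋂ a, {p | p.1 a * p.2.1 (tl a) =
      p.2.1 (hd a) * (p.2.1 (hd a))ᴴ * p.1 a * p.2.1 (tl a)} := by ext; simp [Z]
    rw [this]
    have c1 : ∀ a, Continuous fun p : Rep tl hd ι × K => p.1 a := fun a => by fun_prop
    have c2 : ∀ x, Continuous fun p : Rep tl hd ι × K => p.2.1 x := fun x =>
      (continuous_apply x).comp (continuous_subtype_val.comp continuous_snd)
    refine isClosed_iInter fun a => isClosed_eq ((c1 a).matrix_mul (c2 _)) ?_
    exact (((c2 _).matrix_mul (c2 _).matrix_conjTranspose).matrix_mul (c1 a)).matrix_mul (c2 _)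
  have h := isClosedMap_fst_of_compactSpace _ hZ
  convert h using 1
  ext R
  constructor
  · intro hR
    obtain ⟨Y, B, h1, h2⟩ := HasSub.ortho hR
    refine ⟨(R, ⟨B, h1⟩), ?_, rfl⟩
    intro a
    simp only
    rw [Matrix.mul_assoc _ (R a), h2, Matrix.mul_assoc, ← Matrix.mul_assoc _ (B (hd a)), h1,
      Matrix.one_mul]
  · rintro ⟨⟨R', B, h1⟩, hz, rfl⟩
    refine ⟨fun a => (B (hd a))ᴴ * R' a * B (tl a), B, fun x => (B x)ᴴ, h1, fun a => ?_⟩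
    have := hz a
    simp only at this
    rw [this]
    simp only [Matrix.mul_assoc]

end quiver
end HK
end

open Module

set_option linter.unusedSectionVars false
noncomputable section
namespace HK

theorem exists_idem_factor {m : Type} [Fintype m] [DecidableEq m] (E : Matrix m m ℂ)
    (hE : E * E = E) {k : ℕ} (hk : E.trace = k) :
    ∃ (a : Matrix m (Fin k) ℂ) (b : Matrix (Fin k) m ℂ), a * b = E ∧ b * a = 1 := by
  obtain ⟨a, b, a', b', h, ha, hb⟩ := exists_rank_factor E
  have h1 : b * a = 1 := by
    calc b * a = (a' * a) * (b * a) * (b * b') := by rw [ha, hb]; simp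
      _ = a' * ((a * b) * (a * b)) * b' := by simp only [Matrix.mul_assoc]
      _ = a' * (a * b) * b' := by rw [← h, hE]
      _ = (a' * a) * (b * b') := by simp only [Matrix.mul_assoc]
      _ = 1 := by rw [ha, hb, Matrix.one_mul]
  have h2 : E.rank = k := by
    have : E.trace = (E.rank : ℂ) := by
      have h3 : E.trace = (a * b).trace := congrArg _ h
      rw [h3, Matrix.trace_mul_comm, h1]; simp
    rw [hk] at this
    exact_mod_cast this.symm
  generalize E.rank = q at *
  subst h2
  exact ⟨a, b, h.symm, h1⟩

theorem kercok {m n : Type} [Fintype m] [Fintype n] [DecidableEq m] [DecidableEq n]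
    (φ : Matrix m n ℂ) {k c : ℕ} (hk : k + φ.rank = Fintype.card n)
    (hc : c + φ.rank = Fintype.card m) :
    ∃ (g : Matrix n m ℂ) (K : Matrix n (Fin k) ℂ) (K' : Matrix (Fin k) n ℂ)
      (C : Matrix (Fin c) m ℂ) (C' : Matrix m (Fin c) ℂ),
      φ * g * φ = φ ∧ φ * K = 0 ∧ K' * K = 1 ∧ K * K' = 1 - g * φ ∧
      C * φ = 0 ∧ C * C' = 1 ∧ C' * C = 1 - φ * g := by
  obtain ⟨P, Q, P', Q', h, hP, hQ⟩ := exists_rank_factor φ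
  have hg : φ * (Q' * P') * φ = φ := by
    calc φ * (Q' * P') * φ = (P * Q) * (Q' * P') * (P * Q) := by rw [← h]
      _ = P * (Q * Q') * (P' * P) * Q := by simp only [Matrix.mul_assoc]
      _ = φ := by rw [hP, hQ, Matrix.mul_one, Matrix.mul_one, ← h]
  have h1 : (Q' * P') * φ = Q' * Q := by
    calc (Q' * P') * φ = (Q' * P') * (P * Q) := by rw [← h]
      _ = Q' * (P' * P) * Q := by simp only [Matrix.mul_assoc]
      _ = _ := by rw [hP, Matrix.mul_one]
  have h2 : φ * (Q' * P') = P * P' := by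
    calc φ * (Q' * P') = (P * Q) * (Q' * P') := by rw [← h]
      _ = P * (Q * Q') * P' := by simp only [Matrix.mul_assoc]
      _ = _ := by rw [hQ, Matrix.mul_one]
  obtain ⟨K, K', hK, hK'⟩ := exists_idem_factor (1 - Q' * Q) (k := k) (by
    have : Q' * Q * (Q' * Q) = Q' * Q := by
      calc Q' * Q * (Q' * Q) = Q' * (Q * Q') * Q := by simp only [Matrix.mul_assoc]
        _ = _ := by rw [hQ, Matrix.mul_one]
    simp [Matrix.sub_mul, Matrix.mul_sub, this]) (by
    rw [Matrix.trace_sub, Matrix.trace_mul_comm, hQ]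
    simp [← hk])
  obtain ⟨C', C, hC, hC'⟩ := exists_idem_factor (1 - P * P') (k := c) (by
    have : P * P' * (P * P') = P * P' := by
      calc P * P' * (P * P') = P * (P' * P) * P' := by simp only [Matrix.mul_assoc]
        _ = _ := by rw [hP, Matrix.mul_one]
    simp [Matrix.sub_mul, Matrix.mul_sub, this]) (by
    rw [Matrix.trace_sub, Matrix.trace_mul_comm, hP]
    simp [← hc])
  refine ⟨Q' * P', K, K', C, C', hg, ?_, hK', ?_, ?_, hC', ?_⟩
  · calc φ * K = φ * (K * K') * K := by rw [Matrix.mul_assoc, Matrix.mul_assoc, hK', Matrix.mul_one]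
      _ = 0 := by rw [hK, ← h1, Matrix.mul_sub, ← Matrix.mul_assoc φ, hg]; simp
  · rw [hK, h1]
  · calc C * φ = C * (C' * C) * φ := by rw [← Matrix.mul_assoc C, hC', Matrix.one_mul]
      _ = 0 := by rw [hC, ← h2, Matrix.mul_assoc, Matrix.sub_mul, hg]; simp
  · rw [hC, h2]

section quiver
variable {V A : Type} {tl hd : A → V} [Fintype V] [Fintype A]
  {M N : V → Type} [∀ x, Fintype (M x)] [∀ x, Fintype (N x)]
  [∀ x, DecidableEq (M x)] [∀ x, DecidableEq (N x)]

theorem hasSub_self (R : Rep tl hd M) : HasSub (fun x => Fin (crd M x)) R := by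
  let e : ∀ x, M x ≃ Fin (crd M x) := fun x => Fintype.equivFin (M x)
  refine ⟨fun a => (R a).submatrix (e _).symm (e _).symm,
    fun x => (1 : Matrix (M x) (M x) ℂ).submatrix id (e x).symm,
    fun x => (1 : Matrix (M x) (M x) ℂ).submatrix (e x).symm id, fun x => ?_, fun a => ?_⟩
  · rw [← Matrix.submatrix_mul _ _ _ _ _ Function.bijective_id]; simp
  · have h1 : (1 : Matrix (M (hd a)) (M (hd a)) ℂ).submatrix id (e (hd a)).symm *
        (R a).submatrix (e (hd a)).symm (e (tl a)).symm = (R a).submatrix id (e (tl a)).symm := by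
      rw [← Matrix.submatrix_mul _ _ _ _ _ (e (hd a)).symm.bijective]; simp
    rw [h1]
    ext i j
    simp [Matrix.mul_apply, Matrix.one_apply]

/-- kernel subrepresentation -/
theorem ker_sub {R : Rep tl hd M} {S : Rep tl hd N} {φ : ∀ x, Matrix (N x) (M x) ℂ}
    (hφ : Dm R S φ = 0) {k : V → ℕ} (hk : ∀ x, k x + (φ x).rank = crd M x) :
    ∃ (Y : Rep tl hd (fun x => Fin (k x))) (B : ∀ x, Matrix (M x) (Fin (k x)) ℂ)
      (L : ∀ x, Matrix (Fin (k x)) (M x) ℂ), (∀ x, L x * B x = 1) ∧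
      ∀ a, R a * B (tl a) = B (hd a) * Y a := by
  have hc : ∀ x, ∃ c, c + (φ x).rank = Fintype.card (N x) := fun x =>
    ⟨_, Nat.sub_add_cancel (φ x).rank_le_card_height⟩
  choose c hc using hc
  choose g K K' C C' h1 h2 h3 h4 h5 h6 h7 using fun x => kercok (φ x) (hk x) (hc x)
  refine ⟨fun a => K' (hd a) * R a * K (tl a), K, K', h3, fun a => ?_⟩
  have h8 : φ (hd a) * R a = S a * φ (tl a) := sub_eq_zero.1 (congrFun hφ a)
  calc R a * K (tl a) = (K (hd a) * K' (hd a) + g (hd a) * φ (hd a)) * (R a * K (tl a)) := by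
        rw [h4]; simp
    _ = K (hd a) * (K' (hd a) * R a * K (tl a)) + g (hd a) * (φ (hd a) * R a) * K (tl a) := by
        simp only [Matrix.add_mul, Matrix.mul_assoc]
    _ = _ := by
        rw [h8]
        simp only [Matrix.mul_assoc, h2, Matrix.mul_zero, add_zero]

theorem hom_sub_le {κ γ : V → Type} [∀ x, Fintype (κ x)] [∀ x, Fintype (γ x)]
    [∀ x, DecidableEq (γ x)]
    (K : Rep tl hd κ) {S : Rep tl hd N} {Y : Rep tl hd γ} {B : ∀ x, Matrix (N x) (γ x) ℂ}
    {L : ∀ x, Matrix (γ x) (N x) ℂ} (h1 : ∀ x, L x * B x = 1)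
    (h2 : ∀ a, S a * B (tl a) = B (hd a) * Y a) : hom K Y ≤ hom K S := by
  let F : (∀ x, Matrix (γ x) (κ x) ℂ) →ₗ[ℂ] (∀ x, Matrix (N x) (κ x) ℂ) :=
    { toFun := fun ψ x => B x * ψ x
      map_add' := fun ψ ψ' => by funext x; simp [Matrix.mul_add]
      map_smul' := fun c ψ => by funext x; simp }
  have hF : ∀ ψ ∈ LinearMap.ker (Dm K Y), F ψ ∈ LinearMap.ker (Dm K S) := by
    intro ψ hψ
    rw [LinearMap.mem_ker] at hψ ⊢
    funext a
    have h3 : ψ (hd a) * K a - Y a * ψ (tl a) = 0 := congrFun hψ a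
    show B (hd a) * ψ (hd a) * K a - S a * (B (tl a) * ψ (tl a)) = 0
    rw [← Matrix.mul_assoc (S a), h2, Matrix.mul_assoc, Matrix.mul_assoc, ← Matrix.mul_sub, h3,
      Matrix.mul_zero]
  have hinj : Function.Injective F := by
    intro ψ ψ' h
    funext x
    have h3 : B x * ψ x = B x * ψ' x := congrFun h x
    calc ψ x = L x * (B x * ψ x) := by rw [← Matrix.mul_assoc, h1, Matrix.one_mul]
      _ = ψ' x := by rw [h3, ← Matrix.mul_assoc, h1, Matrix.one_mul]
  refine LinearMap.finrank_le_finrank_of_injective (f := F.restrict hF) ?_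
  intro a b hab
  apply Subtype.ext
  apply hinj
  exact congrArg Subtype.val hab

/-- image subrepresentation -/
theorem euler_le_of_image {κ : V → Type} [∀ x, Fintype (κ x)] (K : Rep tl hd κ)
    {R : Rep tl hd M} {S : Rep tl hd N} {φ : ∀ x, Matrix (N x) (M x) ℂ}
    (hφ : Dm R S φ = 0) : euler tl hd (crd κ) (fun x => (φ x).rank) ≤ hom K S := by
  choose P Q P' Q' h hP hQ using fun x => exists_rank_factor (φ x)
  let Y : Rep tl hd (fun x => Fin (φ x).rank) := fun a => Q (hd a) * R a * Q' (tl a)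
  have h8 : ∀ a, φ (hd a) * R a = S a * φ (tl a) := fun a => sub_eq_zero.1 (congrFun hφ a)
  have h9 : ∀ a, S a * P (tl a) = P (hd a) * Y a := by
    intro a
    calc S a * P (tl a) = S a * (P (tl a) * Q (tl a)) * Q' (tl a) := by
          rw [Matrix.mul_assoc, Matrix.mul_assoc, hQ, Matrix.mul_one]
      _ = S a * φ (tl a) * Q' (tl a) := by rw [← h]
      _ = (P (hd a) * Q (hd a)) * R a * Q' (tl a) := by rw [← h8, ← h]
      _ = _ := by simp only [Y, Matrix.mul_assoc]
  have h10 := hom_sub_le (Y := Y) (B := P) (L := P') K hP h9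
  have h11 := euler_le_hom K Y
  have h12 : crd (fun x => Fin (φ x).rank) = fun x => (φ x).rank := by
    funext x; simp [crd]
  rw [h12] at h11
  exact h11.trans (by exact_mod_cast h10)

end quiver
end HK
end

open Module

set_option linter.unusedSectionVars false
noncomputable section
namespace HK

section quiver
variable {V A : Type} {tl hd : A → V} [Fintype V] [Fintype A]
  {M N : V → Type} [∀ x, Fintype (M x)] [∀ x, Fintype (N x)]
  [∀ x, DecidableEq (M x)] [∀ x, DecidableEq (N x)]

structure Extremal (R0 : Rep tl hd M) (S0 : Rep tl hd N) (φ0 : ∀ x, Matrix (N x) (M x) ℂ) : Prop where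
  ker : Dm R0 S0 φ0 = 0
  min : ∀ R S, hom R0 S0 ≤ hom (tl := tl) (hd := hd) (M := M) (N := N) R S
  max : ∀ (R : Rep tl hd M) (S : Rep tl hd N) φ, hom R S = hom R0 S0 → Dm R S φ = 0 →
    ∑ x, (φ x).rank ≤ ∑ x, (φ0 x).rank

theorem exists_extremal : ∃ (R0 : Rep tl hd M) (S0 : Rep tl hd N) (φ0 : ∀ x, Matrix (N x) (M x) ℂ),
    Extremal R0 S0 φ0 := by
  let f : Rep tl hd M × Rep tl hd N → ℕ := fun p => hom p.1 p.2
  let p0 := Function.argmin f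
  have hp0 : ∀ q, f p0 ≤ f q := fun q => Function.argmin_le f q
  let T := {q : (Rep tl hd M × Rep tl hd N) × (∀ x, Matrix (N x) (M x) ℂ) //
    hom q.1.1 q.1.2 = f p0 ∧ Dm q.1.1 q.1.2 q.2 = 0}
  have : Nonempty T := ⟨⟨(p0, 0), rfl, by simp⟩⟩
  let B := ∑ x, crd M x
  let g : T → ℕ := fun q => B - ∑ x, (q.1.2 x).rank
  let q0 := Function.argmin g
  have hq0 : ∀ q, g q0 ≤ g q := fun q => Function.argmin_le g q
  have hB : ∀ φ : ∀ x, Matrix (N x) (M x) ℂ, ∑ x, (φ x).rank ≤ B := fun φ =>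
    Finset.sum_le_sum fun x _ => (φ x).rank_le_card_width
  refine ⟨q0.1.1.1, q0.1.1.2, q0.1.2, q0.2.2, fun R S => ?_, fun R S φ h1 h2 => ?_⟩
  · rw [q0.2.1]; exact hp0 (R, S)
  · have h3 := hq0 ⟨((R, S), φ), h1.trans q0.2.1, h2⟩
    have h4 := hB φ
    have h5 := hB q0.1.2
    simp only [g] at h3
    omega

namespace Extremal
variable {R0 : Rep tl hd M} {S0 : Rep tl hd N} {φ0 : ∀ x, Matrix (N x) (M x) ℂ}

theorem polyC_entry {Nn : ℂ → ∀ x, Matrix (N x) (M x) ℂ} (hN : PolyC Nn) (x : V) (i : N x) (j : M x) :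
    PolyFn (fun t => Nn t x i j) :=
  hN { toFun := fun φ => φ x i j
       map_add' := fun _ _ => rfl
       map_smul' := fun _ _ => rfl }

theorem rank_eq (E : Extremal R0 S0 φ0) (R1 : Rep tl hd M) (S1 : Rep tl hd N)
    {Nn : ℂ → ∀ x, Matrix (N x) (M x) ℂ} (hN : PolyC Nn)
    (h : ∀ᶠ t : ℂ in Filter.cofinite, Dm (R0 + t • R1) (S0 + t • S1) (φ0 + t • Nn t) = 0) :
    ∀ᶠ t : ℂ in Filter.cofinite, ∀ x, ((φ0 + t • Nn t) x).rank = (φ0 x).rank := by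
  have h1 : ∀ᶠ t : ℂ in Filter.cofinite, ∀ x, (φ0 x).rank ≤ ((φ0 + t • Nn t) x).rank := by
    rw [Filter.eventually_all]
    intro x
    have := rank_semicont (M := fun t : ℂ => (φ0 + t • Nn t) x) (by
      intro i j
      exact (PolyFn.const (φ0 x i j)).add (PolyFn.id'.mul (polyC_entry hN x i j))) 0
    filter_upwards [this] with t ht
    simpa using ht
  filter_upwards [h, h1, hom_semicont R0 R1 S0 S1 0] with t ht h1t h2t
  have h3 : hom (R0 + t • R1) (S0 + t • S1) = hom R0 S0 := by
    apply le_antisymm _ (E.min _ _)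
    simpa using h2t
  have h4 := E.max _ _ _ h3 ht
  have h5 := (Finset.sum_eq_sum_iff_of_le (fun x _ => h1t x)).1
    (le_antisymm (Finset.sum_le_sum fun x _ => h1t x) h4)
  intro x
  exact (h5 x (Finset.mem_univ x)).symm

theorem curve (E : Extremal R0 S0 φ0) (R1 : Rep tl hd M) (S1 : Rep tl hd N) :
    ∃ Nn : ℂ → ∀ x, Matrix (N x) (M x) ℂ, PolyC Nn ∧
    (∀ᶠ t : ℂ in Filter.cofinite, Dm (R0 + t • R1) (S0 + t • S1) (φ0 + t • Nn t) = 0) ∧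
    Dm R0 S0 (Nn 0) + Dm R1 S1 φ0 = 0 := by
  obtain ⟨Nn, h1, h2, h3⟩ := pencil (Dm R0 S0) (Dm R1 S1) (fun t => by
    rw [← Dm_line]; exact E.min _ _) φ0 E.ker
  refine ⟨Nn, h1, ?_, h3⟩
  filter_upwards [h2] with t ht
  rw [Dm_line]; exact ht

theorem tangent (E : Extremal R0 S0 φ0) (R1 : Rep tl hd M) (S1 : Rep tl hd N)
    {Nn : ℂ → ∀ x, Matrix (N x) (M x) ℂ} (hN : PolyC Nn)
    (h : ∀ᶠ t : ℂ in Filter.cofinite, Dm (R0 + t • R1) (S0 + t • S1) (φ0 + t • Nn t) = 0)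
    (x : V) {k c : Type} [Fintype k] [Fintype c] (K : Matrix (M x) k ℂ) (C : Matrix c (N x) ℂ)
    (hK : φ0 x * K = 0) (hC : C * φ0 x = 0) : C * Nn 0 x * K = 0 := by
  have h1 := E.rank_eq R1 S1 hN h
  ext i j
  obtain ⟨u, hu⟩ := HK.tangent (φ0 x) (fun t => Nn t x) (polyC_entry hN x) (by
    filter_upwards [h1] with t ht
    exact (ht x).le) (fun i => K i j) (by
    ext i; exact congrFun (congrFun hK i) j)
  have h2 : (fun i => (C * Nn 0 x * K) i j) = C.mulVec ((Nn 0 x).mulVec (fun i => K i j)) := by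
    rw [Matrix.mulVec_mulVec]; rfl
  have h3 := congrFun h2 i
  rw [← hu, Matrix.mulVec_mulVec, hC] at h3
  simpa using h3

theorem bound (E : Extremal R0 S0 φ0) {k c : V → ℕ} (hk : ∀ x, k x + (φ0 x).rank = crd M x)
    (hc : ∀ x, c x + (φ0 x).rank = crd N x) :
    (hom R0 S0 : ℤ) ≤ euler tl hd (crd M) (crd N) - euler tl hd k c := by
  choose g K K' C C' h1 h2 h3 h4 h5 h6 h7 using fun x => kercok (φ0 x) (hk x) (hc x)
  let Tu : (∀ x, Matrix (N x) (M x) ℂ) →ₗ[ℂ] (∀ x, Matrix (Fin (c x)) (Fin (k x)) ℂ) :=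
    { toFun := fun ψ x => C x * ψ x * K x
      map_add' := fun ψ ψ' => by funext x; simp [Matrix.mul_add, Matrix.add_mul]
      map_smul' := fun c ψ => by funext x; simp }
  let Tw : (∀ a, Matrix (N (hd a)) (M (tl a)) ℂ) →ₗ[ℂ]
      (∀ a, Matrix (Fin (c (hd a))) (Fin (k (tl a))) ℂ) :=
    { toFun := fun ψ a => C (hd a) * ψ a * K (tl a)
      map_add' := fun ψ ψ' => by funext x; simp [Matrix.mul_add, Matrix.add_mul]
      map_smul' := fun c ψ => by funext x; simp }
  have sTu : LinearMap.range Tu = ⊤ := by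
    rw [LinearMap.range_eq_top]
    intro ψ
    refine ⟨fun x => C' x * ψ x * K' x, ?_⟩
    funext x
    show C x * (C' x * ψ x * K' x) * K x = ψ x
    calc _ = (C x * C' x) * ψ x * (K' x * K x) := by simp only [Matrix.mul_assoc]
      _ = _ := by rw [h6, h3, Matrix.one_mul, Matrix.mul_one]
  have fTu := LinearMap.finrank_range_add_finrank_ker Tu
  have fTw := LinearMap.finrank_range_add_finrank_ker Tw
  have fTw' := Submodule.finrank_le (LinearMap.range Tw)
  rw [sTu, finrank_top] at fTu
  have e1 := euler_eq (tl := tl) (hd := hd) M N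
  have e2 := euler_eq (tl := tl) (hd := hd) (fun x => Fin (k x)) (fun x => Fin (c x))
  have e3 : ∀ q : V → ℕ, crd (fun x => Fin (q x)) = q := by intro q; funext x; simp [crd]
  rw [e3, e3] at e2
  have hkT : LinearMap.ker (Dm R0 S0) ≤ LinearMap.ker Tu := by
    intro φ' hφ'
    rw [LinearMap.mem_ker] at hφ' ⊢
    funext x
    refine E.tangent 0 0 (Nn := fun _ => φ') (fun l => PolyFn.const _) ?_ x (K x) (C x) (h2 x) (h5 x)
    refine Filter.Eventually.of_forall fun t => ?_
    simp [hφ', E.ker]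
  have hw : LinearMap.ker Tw ≤ (LinearMap.ker Tu).map (Dm R0 S0) := by
    intro w hw
    rw [LinearMap.mem_ker] at hw
    let R1 : Rep tl hd M := fun a => g (hd a) * w a
    let S1 : Rep tl hd N := fun a => -((1 - φ0 (hd a) * g (hd a)) * w a * g (tl a))
    have hw' : Dm R1 S1 φ0 = w := by
      funext a
      have hwa : C (hd a) * w a * K (tl a) = 0 := congrFun hw a
      have h8 : (1 - φ0 (hd a) * g (hd a)) * w a * (1 - g (tl a) * φ0 (tl a)) = 0 := by
        rw [← h7, ← h4]
        calc _ = C' (hd a) * (C (hd a) * w a * K (tl a)) * K' (tl a) := by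
              simp only [Matrix.mul_assoc]
          _ = 0 := by rw [hwa]; simp
      rw [Matrix.mul_sub, Matrix.mul_one, sub_eq_zero] at h8
      show φ0 (hd a) * (g (hd a) * w a) -
        -((1 - φ0 (hd a) * g (hd a)) * w a * g (tl a)) * φ0 (tl a) = w a
      rw [Matrix.neg_mul, sub_neg_eq_add, Matrix.mul_assoc _ (g (tl a)), ← h8, Matrix.sub_mul,
        Matrix.one_mul, Matrix.mul_assoc]
      abel
    obtain ⟨Nn, c1, c2, c3⟩ := E.curve R1 S1
    refine ⟨-Nn 0, ?_, ?_⟩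
    · apply neg_mem
      show Tu (Nn 0) = 0
      funext x
      exact E.tangent R1 S1 c1 c2 x (K x) (C x) (h2 x) (h5 x)
    · rw [map_neg, ← hw']
      exact neg_eq_of_add_eq_zero_right c3
  have f1 := LinearMap.finrank_range_add_finrank_ker ((Dm R0 S0).domRestrict (LinearMap.ker Tu))
  rw [LinearMap.range_domRestrict, LinearMap.ker_domRestrict,
    (Submodule.comapSubtypeEquivOfLe hkT).finrank_eq] at f1
  have f2 := Submodule.finrank_mono hw
  unfold hom
  omega

end Extremal

theorem euler_add_right (k c d : V → ℕ) :
    euler tl hd k (fun x => c x + d x) = euler tl hd k c + euler tl hd k d := by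
  simp only [euler, Nat.cast_add, mul_add, Finset.sum_add_distrib]; ring

theorem thmQ (N : V → Type) [∀ x, Fintype (N x)] [∀ x, DecidableEq (N x)] (e : ℤ) :
    ∀ (m : ℕ) (M : V → Type) [∀ x, Fintype (M x)] [∀ x, DecidableEq (M x)], ∑ x, crd M x = m →
      (∀ (R : Rep tl hd M) (S : Rep tl hd N), e ≤ hom R S - euler tl hd (crd M) (crd N)) →
      ∀ R : Rep tl hd M, ∃ k' : V → ℕ, HasSub (fun x => Fin (k' x)) R ∧
        e ≤ - euler tl hd k' (crd N) := by
  intro m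
  classical
  induction m using Nat.strong_induction_on with
  | _ m ih =>
  intro M _ _ hm he R
  obtain ⟨R0, S0, φ0, E⟩ := exists_extremal (tl := tl) (hd := hd) (M := M) (N := N)
  by_cases h0 : ∑ x, (φ0 x).rank = 0
  · -- hom is zero
    have hh : hom R0 S0 = 0 := by
      unfold hom
      rw [Submodule.finrank_eq_zero, eq_bot_iff]
      intro φ hφ
      have h1 := E.max R0 S0 φ rfl hφ
      rw [h0, Nat.le_zero, Finset.sum_eq_zero_iff] at h1
      rw [Submodule.mem_bot]
      funext x
      have h2 : finrank ℂ (LinearMap.range (φ x).mulVecLin) = 0 := h1 x (Finset.mem_univ x)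
      rw [Submodule.finrank_eq_zero, LinearMap.range_eq_bot] at h2
      ext i j
      have h3 := congrFun (LinearMap.congr_fun h2 (Pi.single j 1)) i
      simpa using h3
    refine ⟨crd M, hasSub_self R, ?_⟩
    have := he R0 S0
    rw [hh] at this
    simpa using this
  have hk : ∀ x, ∃ k, k + (φ0 x).rank = crd M x := fun x =>
    ⟨_, Nat.sub_add_cancel (φ0 x).rank_le_card_width⟩
  choose k hk using hk
  have hc : ∀ x, ∃ c, c + (φ0 x).rank = crd N x := fun x =>
    ⟨_, Nat.sub_add_cancel (φ0 x).rank_le_card_height⟩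
  choose c hc using hc
  have hb := E.bound hk hc
  have he0 := he R0 S0
  have hsum : ∑ x, k x + ∑ x, (φ0 x).rank = m := by
    rw [← Finset.sum_add_distrib, ← hm]; exact Finset.sum_congr rfl fun x _ => hk x
  have hcN : crd N = fun x => c x + (φ0 x).rank := by funext x; exact (hc x).symm
  have hcrd : crd (fun x => Fin (k x)) = k := by funext x; simp [crd]
  have hQ := ih (∑ x, k x) (by omega) (fun x => Fin (k x)) (by rw [hcrd]) (by
    intro K S
    have h1 : euler tl hd k (fun x => (φ0 x).rank) ≤ hom K S := by
      obtain ⟨Nn, c1, c2, -⟩ := E.curve 0 (S - S0)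
      have c3 := E.rank_eq _ _ c1 c2
      obtain ⟨t, ⟨t1, t2⟩, t3⟩ := ((c2.and c3).and (hom_semicont K 0 S0 (S - S0) 1)).exists
      have h2 := euler_le_of_image K t1
      simp only [t2, hcrd] at h2
      simp only [smul_zero, add_zero, one_smul, add_sub_cancel] at t3
      exact h2.trans (by exact_mod_cast t3)
    rw [hcrd, hcN, euler_add_right]
    rw [hcN] at hb he0
    omega)
  let F : Set (V → ℕ) := {k' | k' ≤ crd M ∧ e ≤ - euler tl hd k' (crd N)}
  have hF : F.Finite := (Set.finite_Iic (crd M)).subset fun k' h => h.1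
  have hcl : IsClosed (⋃ k' ∈ F, {R : Rep tl hd M | HasSub (fun x => Fin (k' x)) R}) :=
    hF.isClosed_biUnion fun k' _ => hasSub_closed
  have hR := closed_line hcl (f := fun t : ℂ => R0 + t • (R - R0)) (by fun_prop) (by
    obtain ⟨Nn, c1, c2, -⟩ := E.curve (R - R0) 0
    have c3 := E.rank_eq _ _ c1 c2
    filter_upwards [c2, c3] with t t1 t2
    obtain ⟨Y, B, L, y1, y2⟩ := ker_sub t1 (k := k) (fun x => by rw [t2]; exact hk x)
    obtain ⟨k', z1, z2⟩ := hQ Y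
    have z3 := HasSub.trans B L y1 y2 z1
    refine Set.mem_biUnion (x := k') ⟨fun x => ?_, z2⟩ z3
    have := z3.card_le x
    simpa [crd] using this) 1
  simp only [one_smul, add_sub_cancel, Set.mem_iUnion] at hR
  obtain ⟨k', ⟨_, z2⟩, z1⟩ := hR
  exact ⟨k', z1, z2⟩

end quiver
end HK
end

open Module

set_option linter.unusedSectionVars false
noncomputable section
namespace HK

theorem mv_eq_zero_of_open {τ : Type} [Fintype τ] (f : MvPolynomial τ ℂ) (U : Set (τ → ℂ))
    (hU : IsOpen U) (hne : U.Nonempty) (h : ∀ y ∈ U, MvPolynomial.eval y f = 0) : f = 0 := by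
  obtain ⟨y, hy⟩ := hne
  obtain ⟨ε, hε, hb⟩ := Metric.isOpen_iff.1 hU y hy
  refine MvPolynomial.funext_set (fun i => Metric.ball (y i) ε) (fun i => ?_) fun x hx => ?_
  · exact (infinite_of_mem_nhds (y i) (Metric.ball_mem_nhds _ hε))
  · rw [map_zero]
    apply h
    apply hb
    rw [Metric.mem_ball, dist_pi_lt_iff hε]
    intro i
    exact hx i (Set.mem_univ i)

theorem dom {σ τ : Type} [Fintype σ] [Fintype τ] (p : τ → MvPolynomial σ ℂ) (U : Set (τ → ℂ))
    (hU : IsOpen U) (hne : U.Nonempty)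
    (h : U ⊆ Set.range (fun (a : σ → ℂ) i => MvPolynomial.eval a (p i))) :
    Dense (Set.range (fun (a : σ → ℂ) i => MvPolynomial.eval a (p i))) := by
  let f : MvPolynomial τ ℂ →ₐ[ℂ] MvPolynomial σ ℂ := MvPolynomial.aeval p
  have hev : ∀ (a : σ → ℂ) (q : MvPolynomial τ ℂ), MvPolynomial.eval a (f q) =
      MvPolynomial.eval (fun i => MvPolynomial.eval a (p i)) q := by
    intro a q
    simp only [f, MvPolynomial.aeval_def, MvPolynomial.eval]
    rw [← MvPolynomial.coe_eval₂Hom, ← RingHom.comp_apply, MvPolynomial.comp_eval₂Hom]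
    congr 1
    ext <;> simp
  have hinj : Function.Injective f := by
    rw [injective_iff_map_eq_zero]
    intro q hq
    apply mv_eq_zero_of_open q U hU hne
    intro y hy
    obtain ⟨a, rfl⟩ := h hy
    rw [← hev, hq, map_zero]
  have hfp : f.toRingHom.FinitePresentation := by
    refine RingHom.FinitePresentation.of_finiteType.1 ?_
    refine RingHom.FiniteType.of_comp_finiteType (f := algebraMap ℂ (MvPolynomial τ ℂ)) ?_
    have : f.toRingHom.comp (algebraMap ℂ (MvPolynomial τ ℂ)) = algebraMap ℂ _ := f.comp_algebraMap
    rw [this, RingHom.finiteType_algebraMap]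
    infer_instance
  obtain ⟨S, hS⟩ := PrimeSpectrum.exists_constructibleSetData_iff.2
    (PrimeSpectrum.isConstructible_range_comap hfp)
  have hbot : (⊥ : PrimeSpectrum (MvPolynomial τ ℂ)) ∈ S.toSet := by
    rw [hS]
    refine ⟨⊥, ?_⟩
    ext q
    simp only [PrimeSpectrum.comap_asIdeal, Ideal.mem_comap]
    show f q ∈ (⊥ : Ideal _) ↔ q ∈ (⊥ : Ideal _)
    simp only [Ideal.mem_bot]
    exact map_eq_zero_iff f hinj
  simp only [PrimeSpectrum.ConstructibleSetData.toSet, Set.mem_iUnion] at hbot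
  obtain ⟨C, hCS, hC⟩ := hbot
  have hg : ∀ i, C.g i = 0 := by
    intro i
    have h1 : C.g i ∈ (⊥ : Ideal (MvPolynomial τ ℂ)) := hC.1 ⟨i, rfl⟩
    simpa using h1
  have hf0 : C.f ≠ 0 := by
    intro h0
    apply hC.2
    simp [h0, PrimeSpectrum.mem_zeroLocus]
  have hlift : ∀ y : τ → ℂ, MvPolynomial.eval y C.f ≠ 0 →
      y ∈ Set.range (fun (a : σ → ℂ) i => MvPolynomial.eval a (p i)) := by
    intro y hy
    let q : PrimeSpectrum (MvPolynomial τ ℂ) := ⟨RingHom.ker (MvPolynomial.eval y),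
      RingHom.ker_isPrime _⟩
    have hq : q ∈ S.toSet := by
      simp only [PrimeSpectrum.ConstructibleSetData.toSet, Set.mem_iUnion]
      refine ⟨C, hCS, ?_, ?_⟩
      · rintro _ ⟨i, rfl⟩
        rw [hg]; exact zero_mem _
      · intro h1
        apply hy
        exact h1 rfl
    rw [hS] at hq
    obtain ⟨P, hP⟩ := hq
    obtain ⟨m, hm, hPm⟩ := P.asIdeal.exists_le_maximal P.2.ne_top
    obtain ⟨a, ha⟩ := MvPolynomial.isMaximal_iff_eq_vanishingIdeal_singleton.1 hm
    refine ⟨a, ?_⟩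
    funext i
    have h1 : (MvPolynomial.X i - MvPolynomial.C (y i) : MvPolynomial τ ℂ) ∈ q.asIdeal := by
      show MvPolynomial.eval y _ = 0
      simp
    rw [← hP] at h1
    have h2 := hPm h1
    rw [ha, MvPolynomial.mem_vanishingIdeal_singleton_iff] at h2
    have h3 : MvPolynomial.eval a (f (MvPolynomial.X i - MvPolynomial.C (y i))) = 0 := h2
    rw [hev] at h3
    simpa [sub_eq_zero] using h3
  rw [dense_iff_inter_open]
  intro U' hU' hne'
  by_contra hcon
  apply hf0
  refine mv_eq_zero_of_open _ U' hU' hne' fun y hy => ?_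
  by_contra h1
  exact hcon ⟨y, hy, hlift y h1⟩

theorem quad_open {E F : Type} [NormedAddCommGroup E] [NormedSpace ℂ E] [FiniteDimensional ℂ E]
    [NormedAddCommGroup F] [NormedSpace ℂ F] [FiniteDimensional ℂ F] (D : E →ₗ[ℂ] F)
    (hD : Function.Surjective D) (b : E →ₗ[ℂ] E →ₗ[ℂ] F) :
    Set.range (fun ψ => D ψ + b ψ ψ) ∈ nhds (0 : F) := by
  have : CompleteSpace E := FiniteDimensional.complete ℂ E
  have : CompleteSpace F := FiniteDimensional.complete ℂ F
  let D' := LinearMap.toContinuousLinearMap D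
  let b' : E →L[ℂ] E →L[ℂ] F := LinearMap.toContinuousLinearMap
    (LinearMap.toContinuousLinearMap.toLinearMap ∘ₗ b)
  have h1 : HasStrictFDerivAt (fun ψ => D ψ + b ψ ψ) D' 0 := by
    have h2 : HasStrictFDerivAt (fun ψ : E => b' ψ ψ)
        (b'.precompR E 0 (ContinuousLinearMap.id ℂ _) +
          b'.precompL E (ContinuousLinearMap.id ℂ _) 0) 0 :=
      b'.hasStrictFDerivAt_of_bilinear (hasStrictFDerivAt_id 0) (hasStrictFDerivAt_id 0)
    have h3 := (D'.hasStrictFDerivAt (x := 0)).add h2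
    have h5 : D' + (b'.precompR E 0 (ContinuousLinearMap.id ℂ _) +
          b'.precompL E (ContinuousLinearMap.id ℂ _) 0) = D' := by
      ext v
      simp
    rw [h5] at h3
    exact h3
  have h4 := h1.map_nhds_eq_of_surj (LinearMap.range_eq_top.2 hD)
  simp only [map_zero, add_zero] at h4
  rw [← h4]
  exact Filter.range_mem_map

theorem dom2 {σ τ : Type} [Fintype σ] [Fintype τ] [DecidableEq σ] (D : (σ → ℂ) →ₗ[ℂ] (τ → ℂ))
    (hD : Function.Surjective D) (b : (σ → ℂ) →ₗ[ℂ] (σ → ℂ) →ₗ[ℂ] (τ → ℂ)) :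
    Dense (Set.range (fun ψ => D ψ + b ψ ψ)) := by
  let p : τ → MvPolynomial σ ℂ := fun i =>
    ∑ j, MvPolynomial.C (D (Pi.single j 1) i) * MvPolynomial.X j +
    ∑ j, ∑ k, MvPolynomial.C (b (Pi.single j 1) (Pi.single k 1) i) * MvPolynomial.X j * MvPolynomial.X k
  have hp : (fun ψ => D ψ + b ψ ψ) = (fun (a : σ → ℂ) i => MvPolynomial.eval a (p i)) := by
    funext ψ i
    have h1 : ψ = ∑ j, ψ j • (Pi.single j 1 : σ → ℂ) := by
      ext j; simp [Finset.sum_apply, Pi.single_apply]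
    have h2 : D ψ = ∑ j, ψ j • D (Pi.single j 1) := by
      conv_lhs => rw [h1]
      simp
    have h3 : b ψ ψ = ∑ j, ∑ k, ψ j • ψ k • b (Pi.single j 1) (Pi.single k 1) := by
      have h4 : ∀ u, b ψ u = ∑ j, ψ j • b (Pi.single j 1) u := by
        intro u
        conv_lhs => rw [h1]
        simp [LinearMap.sum_apply]
      have h5 : ∀ u, b u ψ = ∑ j, ψ j • b u (Pi.single j 1) := by
        intro u
        conv_lhs => rw [h1]
        simp
      rw [h4]
      refine Finset.sum_congr rfl fun j _ => ?_
      rw [h5, Finset.smul_sum]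
    simp only [p, Pi.add_apply, h2, h3, Finset.sum_apply, Pi.smul_apply, smul_eq_mul, map_add,
      map_sum, map_mul, MvPolynomial.eval_C, MvPolynomial.eval_X]
    congr 1
    · exact Finset.sum_congr rfl fun j _ => mul_comm _ _
    · exact Finset.sum_congr rfl fun j _ => Finset.sum_congr rfl fun k _ => by ring
  have h0 := quad_open D hD b
  rw [hp] at h0 ⊢
  obtain ⟨U, hU, hUo, h0U⟩ := mem_nhds_iff.1 h0
  exact dom p U hUo ⟨0, h0U⟩ hU

theorem dom3 {E F : Type} [AddCommGroup E] [Module ℂ E] [FiniteDimensional ℂ E] [AddCommGroup F]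
    [Module ℂ F] [FiniteDimensional ℂ F] [TopologicalSpace F] [IsTopologicalAddGroup F]
    [ContinuousSMul ℂ F] [T2Space F] (D : E →ₗ[ℂ] F)
    (hD : Function.Surjective D) (b : E →ₗ[ℂ] E →ₗ[ℂ] F) :
    Dense (Set.range (fun ψ => D ψ + b ψ ψ)) := by
  let e := (finBasis ℂ E).equivFun
  let f := (finBasis ℂ F).equivFun
  let f' := f.symm.toContinuousLinearEquiv
  let D' := f.toLinearMap ∘ₗ D ∘ₗ e.symm.toLinearMap
  let b' : (Fin (finrank ℂ E) → ℂ) →ₗ[ℂ] (Fin (finrank ℂ E) → ℂ) →ₗ[ℂ] (Fin (finrank ℂ F) → ℂ) :=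
    (b.compl₁₂ e.symm.toLinearMap e.symm.toLinearMap).compr₂ f.toLinearMap
  have h := dom2 D' (f.surjective.comp (hD.comp e.symm.surjective)) b'
  have h2 := f'.toHomeomorph.surjective.denseRange.dense_image f'.continuous h
  convert h2 using 1
  ext y
  constructor
  · rintro ⟨ψ, rfl⟩
    refine ⟨_, ⟨e ψ, rfl⟩, ?_⟩
    simp [D', b', f']
  · rintro ⟨_, ⟨a, rfl⟩, rfl⟩
    refine ⟨e.symm a, ?_⟩
    simp [D', b', f']

end HK
end

open Module
set_option linter.unusedSectionVars false
noncomputable section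
namespace HK
section S1
variable {V A : Type} {tl hd : A → V} [Fintype V] [Fintype A]
variable {κ c : V → Type} [∀ x, Fintype (κ x)] [∀ x, DecidableEq (κ x)]
  [∀ x, Fintype (c x)] [∀ x, DecidableEq (c x)]

/-- block representation -/
def blk (P : Rep tl hd κ) (Q : ∀ a, Matrix (κ (hd a)) (c (tl a)) ℂ)
    (X : ∀ a, Matrix (c (hd a)) (κ (tl a)) ℂ) (D : Rep tl hd c) :
    Rep tl hd (fun x => κ x ⊕ c x) :=
  fun a => Matrix.fromBlocks (P a) (Q a) (X a) (D a)

/-- the quadratic part -/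
def bil (Q : ∀ a, Matrix (κ (hd a)) (c (tl a)) ℂ) :
    (∀ x, Matrix (c x) (κ x) ℂ) →ₗ[ℂ] (∀ x, Matrix (c x) (κ x) ℂ) →ₗ[ℂ]
      (∀ a, Matrix (c (hd a)) (κ (tl a)) ℂ) :=
  LinearMap.mk₂ ℂ (fun ψ ψ' a => ψ (hd a) * Q a * ψ' (tl a))
    (fun _ _ _ => by funext a; simp [Matrix.add_mul])
    (fun _ _ _ => by funext a; simp)
    (fun _ _ _ => by funext a; simp [Matrix.mul_add])
    (fun _ _ _ => by funext a; simp)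

theorem hasSub_blk (P : Rep tl hd κ) (Q : ∀ a, Matrix (κ (hd a)) (c (tl a)) ℂ)
    (D : Rep tl hd c) (ψ : ∀ x, Matrix (c x) (κ x) ℂ) :
    HasSub κ (blk P Q (Dm P D ψ + bil Q ψ ψ) D) := by
  refine ⟨fun a => P a + Q a * ψ (tl a), fun x => Matrix.fromRows 1 (ψ x),
    fun x => Matrix.fromCols 1 0, fun x => ?_, fun a => ?_⟩
  · simp [Matrix.fromCols_mul_fromRows]
  · simp only [blk, bil, LinearMap.mk₂_apply, Pi.add_apply, Dm_apply]
    rw [Matrix.fromBlocks_mul_fromRows, Matrix.fromRows_mul]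
    congr 1
    · simp
    · simp [Matrix.mul_add, Matrix.mul_assoc]; abel

theorem hasSub_blk_all (P : Rep tl hd κ) (Q : ∀ a, Matrix (κ (hd a)) (c (tl a)) ℂ)
    (D : Rep tl hd c) (h : Function.Surjective (Dm P D)) (X : ∀ a, Matrix (c (hd a)) (κ (tl a)) ℂ) :
    HasSub κ (blk P Q X D) := by
  have h1 := dom3 (Dm P D) h (bil Q)
  have h2 : IsClosed {X | HasSub κ (blk P Q X D)} := by
    refine (hasSub_closed (κ := κ) (tl := tl) (hd := hd) (ι := fun x => κ x ⊕ c x)).preimage (f := fun X => blk P Q X D) ?_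
    refine continuous_pi fun a => ?_
    exact Continuous.matrix_fromBlocks continuous_const continuous_const (continuous_apply a) continuous_const
  have h3 : closure (Set.range (fun ψ => Dm P D ψ + bil Q ψ ψ)) ⊆ {X | HasSub κ (blk P Q X D)} :=
    closure_minimal (by rintro _ ⟨ψ, rfl⟩; exact hasSub_blk P Q D ψ) h2
  exact h3 (h1 X)

theorem surj_of_hom_le (P K : Rep tl hd κ) (D C : Rep tl hd c) (h : Function.Surjective (Dm K C))
    (hl : hom P D ≤ hom K C) : Function.Surjective (Dm P D) := by
  rw [← LinearMap.range_eq_top] at h ⊢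
  apply Submodule.eq_top_of_finrank_eq
  have h1 := LinearMap.finrank_range_add_finrank_ker (Dm K C)
  have h2 := LinearMap.finrank_range_add_finrank_ker (Dm P D)
  have h3 := Submodule.finrank_le (LinearMap.range (Dm P D))
  rw [h, finrank_top] at h1
  unfold hom at hl
  omega

theorem hasSub_blk_gen (K : Rep tl hd κ) (C : Rep tl hd c) (h : Function.Surjective (Dm K C))
    (P : Rep tl hd κ) (Q : ∀ a, Matrix (κ (hd a)) (c (tl a)) ℂ)
    (X : ∀ a, Matrix (c (hd a)) (κ (tl a)) ℂ) (D : Rep tl hd c) :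
    HasSub κ (blk P Q X D) := by
  have h1 := hom_semicont K (P - K) C (D - C) 0
  have h2 := closed_line (hasSub_closed (κ := κ) (tl := tl) (hd := hd) (ι := fun x => κ x ⊕ c x))
    (f := fun t : ℂ => blk (K + t • (P - K)) Q X (C + t • (D - C))) (by
      refine continuous_pi fun a => ?_
      refine Continuous.matrix_fromBlocks ?_ continuous_const continuous_const ?_
      · simp only [Pi.add_apply, Pi.smul_apply]
        fun_prop
      · simp only [Pi.add_apply, Pi.smul_apply]
        fun_prop) (by
      filter_upwards [h1] with t ht
      refine hasSub_blk_all _ _ _ (surj_of_hom_le _ K _ C h ?_) _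
      simpa using ht) 1
  simpa using h2

theorem HasSub.reindex {ι M : V → Type} [∀ x, Fintype (ι x)] [∀ x, DecidableEq (ι x)]
    [∀ x, Fintype (M x)] [∀ x, DecidableEq (M x)]
    (R : Rep tl hd ι) (e : ∀ x, M x ≃ ι x)
    (h : HasSub κ (fun a => (R a).submatrix (e _) (e _) : Rep tl hd M)) : HasSub κ R := by
  refine HasSub.trans (fun x => (1 : Matrix (ι x) (ι x) ℂ).submatrix id (e x))
    (fun x => (1 : Matrix (ι x) (ι x) ℂ).submatrix (e x) id) (fun x => ?_) (fun a => ?_) h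
  · rw [← Matrix.submatrix_mul _ _ _ _ _ Function.bijective_id]; simp
  · ext i j
    simp [Matrix.mul_apply, Matrix.one_apply]
    rw [Fintype.sum_eq_single ((e (hd a)).symm i)]
    · simp
    · intro y hy
      rw [if_neg]
      rintro rfl; simp at hy

theorem S1 {ι : V → Type} [∀ x, Fintype (ι x)] [∀ x, DecidableEq (ι x)]
    (K : Rep tl hd κ) (C : Rep tl hd c) (h : Function.Surjective (Dm K C))
    (e : ∀ x, κ x ⊕ c x ≃ ι x) (R : Rep tl hd ι) : HasSub κ R := by
  refine HasSub.reindex R e ?_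
  have := hasSub_blk_gen K C h (fun a => ((R a).submatrix (e _) (e _)).toBlocks₁₁)
    (fun a => ((R a).submatrix (e _) (e _)).toBlocks₁₂)
    (fun a => ((R a).submatrix (e _) (e _)).toBlocks₂₁)
    (fun a => ((R a).submatrix (e _) (e _)).toBlocks₂₂)
  convert this using 2 with a
  exact (Matrix.fromBlocks_toBlocks _).symm
end S1
end HK
end

open Module
set_option linter.unusedSectionVars false
noncomputable section
namespace HK

theorem sard {E F : Type} [NormedAddCommGroup E] [NormedSpace ℝ E] [FiniteDimensional ℝ E]
    [NormedAddCommGroup F] [NormedSpace ℝ F] [FiniteDimensional ℝ F] [MeasurableSpace E] [BorelSpace E]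
    (μ : MeasureTheory.Measure E) [μ.IsAddHaarMeasure]
    (e : E ≃ₗ[ℝ] F) (f : F → F) (hf : Differentiable ℝ f)
    (hv : ∀ y, ∃ v, v ≠ 0 ∧ ∃ w, ∀ t : ℝ, f (y + t • v) = f y + (t ^ 2) • w) :
    μ {x | e x ∈ Set.range f} = 0 := by
  let e' := e.toContinuousLinearEquiv
  have h0 : {x | e x ∈ Set.range f} = (fun x => e'.symm (f (e' x))) '' Set.univ := by
    ext x
    simp only [Set.mem_ofPred_eq, Set.image_univ, Set.mem_range]
    constructor
    · rintro ⟨y, hy⟩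
      refine ⟨e'.symm y, ?_⟩
      simp [hy, e']
    · rintro ⟨y, rfl⟩
      refine ⟨e' y, ?_⟩
      exact (e'.apply_symm_apply (f (e' y))).symm
  rw [h0]
  have hd : Differentiable ℝ (fun x => e'.symm (f (e' x))) :=
    e'.symm.differentiable.comp (hf.comp e'.differentiable)
  refine MeasureTheory.addHaar_image_eq_zero_of_det_fderivWithin_eq_zero μ
    (f' := fun x => fderiv ℝ (fun x => e'.symm (f (e' x))) x)
    (fun x _ => (hd x).hasFDerivAt.hasFDerivWithinAt) fun x _ => ?_
  obtain ⟨v, hv0, w, hw⟩ := hv (e' x)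
  by_contra hdet
  let q := (fderiv ℝ (fun x => e'.symm (f (e' x))) x).toContinuousLinearEquivOfDetNeZero hdet
  have h1 : fderiv ℝ (fun x => e'.symm (f (e' x))) x (e'.symm v) = 0 := by
    have h2 : HasDerivAt (fun t : ℝ => x + t • e'.symm v) (e'.symm v) 0 := by
      simpa using ((hasDerivAt_id (0:ℝ)).smul_const (e'.symm v)).const_add x
    have h3 := HasFDerivAt.comp_hasDerivAt_of_eq (0:ℝ) (hd x).hasFDerivAt h2 (by simp)
    have h4 : ((fun x => e'.symm (f (e' x))) ∘ fun t : ℝ => x + t • e'.symm v) =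
        fun t : ℝ => e'.symm (f (e' x)) + (t ^ 2) • e'.symm w := by
      funext t
      simp [hw]
    rw [h4] at h3
    have h5 : HasDerivAt (fun t : ℝ => e'.symm (f (e' x)) + (t ^ 2) • e'.symm w) 0 0 := by
      simpa using ((hasDerivAt_pow 2 (0:ℝ)).smul_const (e'.symm w)).const_add (e'.symm (f (e' x)))
    exact h3.unique h5
  have h6 : q (e'.symm v) = q 0 := by rw [map_zero]; exact h1
  have := q.injective h6
  exact hv0 (by simpa using this)

theorem sard_cover {E F T : Type} [Finite T] [NormedAddCommGroup E] [NormedSpace ℝ E] [FiniteDimensional ℝ E]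
    [NormedAddCommGroup F] [NormedSpace ℝ F] [FiniteDimensional ℝ F]
    (e : T → (E ≃ₗ[ℝ] F)) (f : F → F) (hf : Differentiable ℝ f)
    (hv : ∀ y, ∃ v, v ≠ 0 ∧ ∃ w, ∀ t : ℝ, f (y + t • v) = f y + (t ^ 2) • w)
    (O : Set E) (hO : IsOpen O) (hne : O.Nonempty)
    (hcov : O ⊆ ⋃ ε, {x | e ε x ∈ Set.range f}) : False := by
  let _ : MeasurableSpace E := borel _
  have : BorelSpace E := ⟨rfl⟩
  let μ : MeasureTheory.Measure E := MeasureTheory.Measure.addHaar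
  have hnull : ∀ ε, μ {x | e ε x ∈ Set.range f} = 0 := fun ε => sard μ (e ε) _ hf hv
  have hz : μ O = 0 := MeasureTheory.measure_mono_null hcov (MeasureTheory.measure_iUnion_null hnull)
  exact (hO.measure_pos μ hne).ne' hz

theorem exists_rows {m k : Type} [Fintype m] [Fintype k] [DecidableEq m] [DecidableEq k]
    (B : Matrix m k ℂ) (L : Matrix k m ℂ) (h : L * B = 1) :
    ∃ f : k → m, Function.Injective f ∧ (B.submatrix f id).det ≠ 0 := by
  by_contra hcon
  push Not at hcon
  have h0 : ∀ f : k → m, (B.submatrix f id).det = 0 := by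
    intro f
    by_cases hf : Function.Injective f
    · exact hcon f hf
    · rw [Function.Injective] at hf
      push Not at hf
      obtain ⟨i, j, hij, hne⟩ := hf
      exact Matrix.det_zero_of_row_eq hne (by ext; simp [hij])
  have h1 : (L * B).det = 0 := by
    have h2 : (L * B) = fun k => ∑ i, L k i • B i := by
      ext i j; simp [Matrix.mul_apply, Finset.sum_apply]
    have h3 : (L * B).det = Matrix.detRowAlternating (L * B) := rfl
    rw [h3, h2]
    have h4 := (Matrix.detRowAlternating (n := k) (R := ℂ)).toMultilinearMap.map_sum (fun (k : k) (i : m) => L k i • B i)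
    refine h4.trans (Finset.sum_eq_zero fun f _ => ?_)
    have h5 := (Matrix.detRowAlternating (n := k) (R := ℂ)).toMultilinearMap.map_smul_univ
      (fun k => L k (f k)) (fun k => B (f k))
    refine h5.trans ?_
    have h6 : (Matrix.detRowAlternating (n := k) (R := ℂ)).toMultilinearMap (fun k => B (f k)) = 0 := h0 f
    rw [h6, smul_zero]
  rw [h, Matrix.det_one] at h1
  exact one_ne_zero h1

theorem exists_chart {m k c : Type} [Fintype m] [Fintype k] [Fintype c] [DecidableEq m] [DecidableEq k]
    [DecidableEq c] (hc : Fintype.card k + Fintype.card c = Fintype.card m)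
    (B : Matrix m k ℂ) (L : Matrix k m ℂ) (h : L * B = 1) :
    ∃ e : k ⊕ c ≃ m, (B.submatrix (e ∘ Sum.inl) id).det ≠ 0 := by
  classical
  obtain ⟨f, hf, hd⟩ := exists_rows B L h
  have h1 : Fintype.card c = Fintype.card ↥((Set.range f)ᶜ : Set m) := by
    have a1 := Fintype.card_congr (Equiv.Set.sumCompl (Set.range f))
    have a2 := Fintype.card_congr (Equiv.ofInjective f hf)
    rw [Fintype.card_sum] at a1
    omega
  refine ⟨(Equiv.sumCongr (Equiv.ofInjective f hf) (Fintype.equivOfCardEq h1)).trans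
    (Equiv.Set.sumCompl (Set.range f)), ?_⟩
  have : (((Equiv.sumCongr (Equiv.ofInjective f hf) (Fintype.equivOfCardEq h1)).trans
    (Equiv.Set.sumCompl (Set.range f))) ∘ Sum.inl : k → m) = f := by
    funext i; simp
  rw [this]; exact hd

section S2
attribute [local instance] Matrix.normedAddCommGroup Matrix.normedSpace
variable {V A : Type} {tl hd : A → V} [Fintype V] [Fintype A]
variable {κ c : V → Type} [∀ x, Fintype (κ x)] [∀ x, DecidableEq (κ x)]
  [∀ x, Fintype (c x)] [∀ x, DecidableEq (c x)]

/-- parameter space -/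
abbrev Par (tl hd : A → V) (κ c : V → Type) : Type := (Rep tl hd κ) × (∀ a, Matrix (κ (hd a)) (c (tl a)) ℂ) ×
  (∀ a, Matrix (c (hd a)) (κ (tl a)) ℂ) × Rep tl hd c

/-- chart map -/
def chartMap (j : (∀ a, Matrix (c (hd a)) (κ (tl a)) ℂ) ≃ₗ[ℂ] (∀ x, Matrix (c x) (κ x) ℂ))
    (y : Par tl hd κ c) : Par tl hd κ c :=
  (y.1, y.2.1, Dm y.1 y.2.2.2 (j y.2.2.1) + bil y.2.1 (j y.2.2.1) (j y.2.2.1), y.2.2.2)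

theorem diff_lin {E : Type} [NormedAddCommGroup E] [NormedSpace ℝ E] [FiniteDimensional ℝ E]
    (l : E →ₗ[ℝ] ℂ) : Differentiable ℝ l := (LinearMap.toContinuousLinearMap l).differentiable


theorem entry_diff {E : Type} [NormedAddCommGroup E] [NormedSpace ℝ E] {m n p q : Type}
    [Fintype n] [Fintype p] [Fintype q] (f1 : E → Matrix m n ℂ) (P : E → Matrix n q ℂ) (D : E → Matrix m p ℂ)
    (f2 : E → Matrix p q ℂ) (Q : E → Matrix n p ℂ) 
    (h1 : ∀ i j, Differentiable ℝ fun y => f1 y i j) (h2 : ∀ i j, Differentiable ℝ fun y => P y i j)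
    (h3 : ∀ i j, Differentiable ℝ fun y => D y i j) (h4 : ∀ i j, Differentiable ℝ fun y => f2 y i j)
    (h5 : ∀ i j, Differentiable ℝ fun y => Q y i j) (i : m) (j : q) :
    Differentiable ℝ fun y => (f1 y * P y - D y * f2 y + f1 y * Q y * f2 y) i j := by
  simp only [Matrix.add_apply, Matrix.sub_apply, Matrix.mul_apply]
  fun_prop

theorem chartMap_diff (j : (∀ a, Matrix (c (hd a)) (κ (tl a)) ℂ) ≃ₗ[ℂ] (∀ x, Matrix (c x) (κ x) ℂ)) :
    Differentiable ℝ (chartMap (tl := tl) (hd := hd) j) := by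
  have e1 : ∀ (x : V) (p : c x) (q : κ x), Differentiable ℝ fun y : Par tl hd κ c => (j y.2.2.1) x p q :=
    fun x p q => diff_lin
      { toFun := fun y : Par tl hd κ c => (j y.2.2.1) x p q
        map_add' := fun y z => by simp
        map_smul' := fun t y => by
          have : j (t • y).2.2.1 = (t : ℂ) • j y.2.2.1 := by rw [← map_smul]; rfl
          rw [this]; simp }
  have e2 : ∀ (a : A) (p) (q), Differentiable ℝ fun y : Par tl hd κ c => y.1 a p q :=
    fun a p q => diff_lin
      { toFun := fun y : Par tl hd κ c => y.1 a p q
        map_add' := fun y z => rfl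
        map_smul' := fun t y => rfl }
  have e3 : ∀ (a : A) (p) (q), Differentiable ℝ fun y : Par tl hd κ c => y.2.1 a p q :=
    fun a p q => diff_lin
      { toFun := fun y : Par tl hd κ c => y.2.1 a p q
        map_add' := fun y z => rfl
        map_smul' := fun t y => rfl }
  have e4 : ∀ (a : A) (p) (q), Differentiable ℝ fun y : Par tl hd κ c => y.2.2.2 a p q :=
    fun a p q => diff_lin
      { toFun := fun y : Par tl hd κ c => y.2.2.2 a p q
        map_add' := fun y z => rfl
        map_smul' := fun t y => rfl }
  have e5 : Differentiable ℝ fun y : Par tl hd κ c =>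
      Dm y.1 y.2.2.2 (j y.2.2.1) + bil y.2.1 (j y.2.2.1) (j y.2.2.1) := by
    refine differentiable_pi.2 fun a => differentiable_pi.2 fun p => differentiable_pi.2 fun q => ?_
    exact entry_diff (fun y : Par tl hd κ c => j y.2.2.1 (hd a)) (fun y => y.1 a)
      (fun y => y.2.2.2 a) (fun y => j y.2.2.1 (tl a)) (fun y => y.2.1 a) (e1 _) (e2 _) (e4 _) (e1 _) (e3 _) p q
  exact differentiable_fst.prodMk ((differentiable_fst.comp differentiable_snd).prodMk (e5.prodMk
    (differentiable_snd.comp (differentiable_snd.comp differentiable_snd))))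

theorem chartMap_line (j : (∀ a, Matrix (c (hd a)) (κ (tl a)) ℂ) ≃ₗ[ℂ] (∀ x, Matrix (c x) (κ x) ℂ))
    (h : ∀ (K : Rep tl hd κ) (C : Rep tl hd c), ∃ φ, φ ≠ 0 ∧ Dm K C φ = 0) (y : Par tl hd κ c) :
    ∃ v, v ≠ 0 ∧ ∃ w, ∀ t : ℝ, chartMap j (y + t • v) = chartMap j y + (t ^ 2) • w := by
  obtain ⟨P, Q, X, D⟩ := y
  obtain ⟨φ, h0, h1⟩ := h (fun a => P a + Q a * (j X) (tl a)) (fun a => D a - (j X) (hd a) * Q a)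
  refine ⟨(0, 0, j.symm φ, 0), ?_, (0, 0, bil Q φ φ, 0), fun t => ?_⟩
  · intro h2
    have h3 : j.symm φ = 0 := congrArg (fun z => z.2.2.1) h2
    exact h0 (by simpa using h3)
  · have hj : j (X + t • j.symm φ) = j X + (t:ℂ) • φ := by
      have : t • j.symm φ = (t:ℂ) • j.symm φ := rfl
      rw [this, map_add, map_smul, LinearEquiv.apply_symm_apply]
    simp only [chartMap, Prod.smul_mk, Prod.mk_add_mk, smul_zero, add_zero, hj]
    refine Prod.ext rfl (Prod.ext rfl (Prod.ext ?_ rfl))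
    funext a
    have h2 := congrFun h1 a
    simp only [Dm_apply, Pi.zero_apply] at h2
    have h3 : (t^2 • bil Q φ φ : ∀ a, Matrix (c (hd a)) (κ (tl a)) ℂ) a =
      ((t:ℂ)^2) • (φ (hd a) * Q a * φ (tl a)) := by
      simp [bil]; norm_cast
    simp only [Pi.add_apply, h3]
    simp only [map_add, map_smul, LinearMap.add_apply, LinearMap.smul_apply, Pi.add_apply,
      Pi.smul_apply, Dm_apply, bil, LinearMap.mk₂_apply]
    have h4 : φ (hd a) * P a = - (φ (hd a) * Q a * (j X) (tl a)) + D a * φ (tl a) -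
        (j X) (hd a) * Q a * φ (tl a) := by
      rw [Matrix.mul_add, Matrix.sub_mul, ← Matrix.mul_assoc] at h2
      rw [sub_eq_zero] at h2
      rw [eq_sub_of_add_eq h2]
      abel
    rw [Matrix.add_mul, Matrix.smul_mul, h4, Matrix.mul_add (D a), Matrix.mul_smul]
    ext p q
    simp
    ring

theorem S2 {ι : V → Type} [∀ x, Fintype (ι x)] [∀ x, DecidableEq (ι x)]
    (hcard : ∀ x, crd κ x + crd c x = crd ι x) (h0 : euler tl hd (crd κ) (crd c) = 0)
    (O : Set (Rep tl hd ι)) (hO : IsOpen O) (hne : O.Nonempty) (hs : ∀ R ∈ O, HasSub κ R) :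
    ∃ (K : Rep tl hd κ) (C : Rep tl hd c), Function.Surjective (Dm K C) := by
  by_contra hcon
  push Not at hcon
  have hfr : finrank ℂ (∀ x, Matrix (c x) (κ x) ℂ) = finrank ℂ (∀ a, Matrix (c (hd a)) (κ (tl a)) ℂ) := by
    rw [euler_eq] at h0; omega
  have hker : ∀ (K : Rep tl hd κ) (C : Rep tl hd c), ∃ φ, φ ≠ 0 ∧ Dm K C φ = 0 := by
    intro K C
    have h1 := mt (LinearMap.injective_iff_surjective_of_finrank_eq_finrank hfr (f := Dm K C)).1 (hcon K C)
    rw [injective_iff_map_eq_zero] at h1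
    push Not at h1
    obtain ⟨φ, h2, h3⟩ := h1
    exact ⟨φ, h3, h2⟩
  let j := LinearEquiv.ofFinrankEq _ _ hfr.symm
  let e : (∀ x, κ x ⊕ c x ≃ ι x) → (Rep tl hd ι ≃ₗ[ℝ] Par tl hd κ c) := fun ε =>
    { toFun := fun R => (fun a => ((R a).submatrix (ε _) (ε _)).toBlocks₁₁,
        fun a => ((R a).submatrix (ε _) (ε _)).toBlocks₁₂,
        fun a => ((R a).submatrix (ε _) (ε _)).toBlocks₂₁,
        fun a => ((R a).submatrix (ε _) (ε _)).toBlocks₂₂)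
      map_add' := fun _ _ => rfl
      map_smul' := fun _ _ => rfl
      invFun := fun y a => (blk y.1 y.2.1 y.2.2.1 y.2.2.2 a).submatrix (ε _).symm (ε _).symm
      left_inv := fun R => by
        funext a
        simp only [blk, Matrix.fromBlocks_toBlocks]
        ext; simp
      right_inv := fun y => by
        obtain ⟨P, Q, X, D⟩ := y
        simp [blk] }
  have hcov : O ⊆ ⋃ ε, {x | e ε x ∈ Set.range (chartMap j)} := by
    intro R hR
    obtain ⟨Y, B, L, h1, h2⟩ := hs R hR
    choose ε hε using fun x => exists_chart (c := c x) (hcard x) (B x) (L x) (h1 x)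
    refine Set.mem_iUnion.2 ⟨ε, ?_⟩
    let B1 : ∀ x, Matrix (κ x) (κ x) ℂ := fun x => (B x).submatrix (ε x ∘ Sum.inl) id
    let B2 : ∀ x, Matrix (c x) (κ x) ℂ := fun x => (B x).submatrix (ε x ∘ Sum.inr) id
    have hu : ∀ x, IsUnit (B1 x).det := fun x => isUnit_iff_ne_zero.2 (hε x)
    let P := (e ε R).1
    let Q := (e ε R).2.1
    let X := (e ε R).2.2.1
    let D := (e ε R).2.2.2
    have h3 : ∀ a, ((R a).submatrix (ε (hd a)) (ε (tl a))) * (B (tl a)).submatrix (ε (tl a)) id =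
        (B (hd a)).submatrix (ε (hd a)) id * Y a := by
      intro a
      rw [Matrix.submatrix_mul_equiv, h2]
      rfl
    have hB : ∀ x, (B x).submatrix (ε x) id = Matrix.fromRows (B1 x) (B2 x) := by
      intro x; ext i k; rcases i with i | i <;> rfl
    have h4 : ∀ a, P a * B1 (tl a) + Q a * B2 (tl a) = B1 (hd a) * Y a ∧
        X a * B1 (tl a) + D a * B2 (tl a) = B2 (hd a) * Y a := by
      intro a
      have h5 := h3 a
      rw [hB, hB, ← Matrix.fromBlocks_toBlocks ((R a).submatrix (ε (hd a)) (ε (tl a))),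
        Matrix.fromBlocks_mul_fromRows, Matrix.fromRows_mul] at h5
      exact (Matrix.fromRows_ext_iff _ _ _ _).1 h5
    let ψ : ∀ x, Matrix (c x) (κ x) ℂ := fun x => B2 x * (B1 x)⁻¹
    have hψ : ∀ x, ψ x * B1 x = B2 x := fun x => by
      simp only [ψ]; rw [Matrix.mul_assoc, Matrix.nonsing_inv_mul _ (hu x), Matrix.mul_one]
    refine ⟨(P, Q, j.symm ψ, D), ?_⟩
    refine Prod.ext rfl (Prod.ext rfl (Prod.ext ?_ rfl))
    change Dm P D (j (j.symm ψ)) + bil Q (j (j.symm ψ)) (j (j.symm ψ)) = X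
    rw [LinearEquiv.apply_symm_apply]
    funext a
    simp only [Pi.add_apply, Dm_apply, bil, LinearMap.mk₂_apply]
    have hc : ∀ Z Z' : Matrix (c (hd a)) (κ (tl a)) ℂ, Z * B1 (tl a) = Z' * B1 (tl a) → Z = Z' := by
      intro Z Z' h
      have := congrArg (· * (B1 (tl a))⁻¹) h
      simpa only [Matrix.mul_assoc, Matrix.mul_nonsing_inv _ (hu _), Matrix.mul_one] using this
    apply hc
    have h6 : X a * B1 (tl a) = B2 (hd a) * Y a - D a * B2 (tl a) := eq_sub_of_add_eq (h4 a).2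
    have h7 : ψ (hd a) * (P a * B1 (tl a) + Q a * B2 (tl a)) = B2 (hd a) * Y a := by
      rw [(h4 a).1, ← Matrix.mul_assoc, hψ]
    rw [h6, ← h7]
    simp only [Matrix.add_mul, Matrix.sub_mul, Matrix.mul_add, Matrix.mul_assoc, hψ]
    abel
  exact sard_cover e (chartMap j) (chartMap_diff j) (chartMap_line j hker) O hO hne hcov
end S2
end HK
end

open Module
set_option linter.unusedSectionVars false
noncomputable section
namespace HK

theorem det_max {E U : Type} [NormedAddCommGroup E] [NormedSpace ℂ E] [FiniteDimensional ℂ E]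
    [AddCommGroup U] [Module ℂ U] [FiniteDimensional ℂ U] (Φ0 : U →ₗ[ℂ] U)
    (Λ : E →ₗ[ℂ] (U →ₗ[ℂ] U)) (N : E → ℝ) (hN : Continuous N) (hN2 : ∀ K, ‖K‖ ^ 2 ≤ N K)
    (K0 : E) (h0 : LinearMap.det (Φ0 + Λ K0) ≠ 0) :
    ∃ K, LinearMap.det (Φ0 + Λ K) ≠ 0 ∧ ∀ K', ‖LinearMap.det (Φ0 + Λ K')‖ ^ 2 * Real.exp (- N K') ≤
      ‖LinearMap.det (Φ0 + Λ K)‖ ^ 2 * Real.exp (- N K) := by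
  have : ProperSpace E := FiniteDimensional.proper ℂ E
  let b := finBasis ℂ U
  let d := finrank ℂ U
  let m0 := LinearMap.toMatrix b b Φ0
  let l : Fin d → Fin d → (E →L[ℂ] ℂ) := fun i j => LinearMap.toContinuousLinearMap
    { toFun := fun K => LinearMap.toMatrix b b (Λ K) i j
      map_add' := fun _ _ => by simp
      map_smul' := fun _ _ => by simp }
  have hM : ∀ K i j, LinearMap.toMatrix b b (Φ0 + Λ K) i j = m0 i j + l i j K := by
    intro K i j; simp [m0, l]
  have hdet : ∀ K, LinearMap.det (Φ0 + Λ K) = (LinearMap.toMatrix b b (Φ0 + Λ K)).det := fun K =>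
    (LinearMap.det_toMatrix b _).symm
  have hcont : Continuous fun K => LinearMap.det (Φ0 + Λ K) := by
    simp only [hdet]
    refine Continuous.matrix_det ?_
    refine continuous_pi fun i => continuous_pi fun j => ?_
    simp only [hM]
    fun_prop
  let F : E → ℝ := fun K => ‖LinearMap.det (Φ0 + Λ K)‖ ^ 2 * Real.exp (- N K)
  have hF : Continuous F := by fun_prop
  have hF0 : 0 < F K0 := by have := norm_pos_iff.2 h0; positivity
  let C0 : ℝ := ∑ i, ∑ j, (‖m0 i j‖ + ‖l i j‖)
  have hC0 : 0 ≤ C0 := by positivity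
  have hent : ∀ K, 1 ≤ ‖K‖ → ∀ i j, ‖LinearMap.toMatrix b b (Φ0 + Λ K) i j‖ ≤ C0 * ‖K‖ := by
    intro K hK i j
    rw [hM]
    have h1 : ‖m0 i j‖ + ‖l i j‖ ≤ C0 := by
      have a1 := Finset.single_le_sum (f := fun j => ‖m0 i j‖ + ‖l i j‖) (fun j _ => by positivity) (Finset.mem_univ j)
      have a2 := Finset.single_le_sum (f := fun i => ∑ j, (‖m0 i j‖ + ‖l i j‖)) (fun j _ => by positivity) (Finset.mem_univ i)
      exact a1.trans a2
    calc ‖m0 i j + l i j K‖ ≤ ‖m0 i j‖ + ‖l i j K‖ := norm_add_le _ _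
      _ ≤ ‖m0 i j‖ * ‖K‖ + ‖l i j‖ * ‖K‖ := by
          gcongr
          · exact le_mul_of_one_le_right (norm_nonneg _) hK
          · exact (l i j).le_opNorm K
      _ = (‖m0 i j‖ + ‖l i j‖) * ‖K‖ := by ring
      _ ≤ C0 * ‖K‖ := by gcongr
  have hbound : ∀ K, 1 ≤ ‖K‖ → F K ≤ (d.factorial * C0 ^ d) ^ 2 * (‖K‖ ^ (2 * d) * Real.exp (-‖K‖)) := by
    intro K hK
    have h1 : ‖LinearMap.det (Φ0 + Λ K)‖ ≤ d.factorial * (C0 * ‖K‖) ^ d := by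
      rw [hdet]
      have := Matrix.det_le (abv := IsAbsoluteValue.toAbsoluteValue (norm : ℂ → ℝ)) (x := C0 * ‖K‖) (hent K hK)
      simpa [nsmul_eq_mul] using this
    have h2 : Real.exp (- N K) ≤ Real.exp (-‖K‖) := by
      apply Real.exp_le_exp.2
      have := hN2 K
      nlinarith
    calc F K ≤ (d.factorial * (C0 * ‖K‖) ^ d) ^ 2 * Real.exp (-‖K‖) := by
          simp only [F]; gcongr
      _ = _ := by ring
  have hlim : Filter.Tendsto (fun K : E => (d.factorial * C0 ^ d) ^ 2 * (‖K‖ ^ (2 * d) * Real.exp (-‖K‖)))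
      (Filter.cocompact E) (nhds 0) := by
    have h1 := (Real.tendsto_pow_mul_exp_neg_atTop_nhds_zero (2 * d)).comp (tendsto_norm_cocompact_atTop (E := E))
    simpa using h1.const_mul ((d.factorial * C0 ^ d : ℝ) ^ 2)
  obtain ⟨K, hK⟩ := hF.exists_forall_ge' K0 (by
    have a1 := hlim.eventually (gt_mem_nhds hF0)
    have a2 := (tendsto_norm_cocompact_atTop (E := E)).eventually (Filter.eventually_ge_atTop 1)
    filter_upwards [a1, a2] with K b1 b2
    exact (hbound K b2).trans b1.le)
  refine ⟨K, ?_, hK⟩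
  intro hz
  have := hK K0
  simp only [F, hz] at this hF0
  simp at this
  linarith

theorem det_deriv {U : Type} [AddCommGroup U] [Module ℂ U] [FiniteDimensional ℂ U] (T : U →ₗ[ℂ] U) :
    HasDerivAt (fun t : ℝ => LinearMap.det (1 + (t : ℂ) • T)) (LinearMap.trace ℂ U T) 0 := by
  let b := finBasis ℂ U
  let M := LinearMap.toMatrix b b T
  have h1 : ∀ t : ℂ, LinearMap.det (1 + t • T) = (1 + t • M).det := by
    intro t
    rw [← LinearMap.det_toMatrix b, map_add, map_smul, LinearMap.toMatrix_one]
  have h2 : LinearMap.trace ℂ U T = M.trace := LinearMap.trace_eq_matrix_trace ℂ b T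
  rw [h2]
  let q := (Matrix.det (1 + (Polynomial.X : Polynomial ℂ) • M.map Polynomial.C)).divX.divX
  have h3 : HasDerivAt (fun z : ℂ => 1 + M.trace * z + q.eval z * z ^ 2) M.trace ((0:ℝ):ℂ) := by
    have a1 := ((hasDerivAt_id ((0:ℝ):ℂ)).const_mul M.trace).const_add 1
    have a2 := (q.hasDerivAt ((0:ℝ):ℂ)).mul (hasDerivAt_pow 2 ((0:ℝ):ℂ))
    exact (a1.add a2).congr_deriv (by simp)
  have h4 : (fun t : ℝ => LinearMap.det (1 + (t : ℂ) • T)) =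
      fun t : ℝ => 1 + M.trace * (t:ℂ) + q.eval (t:ℂ) * (t:ℂ) ^ 2 := by
    funext t
    rw [h1, Matrix.det_one_add_smul]
  rw [h4]
  exact h3.comp_ofReal

theorem first_order {U : Type} [AddCommGroup U] [Module ℂ U] [FiniteDimensional ℂ U] (T : U →ₗ[ℂ] U)
    (N : ℝ → ℝ) (β : ℝ) (hN : HasDerivAt N (2 * β) 0)
    (hmax : ∀ t : ℝ, ‖LinearMap.det (1 + (t : ℂ) • T)‖ ^ 2 * Real.exp (- N t) ≤ Real.exp (- N 0)) :
    (LinearMap.trace ℂ U T).re = β := by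
  have h1 := (det_deriv T).norm_sq.mul hN.neg.exp
  have h2 : IsLocalMax ((fun t : ℝ => ‖LinearMap.det (1 + (t : ℂ) • T)‖ ^ 2) * fun t => Real.exp (- N t)) 0 := by
    refine Filter.Eventually.of_forall fun t => ?_
    simpa using hmax t
  have h3 := h2.hasDerivAt_eq_zero h1
  have h5 : Real.exp (- N 0) ≠ 0 := (Real.exp_pos _).ne'
  have h6 : (2 * (LinearMap.trace ℂ U T).re - 2 * β) * Real.exp (- N 0) = 0 := by
    have h4 := h3
    simp [Complex.inner] at h4
    linear_combination h4
  have := (mul_eq_zero.1 h6).resolve_right h5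
  linarith

/-- right multiplication -/
def rmul {V : Type} {m n : V → Type} [∀ v, Fintype (n v)] (X : ∀ v, Matrix (n v) (n v) ℂ) :
    (∀ v, Matrix (m v) (n v) ℂ) →ₗ[ℂ] (∀ v, Matrix (m v) (n v) ℂ) where
  toFun φ v := φ v * X v
  map_add' _ _ := by funext v; simp [Matrix.add_mul]
  map_smul' _ _ := by funext v; simp

theorem trace_rmul {V : Type} {m n : V → Type} [Fintype V] [DecidableEq V] [∀ v, Fintype (n v)]
    [∀ v, Fintype (m v)] [∀ v, DecidableEq (n v)]
    [∀ v, DecidableEq (m v)] (X : ∀ v, Matrix (n v) (n v) ℂ) :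
    LinearMap.trace ℂ _ (rmul (m := m) X) = ∑ v, (Fintype.card (m v) : ℂ) * (X v).trace := by
  let b := Pi.basis (fun v => Matrix.stdBasis ℂ (m v) (n v))
  rw [LinearMap.trace_eq_matrix_trace ℂ b, Matrix.trace, Fintype.sum_sigma]
  refine Finset.sum_congr rfl fun v _ => ?_
  rw [Fintype.sum_prod_type]
  have : ∀ i k, Matrix.diag (LinearMap.toMatrix b b (rmul (m := m) X)) ⟨v, (i, k)⟩ = X v k k := by
    intro i k
    rw [Matrix.diag_apply, LinearMap.toMatrix_apply]
    simp only [b, Pi.basis_repr, Pi.basis_apply, rmul, LinearMap.coe_mk, AddHom.coe_mk]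
    rw [Pi.single_eq_same, Matrix.stdBasis_eq_single]
    simp [Matrix.stdBasis]
  simp only [this]
  simp [Matrix.trace]

section KN
variable {V A : Type} {tl hd : A → V} [Fintype V] [Fintype A]
variable {κ c : V → Type} [∀ x, Fintype (κ x)] [∀ x, DecidableEq (κ x)]
  [∀ x, Fintype (c x)] [∀ x, DecidableEq (c x)]

/-- squared norm -/
def nsq (K : Rep tl hd κ) : ℝ := ∑ a, ∑ i, ∑ j, ‖K a i j‖ ^ 2

theorem nsq_deriv (K H : Rep tl hd κ) : HasDerivAt (fun t : ℝ => nsq (K + (t:ℂ) • H))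
    (2 * (∑ a, (H a * (K a).conjTranspose).trace).re) 0 := by
  have h1 : ∀ a i j, HasDerivAt (fun t : ℝ => ‖K a i j + (t:ℂ) * H a i j‖ ^ 2)
      (2 * (H a i j * star (K a i j)).re) 0 := by
    intro a i j
    have h2 : HasDerivAt (fun t : ℝ => K a i j + (t:ℂ) * H a i j) (H a i j) 0 := by
      have := (((hasDerivAt_id ((0:ℝ):ℂ)).mul_const (H a i j)).const_add (K a i j)).comp_ofReal
      simpa using this
    have h3 := h2.norm_sq
    convert h3 using 1
    simp [Complex.inner]
  have h4 : HasDerivAt (fun t : ℝ => ∑ a, ∑ i, ∑ j, ‖K a i j + (t:ℂ) * H a i j‖ ^ 2)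
      (∑ a, ∑ i, ∑ j, 2 * (H a i j * star (K a i j)).re) 0 := by
    refine HasDerivAt.fun_sum fun a _ => HasDerivAt.fun_sum fun i _ => HasDerivAt.fun_sum fun j _ => h1 a i j
  refine HasDerivAt.congr_deriv (f := fun t : ℝ => nsq (K + (t:ℂ) • H)) h4 ?_
  simp only [Matrix.trace, Matrix.diag_apply, Matrix.mul_apply, Matrix.conjTranspose_apply, Complex.re_sum,
    Finset.mul_sum]

theorem Dm_split (K : Rep tl hd κ) (C : Rep tl hd c) : Dm K C = Dm 0 C + Dm K 0 := by
  ext φ a : 2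
  simp
  abel

/-- linear part -/
def DmL (tl hd : A → V) (κ c : V → Type) [∀ x, Fintype (κ x)] [∀ x, Fintype (c x)] :
    Rep tl hd κ →ₗ[ℂ] ((∀ x, Matrix (c x) (κ x) ℂ) →ₗ[ℂ] (∀ a, Matrix (c (hd a)) (κ (tl a)) ℂ)) where
  toFun K := Dm K 0
  map_add' K H := by ext φ a : 2; simp [Matrix.mul_add]
  map_smul' t K := by ext φ a : 2; simp

theorem KN_max (K0 : Rep tl hd κ) (C : Rep tl hd c)
    (j : (∀ a, Matrix (c (hd a)) (κ (tl a)) ℂ) →ₗ[ℂ] (∀ x, Matrix (c x) (κ x) ℂ))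
    (h0 : LinearMap.det (j ∘ₗ Dm K0 C) ≠ 0) :
    ∃ K : Rep tl hd κ, LinearMap.det (j ∘ₗ Dm K C) ≠ 0 ∧ ∀ K', ‖LinearMap.det (j ∘ₗ Dm K' C)‖ ^ 2 *
      Real.exp (- nsq K') ≤ ‖LinearMap.det (j ∘ₗ Dm K C)‖ ^ 2 * Real.exp (- nsq K) := by
  let i1 : ∀ m n : Type, ∀ [Fintype m] [Fintype n], NormedAddCommGroup (Matrix m n ℂ) :=
    fun m n _ _ => Matrix.normedAddCommGroup
  let i2 : ∀ m n : Type, ∀ [Fintype m] [Fintype n], NormedSpace ℂ (Matrix m n ℂ) :=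
    fun m n _ _ => Matrix.normedSpace
  have hs : ∀ K : Rep tl hd κ, j ∘ₗ Dm K C = j ∘ₗ Dm 0 C + (LinearMap.llcomp ℂ _ _ _ j ∘ₗ DmL tl hd κ c) K := by
    intro K
    rw [Dm_split K C, LinearMap.comp_add]
    rfl
  rw [hs] at h0
  suffices hh : ∃ K : Rep tl hd κ, LinearMap.det (j ∘ₗ Dm 0 C + (LinearMap.llcomp ℂ _ _ _ j ∘ₗ DmL tl hd κ c) K) ≠ 0 ∧
      ∀ K', ‖LinearMap.det (j ∘ₗ Dm 0 C + (LinearMap.llcomp ℂ _ _ _ j ∘ₗ DmL tl hd κ c) K')‖ ^ 2 *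
      Real.exp (- nsq K') ≤ ‖LinearMap.det (j ∘ₗ Dm 0 C + (LinearMap.llcomp ℂ _ _ _ j ∘ₗ DmL tl hd κ c) K)‖ ^ 2 *
        Real.exp (- nsq K) by
    simpa only [← hs] using hh
  refine det_max (j ∘ₗ Dm 0 C) (LinearMap.llcomp ℂ _ _ _ j ∘ₗ DmL tl hd κ c) nsq ?_ ?_ K0 h0
  · unfold nsq
    refine continuous_finsetSum _ fun a _ => continuous_finsetSum _ fun p _ =>
      continuous_finsetSum _ fun q _ => ?_
    refine (Continuous.norm ?_).pow 2
    exact (continuous_apply q).comp ((continuous_apply p).comp (continuous_apply a))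
  · intro K
    have hn : 0 ≤ nsq K := by unfold nsq; positivity
    have : ‖K‖ ≤ Real.sqrt (nsq K) := by
      refine (pi_norm_le_iff_of_nonneg (Real.sqrt_nonneg _)).2 fun a => ?_
      refine (Matrix.norm_le_iff (Real.sqrt_nonneg _)).2 fun p q => ?_
      apply Real.le_sqrt_of_sq_le
      unfold nsq
      have a1 := Finset.single_le_sum (f := fun q => ‖K a p q‖ ^ 2) (fun _ _ => by positivity) (Finset.mem_univ q)
      have a2 := Finset.single_le_sum (f := fun p => ∑ q, ‖K a p q‖ ^ 2) (fun _ _ => by positivity) (Finset.mem_univ p)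
      have a3 := Finset.single_le_sum (f := fun a => ∑ p, ∑ q, ‖K a p q‖ ^ 2) (fun _ _ => by positivity) (Finset.mem_univ a)
      exact a1.trans (a2.trans a3)
    calc ‖K‖ ^ 2 ≤ Real.sqrt (nsq K) ^ 2 := by gcongr
      _ = nsq K := Real.sq_sqrt hn

theorem KN [DecidableEq V] [DecidableEq A] (K0 : Rep tl hd κ) (C : Rep tl hd c) (h0 : Function.Bijective (Dm K0 C)) :
    ∃ K : Rep tl hd κ, ∀ X : ∀ x, Matrix (κ x) (κ x) ℂ,
      ∑ a, (X (hd a) * K a * (K a).conjTranspose).trace - ∑ a, (K a * X (tl a) * (K a).conjTranspose).trace =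
      ∑ x, (Fintype.card (c x) : ℂ) * (X x).trace -
        ∑ a, (Fintype.card (c (hd a)) : ℂ) * (X (tl a)).trace := by
  let j := (LinearEquiv.ofBijective _ h0).symm
  have hj0 : LinearMap.det ((j : _ →ₗ[ℂ] _) ∘ₗ Dm K0 C) ≠ 0 := by
    have : (j : _ →ₗ[ℂ] _) ∘ₗ Dm K0 C = LinearMap.id := by
      refine LinearMap.ext fun φ => ?_
      exact (LinearEquiv.ofBijective _ h0).symm_apply_apply φ
    rw [this, LinearMap.det_id]; exact one_ne_zero
  obtain ⟨K, hK, hmax⟩ := KN_max K0 C (j : _ →ₗ[ℂ] _) hj0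
  have hb : Function.Bijective (Dm K C) := by
    have h1 := (LinearMap.equivOfDetNeZero _ hK).bijective
    have h2 : ⇑(LinearMap.equivOfDetNeZero _ hK) = j ∘ Dm K C := by
      funext φ; rfl
    rw [h2] at h1
    exact (Function.Bijective.of_comp_iff' j.bijective _).1 h1
  let D := LinearEquiv.ofBijective _ hb
  have hDa : ∀ φ, D φ = Dm K C φ := fun _ => rfl
  have key : ∀ X : ∀ x, Matrix (κ x) (κ x) ℂ,
      (∑ x, (Fintype.card (c x) : ℂ) * (X x).trace -
        ∑ a, (Fintype.card (c (hd a)) : ℂ) * (X (tl a)).trace).re =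
      (∑ a, (X (hd a) * K a * (K a).conjTranspose).trace - ∑ a, (K a * X (tl a) * (K a).conjTranspose).trace).re := by
    intro X
    let H : Rep tl hd κ := fun a => X (hd a) * K a - K a * X (tl a)
    let T : (∀ x, Matrix (c x) (κ x) ℂ) →ₗ[ℂ] (∀ x, Matrix (c x) (κ x) ℂ) :=
      (D.symm : _ →ₗ[ℂ] _) ∘ₗ Dm H 0
    have hT : T = rmul X - (D.symm : _ →ₗ[ℂ] _) ∘ₗ rmul (m := fun a => c (hd a)) (fun a => X (tl a)) ∘ₗ (D : _ →ₗ[ℂ] _) := by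
      refine LinearMap.ext fun φ => ?_
      apply D.injective
      simp only [T, LinearMap.comp_apply, LinearMap.sub_apply, map_sub, LinearEquiv.coe_coe,
        LinearEquiv.apply_symm_apply]
      rw [hDa, hDa]
      funext a
      simp [rmul, H, Matrix.mul_sub, Matrix.sub_mul, Matrix.mul_assoc]
    have htr : LinearMap.trace ℂ _ T = ∑ x, (Fintype.card (c x) : ℂ) * (X x).trace -
        ∑ a, (Fintype.card (c (hd a)) : ℂ) * (X (tl a)).trace := by
      rw [hT, map_sub, trace_rmul]
      congr 1
      have := LinearMap.trace_conj' (rmul (m := fun a => c (hd a)) (fun a => X (tl a))) D.symm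
      rw [LinearEquiv.conj_apply, LinearEquiv.symm_symm, LinearMap.comp_assoc] at this
      rw [this, trace_rmul]
    have hfo := first_order T (fun t => nsq (K + (t:ℂ) • H)) _ (nsq_deriv K H) (by
      intro t
      have h1 := hmax (K + (t:ℂ) • H)
      have h2 : j.toLinearMap ∘ₗ Dm (K + (t:ℂ) • H) C = (j.toLinearMap ∘ₗ Dm K C) ∘ₗ (1 + (t:ℂ) • T) := by
        refine LinearMap.ext fun φ => ?_
        simp only [LinearMap.comp_apply]
        congr 1
        rw [LinearMap.add_apply, map_add, LinearMap.smul_apply, map_smul]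
        have h3 : Dm K C (T φ) = Dm H 0 φ := D.apply_symm_apply _
        rw [h3]
        funext a
        simp [Matrix.mul_add]
        abel
      rw [h2, LinearMap.det_comp, norm_mul, mul_pow, mul_assoc] at h1
      have h4 : 0 < ‖LinearMap.det ((j : _ →ₗ[ℂ] _) ∘ₗ Dm K C)‖ ^ 2 := by
        have := norm_pos_iff.2 hK
        positivity
      have h5 := le_of_mul_le_mul_left h1 h4
      simpa using h5)
    rw [htr] at hfo
    rw [hfo, ← Finset.sum_sub_distrib]
    congr 2
    funext a
    simp [H, Matrix.sub_mul]
  refine ⟨K, fun X => (Complex.ext ?_ ?_).symm⟩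
  · exact key X
  · have := key (fun x => (-Complex.I) • X x)
    simp only [Matrix.trace_smul, Matrix.smul_mul, Matrix.mul_smul, smul_eq_mul] at this
    simp only [mul_left_comm _ (-Complex.I), ← Finset.mul_sum, ← mul_sub] at this
    simpa using this
end KN
end HK
end

open Module
set_option linter.unusedSectionVars false
noncomputable section
namespace HK

/-- number of `k` with `I k ≤ t` -/
def kk {r n : ℕ} (I : Fin r → Fin n) (t : ℕ) : ℕ :=
  (Finset.univ.filter fun k : Fin r => (I k : ℕ) ≤ t).card

theorem lt_kk {r n : ℕ} {I : Fin r → Fin n} (hI : StrictMono I) (k : Fin r) (t : ℕ) :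
    (k : ℕ) < kk I t ↔ (I k : ℕ) ≤ t := by
  constructor
  · intro h
    by_contra hc
    push Not at hc
    have : (Finset.univ.filter fun k : Fin r => (I k : ℕ) ≤ t) ⊆ Finset.Iio k := by
      intro x hx
      simp only [Finset.mem_filter, Finset.mem_univ, true_and] at hx
      simp only [Finset.mem_Iio]
      by_contra hxk
      push Not at hxk
      have := hI.monotone hxk
      have : (I k : ℕ) ≤ I x := this
      omega
    have := Finset.card_le_card this
    simp only [Fin.card_Iio] at this
    unfold kk at h
    omega
  · intro h
    have : Finset.Iic k ⊆ (Finset.univ.filter fun k : Fin r => (I k : ℕ) ≤ t) := by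
      intro x hx
      simp only [Finset.mem_Iic] at hx
      simp only [Finset.mem_filter, Finset.mem_univ, true_and]
      have := hI.monotone hx
      have : (I x : ℕ) ≤ I k := this
      omega
    have := Finset.card_le_card this
    simp only [Fin.card_Iic] at this
    unfold kk
    omega

theorem kk_le_r {r n : ℕ} (I : Fin r → Fin n) (t : ℕ) : kk I t ≤ r := by
  have := Finset.card_le_univ (Finset.univ.filter fun k : Fin r => (I k : ℕ) ≤ t)
  simpa [kk] using this

theorem kk_last {r m : ℕ} (I : Fin r → Fin (m+1)) : kk I m = r := by
  unfold kk
  rw [Finset.filter_true_of_mem]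
  · simp
  · intro x _; have := (I x).2; omega

theorem kk_le {r n : ℕ} {I : Fin r → Fin n} (hI : StrictMono I) (t : ℕ) : kk I t ≤ t + 1 := by
  unfold kk
  rw [← Finset.card_range (t+1)]
  refine Finset.card_le_card_of_injOn (fun k => (I k : ℕ)) ?_ ?_
  · intro x hx
    simp at hx ⊢; omega
  · intro x _ y _ h
    exact hI.injective (Fin.ext h)

theorem kk_mono {r n : ℕ} (I : Fin r → Fin n) (t : ℕ) : kk I t ≤ kk I (t+1) := by
  unfold kk
  refine Finset.card_le_card ?_
  intro x hx
  simp at hx ⊢; omega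

theorem kk_succ_le {r n : ℕ} {I : Fin r → Fin n} (hI : StrictMono I) (t : ℕ) :
    kk I (t+1) ≤ kk I t + 1 := by
  unfold kk
  have h1 : (Finset.univ.filter fun k : Fin r => (I k : ℕ) ≤ t + 1) ⊆
    (Finset.univ.filter fun k : Fin r => (I k : ℕ) ≤ t) ∪
    (Finset.univ.filter fun k : Fin r => (I k : ℕ) = t + 1) := by
    intro x hx
    simp at hx ⊢; omega
  have h2 : (Finset.univ.filter fun k : Fin r => (I k : ℕ) = t + 1).card ≤ 1 := by
    rw [Finset.card_le_one]
    intro a ha b hb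
    simp at ha hb
    exact hI.injective (Fin.ext (by omega))
  have := Finset.card_le_card h1
  have := Finset.card_union_le (Finset.univ.filter fun k : Fin r => (I k : ℕ) ≤ t)
    (Finset.univ.filter fun k : Fin r => (I k : ℕ) = t + 1)
  omega

theorem kk_self {r n : ℕ} {I : Fin r → Fin n} (hI : StrictMono I) (k : Fin r) :
    kk I (I k) = k + 1 := by
  apply le_antisymm
  · by_contra h
    push Not at h
    have hr := kk_le_r I (I k)
    have := (lt_kk hI ⟨k + 1, by omega⟩ (I k)).1 (by simpa using h)
    have h2 : I k < I ⟨k+1, by omega⟩ := hI (by simp [Fin.lt_def])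
    have : (I k : ℕ) < I ⟨k+1, by omega⟩ := h2
    omega
  · exact (lt_kk hI k (I k)).2 le_rfl

/-- integer valued codimension function -/
def cz {r n : ℕ} (I : Fin r → Fin n) (t : ℕ) : ℤ := (t : ℤ) + 1 - kk I t

theorem cz_self {r n : ℕ} {I : Fin r → Fin n} (hI : StrictMono I) (k : Fin r) :
    cz I (I k) = (I k : ℤ) - k := by
  unfold cz; rw [kk_self hI]; push_cast; ring

theorem cz_last {r m : ℕ} (I : Fin r → Fin (m+1)) : cz I m = (m : ℤ) + 1 - r := by
  unfold cz; rw [kk_last]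

theorem cz_mono {r n : ℕ} {I : Fin r → Fin n} (hI : StrictMono I) (t : ℕ) :
    cz I t ≤ cz I (t+1) := by
  unfold cz; have := kk_succ_le hI t; push_cast; omega

theorem telesc (f : ℕ → ℤ) (m a : ℕ) (h : a ≤ m) :
    ∑ j : Fin m, (if a ≤ (j : ℕ) then (f (j+1) - f j) else 0) = f m - f a := by
  rw [Fin.sum_univ_eq_sum_range (fun j => if a ≤ j then (f (j+1) - f j) else 0)]
  induction m with
  | zero => have : a = 0 := by omega
            subst this; simp
  | succ m ih =>
    rw [Finset.sum_range_succ]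
    by_cases h2 : a ≤ m
    · rw [ih h2, if_pos h2]; ring
    · have : a = m + 1 := by omega
      subst this
      rw [Finset.sum_eq_zero]
      · simp
      · intro x hx; simp at hx; rw [if_neg]; omega

theorem gam_sum {r m : ℕ} {I : Fin r → Fin (m+1)} (hI : StrictMono I) (k : Fin r) :
    ∑ j : Fin m, (if (k : ℕ) < kk I j then (cz I (j+1) - cz I j) else 0) =
      (m : ℤ) + 1 - r - ((I k : ℤ) - k) := by
  simp only [lt_kk hI]
  rw [telesc _ _ _ (by have := (I k).2; omega), cz_last, cz_self hI]

variable {s r m : ℕ}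

abbrev SV (s m : ℕ) : Type := Option (Fin s × Fin (m+1))
abbrev SA (s m : ℕ) : Type := (Fin s × Fin m) ⊕ Fin s

@[reducible] def stl (s m : ℕ) : SA s m → SV s m
  | .inl (l, j) => some (l, j.castSucc)
  | .inr l => some (l, Fin.last m)

@[reducible] def shd (s m : ℕ) : SA s m → SV s m
  | .inl (l, j) => some (l, j.succ)
  | .inr _ => none

@[reducible] def xd (s m : ℕ) : SV s m → ℕ
  | some (_, j) => (j : ℕ) + 1
  | none => m + 1

@[reducible] def kd (I : Fin s → Fin r → Fin (m+1)) : SV s m → ℕ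
  | some (l, j) => kk (I l) j
  | none => r

@[reducible] def cd (I : Fin s → Fin r → Fin (m+1)) : SV s m → ℕ
  | some (l, j) => (j : ℕ) + 1 - kk (I l) j
  | none => m + 1 - r

theorem kd_add_cd {I : Fin s → Fin r → Fin (m+1)} (hI : ∀ l, StrictMono (I l)) (hr : r ≤ m + 1)
    (x : SV s m) : kd I x + cd I x = xd s m x := by
  rcases x with _ | ⟨l, j⟩
  · simp only [kd, cd, xd]; omega
  · simp only [kd, cd, xd]; have := kk_le (hI l) j; omega

theorem euler_star {I : Fin s → Fin r → Fin (m+1)} (hI : ∀ l, StrictMono (I l)) (hr : r ≤ m + 1)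
    (k' : SV s m → ℕ) :
    euler (stl s m) (shd s m) k' (cd I) = (k' none : ℤ) * ((m : ℤ) + 1 - r) -
      ∑ l, ∑ j : Fin m, (k' (some (l, j.castSucc)) : ℤ) * (cz (I l) (j+1) - cz (I l) j) := by
  unfold euler
  have hc : ∀ l (j : Fin (m+1)), ((cd I (some (l, j)) : ℕ) : ℤ) = cz (I l) j := by
    intro l j; simp only [cd, cz]; have := kk_le (hI l) j; omega
  have hc0 : ((cd I none : ℕ) : ℤ) = (m : ℤ) + 1 - r := by simp only [cd]; omega
  rw [Fintype.sum_option, Fintype.sum_prod_type, Fintype.sum_sum_type, Fintype.sum_prod_type, hc0]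
  simp only [stl, shd, hc, hc0, Fin.sum_univ_castSucc, Fin.val_last, cz_last, Fin.val_succ,
    Fin.val_castSucc, Finset.sum_add_distrib, mul_sub, Finset.sum_sub_distrib]
  ring

theorem euler_kd {I : Fin s → Fin r → Fin (m+1)} (hI : ∀ l, StrictMono (I l)) (hr : r ≤ m + 1) :
    euler (stl s m) (shd s m) (kd I) (cd I) = (r : ℤ) * ((m : ℤ) + 1 - r) -
      ∑ l, ((r : ℤ) * ((m : ℤ) + 1 - r) - ∑ k, ((I l k : ℤ) - (k : ℤ))) := by
  rw [euler_star hI hr]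
  congr 1
  refine Finset.sum_congr rfl fun l _ => ?_
  have h1 : ∀ k : Fin r, _ := gam_sum (hI l)
  have h2 := Finset.sum_congr (rfl : (Finset.univ : Finset (Fin r)) = Finset.univ) fun k _ => h1 k
  rw [Finset.sum_comm, Finset.sum_sub_distrib] at h2
  simp only [Finset.sum_const, Finset.card_univ, Fintype.card_fin, nsmul_eq_mul] at h2
  rw [← h2]
  refine Finset.sum_congr rfl fun j _ => ?_
  rw [← Finset.sum_filter, Finset.sum_const, nsmul_eq_mul]
  congr 2
  simp only [kd, Fin.val_castSucc]
  have : ((Finset.univ.filter fun a : Fin r => (a : ℕ) < kk (I l) j)) =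
    Finset.univ.filter fun k : Fin r => (I l k : ℕ) ≤ j := by
    ext a; simp [lt_kk (hI l)]
  rw [this]; rfl

end HK
end

open Module
set_option linter.unusedSectionVars false
noncomputable section
namespace HK
open Matrix Polynomial

theorem charpoly_add_smul {n : Type} [Fintype n] [DecidableEq n] (M : Matrix n n ℂ) (μ : ℂ) :
    (M + μ • (1 : Matrix n n ℂ)).charpoly = M.charpoly.comp (X - C μ) := by
  have := Matrix.charpoly_sub_scalar M (-μ)
  rw [map_neg, sub_neg_eq_add, Matrix.scalar_apply, ← Matrix.smul_one_eq_diagonal] at this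
  rw [this]; simp [sub_eq_add_neg]

theorem arm_charpoly {r m : ℕ} {I : Fin r → Fin (m+1)} (hI : StrictMono I)
    (S : ∀ j : Fin (m+1), Matrix (Fin (kk I j)) (Fin (kk I j)) ℂ)
    (K : ∀ j : Fin m, Matrix (Fin (kk I j.succ)) (Fin (kk I j.castSucc)) ℂ)
    (KL : Matrix (Fin r) (Fin (kk I (Fin.last m))) ℂ)
    (h0 : S 0 = 0) (hS : ∀ j : Fin m, S j.succ = K j * (K j)ᴴ)
    (hT : ∀ j : Fin m, (K j)ᴴ * K j = S j.castSucc + ((cz I (j+1) - cz I j : ℤ) : ℂ) • 1)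
    (hL : KLᴴ * KL = S (Fin.last m)) :
    (KL * KLᴴ).charpoly = ∏ k : Fin r, (X - C ((m : ℂ) + 1 - r - ((I k : ℂ) - (k : ℂ)))) := by
  have key : ∀ j : Fin (m+1), (S j).charpoly =
      ∏ k ∈ Finset.univ.filter (fun k : Fin r => (I k : ℕ) ≤ j),
        (X - C (((cz I j - cz I (I k) : ℤ) : ℂ))) := by
    intro j
    induction j using Fin.induction with
    | zero =>
      rw [h0, Matrix.charpoly_zero]
      rw [Finset.prod_congr rfl (g := fun _ => (X : ℂ[X]))]
      · simp [kk]
      · intro k hk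
        simp at hk
        simp [hk]
    | succ j ih =>
      rw [hS]
      have h1 := Matrix.charpoly_mul_comm' (K j) (K j)ᴴ
      rw [hT, charpoly_add_smul, ih, Polynomial.prod_comp] at h1
      simp only [Fintype.card_fin] at h1
      have h2 : (Finset.univ.filter (fun k : Fin r => (I k : ℕ) ≤ (j.succ : Fin (m+1)))) =
        (Finset.univ.filter (fun k : Fin r => (I k : ℕ) ≤ j)) ∪
        (Finset.univ.filter (fun k : Fin r => (I k : ℕ) = j + 1)) := by
        ext k; simp; omega
      have h3 : Disjoint (Finset.univ.filter (fun k : Fin r => (I k : ℕ) ≤ j))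
        (Finset.univ.filter (fun k : Fin r => (I k : ℕ) = j + 1)) := by
        rw [Finset.disjoint_filter]; intro x _ h; omega
      have h5 : kk I (j.succ : Fin (m+1)) = kk I (j.castSucc : Fin (m+1)) +
          (Finset.univ.filter (fun k : Fin r => (I k : ℕ) = j + 1)).card := by
        unfold kk; rw [h2, Finset.card_union_of_disjoint h3]; simp
      have h4 : ∏ k ∈ Finset.univ.filter (fun k : Fin r => (I k : ℕ) = j + 1),
        (X - C (((cz I (j.succ : Fin (m+1)) - cz I (I k) : ℤ) : ℂ))) =
          X ^ (Finset.univ.filter (fun k : Fin r => (I k : ℕ) = j + 1)).card := by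
        rw [Finset.prod_congr rfl (g := fun _ => (X : ℂ[X]))]
        · simp
        · intro k hk
          simp at hk
          simp [hk]
      have hX : (X : ℂ[X]) ^ (kk I (j.castSucc : Fin (m+1))) ≠ 0 := pow_ne_zero _ X_ne_zero
      apply mul_left_cancel₀ hX
      rw [h1, h2, Finset.prod_union h3, h4, h5, pow_add]
      have h6 : ∏ k ∈ Finset.univ.filter (fun k : Fin r => (I k : ℕ) ≤ (j.castSucc : Fin (m+1))),
          (X - C (((cz I (j.castSucc : Fin (m+1)) - cz I (I k) : ℤ) : ℂ))).comp
            (X - C (((cz I (j+1) - cz I j : ℤ)) : ℂ)) =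
          ∏ k ∈ Finset.univ.filter (fun k : Fin r => (I k : ℕ) ≤ j),
        (X - C (((cz I (j.succ : Fin (m+1)) - cz I (I k) : ℤ) : ℂ))) := by
        refine Finset.prod_congr (by simp) fun k _ => ?_
        simp only [sub_comp, X_comp, C_comp, Fin.val_castSucc, Fin.val_succ]
        push_cast
        simp only [C_sub]
        ring
      rw [h6]; ring
  have h1 := Matrix.charpoly_mul_comm' KL KLᴴ
  rw [hL, key] at h1
  simp only [Fintype.card_fin] at h1
  have h5 : kk I (Fin.last m : Fin (m+1)) = r := by rw [Fin.val_last, kk_last]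
  rw [show (X : ℂ[X]) ^ kk I (Fin.last m : Fin (m+1)) = X ^ r from congrArg (fun t => (X : ℂ[X]) ^ t) h5] at h1
  have hX : (X : ℂ[X]) ^ r ≠ 0 := pow_ne_zero _ X_ne_zero
  rw [mul_left_cancel₀ hX h1]
  rw [Finset.filter_true_of_mem]
  · refine Finset.prod_congr rfl fun k _ => ?_
    rw [Fin.val_last, cz_last, cz_self hI]
    push_cast; rfl
  · intro k _
    have := (I k).2
    simp only [Fin.val_last]; omega

open ComplexOrder in
theorem all_zero {V : Type} [Fintype V] {κ : V → Type} [∀ x, Fintype (κ x)] (Z : ∀ x, Matrix (κ x) (κ x) ℂ)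
    (h : ∑ x, ((Z x)ᴴ * Z x).trace = 0) : ∀ x, Z x = 0 := by
  intro x
  rw [Finset.sum_eq_zero_iff_of_nonneg] at h
  · exact Matrix.trace_conjTranspose_mul_self_eq_zero_iff.1 (h x (Finset.mem_univ x))
  · intro x _
    exact (Matrix.posSemidef_conjTranspose_mul_self (Z x)).trace_nonneg

variable {s r m : ℕ}

theorem extract {I : Fin s → Fin r → Fin (m+1)} (hI : ∀ l, StrictMono (I l)) (hr : r ≤ m + 1)
    (K : Rep (stl s m) (shd s m) (fun x => Fin (kd I x)))
    (h : ∀ X : ∀ x, Matrix (Fin (kd I x)) (Fin (kd I x)) ℂ,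
      ∑ a, (X (shd s m a) * K a * (K a).conjTranspose).trace
        - ∑ a, (K a * X (stl s m a) * (K a).conjTranspose).trace
      = ∑ x, (Fintype.card (Fin (cd I x)) : ℂ) * (X x).trace
        - ∑ a, (Fintype.card (Fin (cd I (shd s m a))) : ℂ) * (X (stl s m a)).trace) :
    (∑ l, (K (.inr l) : Matrix (Fin r) (Fin (kk (I l) (Fin.last m))) ℂ) *
      (K (.inr l) : Matrix (Fin r) (Fin (kk (I l) (Fin.last m))) ℂ)ᴴ =
      ((m : ℂ) + 1 - r) • (1 : Matrix (Fin r) (Fin r) ℂ)) ∧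
    ∀ l, ((K (.inr l) : Matrix (Fin r) (Fin (kk (I l) (Fin.last m))) ℂ) *
      (K (.inr l) : Matrix (Fin r) (Fin (kk (I l) (Fin.last m))) ℂ)ᴴ).charpoly =
      ∏ k : Fin r, (X - C ((m : ℂ) + 1 - r - ((I l k : ℂ) - (k : ℂ)))) := by
  let Ki : ∀ l (j : Fin m), Matrix (Fin (kk (I l) j.succ)) (Fin (kk (I l) j.castSucc)) ℂ :=
    fun l j => K (.inl (l, j))
  let KL : ∀ l, Matrix (Fin r) (Fin (kk (I l) (Fin.last m))) ℂ := fun l => K (.inr l)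
  let S : ∀ l, ∀ j : Fin (m+1), Matrix (Fin (kk (I l) j)) (Fin (kk (I l) j)) ℂ := fun l =>
    Fin.cases 0 fun j => Ki l j * (Ki l j)ᴴ
  let T : ∀ l, ∀ j : Fin (m+1), Matrix (Fin (kk (I l) j)) (Fin (kk (I l) j)) ℂ := fun l =>
    Fin.lastCases ((KL l)ᴴ * KL l) fun j => (Ki l j)ᴴ * Ki l j -
      ((cz (I l) (j+1) - cz (I l) j : ℤ) : ℂ) • 1
  have hS0 : ∀ l, S l 0 = 0 := fun l => rfl
  have hSs : ∀ l (j : Fin m), S l j.succ = Ki l j * (Ki l j)ᴴ := fun l j => rfl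
  have hTl : ∀ l, T l (Fin.last m) = (KL l)ᴴ * KL l := fun l => by simp [T]
  have hTs : ∀ l (j : Fin m), T l j.castSucc = (Ki l j)ᴴ * Ki l j -
      ((cz (I l) (j+1) - cz (I l) j : ℤ) : ℂ) • 1 := fun l j => by simp [T]
  let Z : ∀ x, Matrix (Fin (kd I x)) (Fin (kd I x)) ℂ := fun x => match x with
    | none => ∑ l, KL l * (KL l)ᴴ - ((m : ℂ) + 1 - r) • (1 : Matrix (Fin r) (Fin r) ℂ)
    | some (l, j) => S l j - T l j
  have hc : ∀ l (j : Fin (m+1)), ((cd I (some (l, j)) : ℕ) : ℂ) = (cz (I l) j : ℂ) := by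
    intro l j
    have : ((cd I (some (l, j)) : ℕ) : ℤ) = cz (I l) j := by
      simp only [cd, cz]; have := kk_le (hI l) j; omega
    exact_mod_cast this
  have hc0 : ((cd I none : ℕ) : ℂ) = (m : ℂ) + 1 - r := by simp only [cd]; push_cast [hr]; ring
  have main : ∀ (Xn : Matrix (Fin r) (Fin r) ℂ)
      (Y : ∀ l (j : Fin (m+1)), Matrix (Fin (kk (I l) j)) (Fin (kk (I l) j)) ℂ),
      (Xn * (∑ l, KL l * (KL l)ᴴ - ((m : ℂ) + 1 - r) • (1 : Matrix (Fin r) (Fin r) ℂ))).trace +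
        ∑ l, ∑ j, (Y l j * (S l j - T l j)).trace = 0 := by
    intro Xn Y
    have h := h (fun x => match x with
      | none => Xn
      | some (l, j) => Y l j)
    rw [Fintype.sum_option, Fintype.sum_prod_type] at h
    simp only [Fintype.sum_sum_type, Fintype.sum_prod_type, Fintype.card_fin] at h
    simp only [stl, shd, hc, hc0, Fin.sum_univ_castSucc] at h
    have h : ∑ l, ∑ j : Fin m, (Y l j.succ * Ki l j * (Ki l j)ᴴ).trace +
       ∑ l, (Xn * KL l * (KL l)ᴴ).trace -
       (∑ l, ∑ j : Fin m, (Ki l j * Y l j.castSucc * (Ki l j)ᴴ).trace +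
       ∑ l, (KL l * Y l (Fin.last m) * (KL l)ᴴ).trace) =
       ((m : ℂ) + 1 - r) * Xn.trace + ∑ l, (∑ j : Fin m, (cz (I l) j : ℂ) * (Y l j.castSucc).trace
         + (cz (I l) m : ℂ) * (Y l (Fin.last m)).trace) -
       (∑ l, ∑ j : Fin m, (cz (I l) (j+1) : ℂ) * (Y l j.castSucc).trace +
         ∑ l, ((m : ℂ) + 1 - r) * (Y l (Fin.last m)).trace) := h
    have e1 : ∀ l, ∑ j, (Y l j * (S l j - T l j)).trace =
        ∑ j : Fin m, (Y l j.succ * Ki l j * (Ki l j)ᴴ).trace -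
        (∑ j : Fin m, ((Ki l j * Y l j.castSucc * (Ki l j)ᴴ).trace -
        ((cz (I l) (j+1) : ℂ) - cz (I l) j) * (Y l j.castSucc).trace) +
        (KL l * Y l (Fin.last m) * (KL l)ᴴ).trace) := by
      intro l
      simp only [Matrix.mul_sub, Matrix.trace_sub, Finset.sum_sub_distrib]
      rw [Fin.sum_univ_succ (fun j => (Y l j * S l j).trace),
        Fin.sum_univ_castSucc (fun j => (Y l j * T l j).trace)]
      rw [hS0, hTl]
      simp only [hSs, hTs, Matrix.mul_zero, Matrix.trace_zero, zero_add, Matrix.mul_assoc]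
      congr 2
      · rw [← Finset.sum_sub_distrib]
        refine Finset.sum_congr rfl fun j _ => ?_
        rw [Matrix.mul_sub, Matrix.trace_sub]
        congr 1
        · rw [← Matrix.mul_assoc, Matrix.trace_mul_comm]
        · simp
      · rw [← Matrix.mul_assoc, Matrix.trace_mul_comm]
    rw [Finset.sum_congr rfl fun l _ => e1 l]
    simp only [Matrix.mul_sub, Matrix.trace_sub, Finset.mul_sum, Matrix.trace_sum]
    have hcz : ∀ l, (cz (I l) m : ℂ) = (m : ℂ) + 1 - r := by
      intro l; rw [cz_last]; push_cast; ring
    simp only [Finset.sum_sub_distrib, Finset.sum_add_distrib, hcz, sub_mul, ← Matrix.mul_assoc] at h ⊢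
    simp only [Matrix.mul_smul, Matrix.mul_one, Matrix.trace_smul, smul_eq_mul]
    linear_combination h
  have hz := all_zero Z (by
    rw [Fintype.sum_option, Fintype.sum_prod_type]
    exact main (Z none)ᴴ (fun l j => (Z (some (l, j)))ᴴ))
  refine ⟨sub_eq_zero.1 (hz none), fun l => ?_⟩
  have hst : ∀ j, S l j = T l j := fun j => sub_eq_zero.1 (hz (some (l, j)))
  refine arm_charpoly (hI l) (S l) (Ki l) (KL l) (hS0 l) (hSs l) (fun j => ?_) ?_
  · rw [hst, hTs]; simp
  · rw [hst, hTl]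

end HK
end

open Module
set_option linter.unusedSectionVars false
noncomputable section
namespace HK
open Matrix

theorem exists_left_inv {m k : Type} [Fintype m] [Fintype k] [DecidableEq m] [DecidableEq k]
    (M : Matrix m k ℂ) (h : LinearIndependent ℂ M.col) : ∃ L : Matrix k m ℂ, L * M = 1 := by
  rw [← Matrix.mulVec_injective_iff] at h
  obtain ⟨g, hg⟩ := LinearMap.exists_leftInverse_of_injective (Matrix.toLin' M)
    (LinearMap.ker_eq_bot.2 h)
  refine ⟨LinearMap.toMatrix' g, ?_⟩
  have := congrArg LinearMap.toMatrix' hg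
  rw [LinearMap.toMatrix'_comp] at this
  simpa using this

theorem indep_of_left_inv {m k : Type} [Fintype m] [Fintype k] [DecidableEq m] [DecidableEq k]
    (M : Matrix m k ℂ) (L : Matrix k m ℂ) (h : L * M = 1) : Function.Injective M.mulVec := by
  intro x y hxy
  have := congrArg L.mulVec hxy
  simpa [Matrix.mulVec_mulVec, h] using this

theorem exists_indep {E : Type} [AddCommGroup E] [Module ℂ E] [FiniteDimensional ℂ E] :
    ∀ (r : ℕ) (W : Fin r → Submodule ℂ E), (∀ k : Fin r, (k : ℕ) + 1 ≤ finrank ℂ (W k)) →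
      ∃ v : Fin r → E, LinearIndependent ℂ v ∧ ∀ k, v k ∈ W k := by
  intro r
  induction r with
  | zero => intro W _; exact ⟨fun k => k.elim0, linearIndependent_empty_type, fun k => k.elim0⟩
  | succ r ih =>
    intro W hW
    obtain ⟨v, hv, hvW⟩ := ih (fun k => W k.castSucc) (fun k => by simpa using hW k.castSucc)
    have h1 : finrank ℂ (Submodule.span ℂ (Set.range v)) = r := by
      rw [finrank_span_eq_card hv]; simp
    have h2 : ¬ (W (Fin.last r) ≤ Submodule.span ℂ (Set.range v)) := by
      intro hle
      have := Submodule.finrank_mono hle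
      have := hW (Fin.last r)
      simp only [Fin.val_last] at this
      omega
    obtain ⟨x, hx, hx2⟩ := SetLike.not_le_iff_exists.1 h2
    refine ⟨Fin.snoc v x, linearIndependent_finSnoc.2 ⟨hv, hx2⟩, fun k => ?_⟩
    refine Fin.lastCases ?_ (fun k => ?_) k
    · simpa using hx
    · simpa using hvW k

/-- standard inclusion -/
def inc {a b : ℕ} (h : a ≤ b) : Matrix (Fin b) (Fin a) ℂ :=
  (1 : Matrix (Fin b) (Fin b) ℂ).submatrix id (Fin.castLE h)

theorem mul_inc {m : Type} {a b : ℕ} (h : a ≤ b) (M : Matrix m (Fin b) ℂ) :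
    M * inc h = M.submatrix id (Fin.castLE h) := by
  have := Matrix.mul_submatrix_one (Equiv.refl (Fin b)) (Fin.castLE h) M
  simpa [inc] using this

theorem inc_left_inv {a b : ℕ} (h : a ≤ b) : (inc h)ᴴ * inc h = 1 := by
  rw [mul_inc]
  simp only [inc, Matrix.conjTranspose_submatrix, Matrix.conjTranspose_one, Matrix.submatrix_submatrix]
  exact Matrix.submatrix_one _ (Fin.castLE_injective h)

theorem exists_paths {m N : ℕ} {d : Fin (m+1) → ℕ}
    (R : ∀ j : Fin m, Matrix (Fin (d j.succ)) (Fin (d j.castSucc)) ℂ)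
    (RL : Matrix (Fin N) (Fin (d (Fin.last m))) ℂ) :
    ∃ P : ∀ j, Matrix (Fin N) (Fin (d j)) ℂ, P (Fin.last m) = RL ∧
      ∀ j : Fin m, P j.castSucc = P j.succ * R j := by
  refine ⟨fun j => Fin.reverseInduction (motive := fun j => Matrix (Fin N) (Fin (d j)) ℂ) RL
    (fun j Q => Q * R j) j, ?_, fun j => ?_⟩
  · simp
  · simp

variable {s r m : ℕ}

theorem hasSub_of_inter {I : Fin s → Fin r → Fin (m+1)} (hI : ∀ l, StrictMono (I l))
    (hInter : Intersecting I)
    (R : Rep (stl s m) (shd s m) (fun x => Fin (xd s m x)))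
    (hR : ∀ a, ∃ L : Matrix (Fin (xd s m (stl s m a))) (Fin (xd s m (shd s m a))) ℂ, L * R a = 1) :
    HasSub (fun x => Fin (kd I x)) R := by
  have hp := fun l => exists_paths (N := m + 1) (d := fun j : Fin (m+1) => (j : ℕ) + 1)
    (fun j : Fin m => R (.inl (l, j))) (R (.inr l))
  choose P hPl hPs using hp
  have hinv : ∀ l (j : Fin (m+1)), ∃ L : Matrix (Fin ((j : ℕ) + 1)) (Fin (m+1)) ℂ, L * P l j = 1 := by
    intro l j
    induction j using Fin.reverseInduction with
    | last => rw [hPl]; exact hR (.inr l)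
    | cast j ih =>
      obtain ⟨L, hL⟩ := ih
      obtain ⟨L', hL'⟩ := hR (.inl (l, j))
      refine ⟨L' * L, ?_⟩
      rw [hPs, Matrix.mul_assoc, ← Matrix.mul_assoc L, hL, Matrix.one_mul]
      exact hL'
  choose Q hQ using hinv
  have hinj : ∀ l j, Function.Injective (P l j).mulVecLin := fun l j =>
    indep_of_left_inv _ _ (hQ l j)
  let F : Fin s → Flagg (m+1) := fun l =>
    { F := fun j => LinearMap.range (P l j).mulVecLin
      mono := by
        rw [Fin.monotone_iff_le_succ]
        intro j
        simp only [hPs, Matrix.mulVecLin_mul]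
        exact LinearMap.range_comp_le_range _ _
      rank_eq := fun j => by
        rw [LinearMap.finrank_range_of_inj (hinj l j)]; simp }
  obtain ⟨V, hV, hVF⟩ := hInter F
  choose v hv hvF using fun l => exists_indep r (fun k => V ⊓ (F l).F (I l k)) (hVF l)
  let b : Basis (Fin r) ℂ V := (finBasis ℂ V).reindex (finCongr hV)
  let Bn : Matrix (Fin (m+1)) (Fin r) ℂ := Matrix.of fun i k => (b k : Fin (m+1) → ℂ) i
  have hBn : LinearIndependent ℂ Bn.col := by
    have : Bn.col = V.subtype ∘ b := by ext k i; simp [Bn, Matrix.col]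
    rw [this]
    exact b.linearIndependent.map' _ (Submodule.ker_subtype V)
  have hy : ∀ l k, ∃ y : Fin r → ℂ, Bn *ᵥ y = v l k := by
    intro l k
    let u : V := ⟨v l k, (hvF l k).1⟩
    refine ⟨fun i => b.repr u i, ?_⟩
    have := congrArg (fun z : V => (z : Fin (m+1) → ℂ)) (b.sum_repr u)
    simp only [Submodule.coe_sum, Submodule.coe_smul] at this
    rw [Matrix.mulVec_eq_sum]
    rw [show v l k = (u : Fin (m+1) → ℂ) from rfl, ← this]
    refine Finset.sum_congr rfl fun i _ => ?_
    ext t; simp [Bn, mul_comm]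
  choose y hy using hy
  let Vm : ∀ l, Matrix (Fin (m+1)) (Fin r) ℂ := fun l => Matrix.of fun i k => v l k i
  have hw : ∀ l (j : Fin (m+1)) (k : Fin (kk (I l) j)), ∃ w, P l j *ᵥ w =
      v l (Fin.castLE (kk_le_r _ _) k) := by
    intro l j k
    have h1 : I l (Fin.castLE (kk_le_r _ _) k) ≤ j :=
      (lt_kk (hI l) (Fin.castLE (kk_le_r _ _) k) j).1 k.2
    have := (F l).mono h1 (hvF l (Fin.castLE (kk_le_r _ _) k)).2
    obtain ⟨w, hw⟩ := this
    exact ⟨w, hw⟩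
  choose w hw using hw
  let Bi : ∀ l (j : Fin (m+1)), Matrix (Fin ((j : ℕ) + 1)) (Fin (kk (I l) j)) ℂ := fun l j =>
    Matrix.of fun i k => w l j k i
  have hPB : ∀ l j, P l j * Bi l j = (Vm l).submatrix id (Fin.castLE (kk_le_r _ _)) := by
    intro l j
    ext i k
    exact congrFun (hw l j k) i
  have hBi : ∀ l (j : Fin (m+1)), LinearIndependent ℂ ((Vm l).submatrix id (Fin.castLE (kk_le_r (I l) j))).col := by
    intro l j
    exact (hv l).comp _ (Fin.castLE_injective (kk_le_r (I l) j))
  have hLi : ∀ l (j : Fin (m+1)), ∃ L : Matrix (Fin (kk (I l) j)) (Fin ((j : ℕ) + 1)) ℂ, L * Bi l j = 1 := by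
    intro l j
    obtain ⟨L, hL⟩ := exists_left_inv _ (hBi l j)
    exact ⟨L * P l j, by rw [Matrix.mul_assoc, hPB, hL]⟩
  choose Li hLi using hLi
  obtain ⟨Ln, hLn⟩ := exists_left_inv _ hBn
  let Yn : ∀ l, Matrix (Fin r) (Fin (kk (I l) (Fin.last m))) ℂ := fun l =>
    Matrix.of fun i k => y l (Fin.castLE (kk_le_r _ _) k) i
  have hYn : ∀ l, Bn * Yn l = (Vm l).submatrix id (Fin.castLE (kk_le_r _ _)) := by
    intro l
    ext i k
    exact congrFun (hy l _) i
  have hmono : ∀ l (j : Fin m), kk (I l) (j.castSucc : Fin (m+1)) ≤ kk (I l) (j.succ : Fin (m+1)) :=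
    fun l j => kk_mono (I l) j
  refine ⟨fun a => match a with
    | .inl (l, j) => inc (hmono l j)
    | .inr l => Yn l, fun x => match x with
    | some (l, j) => Bi l j
    | none => Bn, fun x => match x with
    | some (l, j) => Li l j
    | none => Ln, ?_, ?_⟩
  · intro x
    rcases x with _ | ⟨l, j⟩
    · exact hLn
    · exact hLi l j
  · intro a
    rcases a with ⟨l, j⟩ | l
    · change R (.inl (l, j)) * Bi l j.castSucc = Bi l j.succ * inc (hmono l j)
      have h1 : P l j.succ * (R (.inl (l, j)) * Bi l j.castSucc) =
          P l j.succ * (Bi l j.succ * inc (hmono l j)) := by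
        rw [← Matrix.mul_assoc, ← Matrix.mul_assoc, ← hPs, hPB, hPB, mul_inc]
        rfl
      have h2 := congrArg (fun Z => Q l j.succ * Z) h1
      simp only [← Matrix.mul_assoc, hQ] at h2
      simpa [Matrix.one_mul] using h2
    · change R (.inr l) * Bi l (Fin.last m) = Bn * Yn l
      rw [hYn, ← hPB, hPl]

theorem open_inj {V A : Type} {tl hd : A → V} [Fintype V] [Fintype A] (d : V → ℕ) :
    IsOpen {R : Rep tl hd (fun x => Fin (d x)) | ∀ a, ∃ L : Matrix (Fin (d (tl a))) (Fin (d (hd a))) ℂ,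
      L * R a = 1} := by
  simp only [Set.ofPred_forall]
  refine isOpen_iInter_of_finite fun a => ?_
  rw [isOpen_iff_mem_nhds]
  rintro R ⟨L, hL⟩
  have hc : Continuous fun R : Rep tl hd (fun x => Fin (d x)) => (L * R a).det :=
    (continuous_const.matrix_mul (continuous_apply a)).matrix_det
  have ho : IsOpen {R : Rep tl hd (fun x => Fin (d x)) | (L * R a).det ≠ 0} :=
    isOpen_ne_fun hc continuous_const
  refine Filter.mem_of_superset (ho.mem_nhds (by simp [hL])) ?_
  intro R' hR'
  refine ⟨(L * R' a)⁻¹ * L, ?_⟩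
  rw [Matrix.mul_assoc, Matrix.nonsing_inv_mul _ (isUnit_iff_ne_zero.2 hR')]

theorem xd_le (a : SA s m) : xd s m (stl s m a) ≤ xd s m (shd s m a) := by
  rcases a with ⟨l, j⟩ | l <;> simp

end HK
end

open Module
set_option linter.unusedSectionVars false
noncomputable section
namespace HK
open Matrix

theorem exists_perm_of_map_eq {n : ℕ} {α : Type} [DecidableEq α] (f g : Fin n → α)
    (h : Multiset.map f Finset.univ.val = Multiset.map g Finset.univ.val) :
    ∃ e : Equiv.Perm (Fin n), ∀ i, f i = g (e i) := by
  have h1 : ∀ c, Nonempty ({a // f a = c} ≃ {b // g b = c}) := by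
    intro c
    refine ⟨Fintype.equivOfCardEq ?_⟩
    have := congrArg (Multiset.count c) h
    rw [Multiset.count_map, Multiset.count_map] at this
    rw [Fintype.card_subtype, Fintype.card_subtype]
    simp only [eq_comm (a := c)] at this
    exact this
  exact ⟨Equiv.ofFiberEquiv fun c => (h1 c).some, fun i => (Equiv.ofFiberEquiv_map _ i).symm⟩

variable {s r m : ℕ}

theorem gamma_antitone {n : ℕ} {I : Fin s → Fin r → Fin n} (hI : ∀ l, StrictMono (I l)) (l : Fin s) :
    Antitone (GammaT I l) := by
  cases r with
  | zero => intro i; exact i.elim0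
  | succ r =>
    rw [Fin.antitone_iff_succ_le]
    intro i
    unfold GammaT
    have h : I l i.castSucc < I l i.succ := hI l (Fin.castSucc_lt_succ)
    have h2 : (I l i.castSucc : ℕ) + 1 ≤ (I l i.succ : ℕ) := h
    have h3 : ((I l i.castSucc : ℕ) : ℝ) + 1 ≤ ((I l i.succ : ℕ) : ℝ) := by exact_mod_cast h2
    simp only [Fin.val_succ, Fin.val_castSucc]
    push_cast
    linarith

theorem edim_eq {I : Fin s → Fin r → Fin (m+1)} (hI : ∀ l, StrictMono (I l)) (hr : r ≤ m + 1) :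
    euler (stl s m) (shd s m) (kd I) (cd I) = edim I := by
  rw [euler_kd hI hr]; unfold edim dimI; push_cast; rfl

theorem crd_fin {V : Type} (d : V → ℕ) : crd (fun x => Fin (d x)) = d := by
  funext x; simp [crd]

theorem kirwan_of_inter {I : Fin s → Fin r → Fin (m+1)} (hI : ∀ l, StrictMono (I l)) (hr : r ≤ m + 1)
    (hInter : Intersecting I) (he : edim I = 0) :
    KirwanMem (GammaT I) (((m+1 : ℕ) : ℝ) - (r : ℝ)) := by
  refine ⟨gamma_antitone hI, ?_⟩
  have h0 : euler (stl s m) (shd s m) (crd fun x => Fin (kd I x)) (crd fun x => Fin (cd I x)) = 0 := by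
    rw [crd_fin, crd_fin, edim_eq hI hr, he]
  obtain ⟨K0, C, hs⟩ := S2 (κ := fun x => Fin (kd I x)) (c := fun x => Fin (cd I x))
    (ι := fun x => Fin (xd s m x)) (fun x => by
      simp only [crd_fin]; exact kd_add_cd hI hr x) h0
    {R : Rep (stl s m) (shd s m) (fun x => Fin (xd s m x)) |
      ∀ a, ∃ L : Matrix (Fin (xd s m (stl s m a))) (Fin (xd s m (shd s m a))) ℂ, L * R a = 1}
    (open_inj _) ⟨fun a => inc (xd_le a), fun a => ⟨_, inc_left_inv (xd_le a)⟩⟩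
    (fun R hR => hasSub_of_inter hI hInter R hR)
  have hfr : finrank ℂ (∀ x, Matrix (Fin (cd I x)) (Fin (kd I x)) ℂ) =
      finrank ℂ (∀ a, Matrix (Fin (cd I (shd s m a))) (Fin (kd I (stl s m a))) ℂ) := by
    have := euler_eq (tl := stl s m) (hd := shd s m) (fun x => Fin (kd I x)) (fun x => Fin (cd I x))
    rw [h0] at this
    omega
  have hbij : Function.Bijective (Dm K0 C) :=
    ⟨(LinearMap.injective_iff_surjective_of_finrank_eq_finrank hfr).2 hs, hs⟩
  obtain ⟨K, hK⟩ := KN K0 C hbij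
  obtain ⟨h1, h2⟩ := extract hI hr K hK
  let KL : ∀ l, Matrix (Fin r) (Fin (kk (I l) (Fin.last m))) ℂ := fun l => K (.inr l)
  refine ⟨fun l => KL l * (KL l)ᴴ, fun l => Matrix.isHermitian_mul_conjTranspose_self _, ?_, fun l => ?_⟩
  · refine Eq.trans h1 ?_
    push_cast; rfl
  · have hA : (KL l * (KL l)ᴴ).IsHermitian := Matrix.isHermitian_mul_conjTranspose_self _
    have h3 := hA.roots_charpoly_eq_eigenvalues
    have h4 : (KL l * (KL l)ᴴ).charpoly = _ := h2 l
    rw [h4, Polynomial.roots_prod] at h3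
    · simp only [Polynomial.roots_X_sub_C] at h3
      rw [Multiset.bind_singleton] at h3
      have h5 := congrArg (Multiset.map Complex.re) h3
      rw [Multiset.map_map, Multiset.map_map] at h5
      classical
      obtain ⟨e, he⟩ := exists_perm_of_map_eq _ _ h5
      refine ⟨e, fun i => ?_⟩
      have := he i
      simp only [Function.comp, Complex.sub_re, Complex.add_re, Complex.natCast_re, Complex.one_re,
        RCLike.ofReal_eq_complex_ofReal, Complex.ofReal_re] at this
      unfold GammaT
      push_cast
      rw [← this]
      ring
    · exact Finset.prod_ne_zero_iff.2 fun k _ => Polynomial.X_sub_C_ne_zero _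

end HK
end

open Module
set_option linter.unusedSectionVars false
noncomputable section
namespace HK
open Matrix
variable {s r m : ℕ}

theorem exists_basis_matrix {N d : ℕ} (W : Submodule ℂ (Fin N → ℂ)) (h : finrank ℂ W = d) :
    ∃ (b : Matrix (Fin N) (Fin d) ℂ) (L : Matrix (Fin d) (Fin N) ℂ), L * b = 1 ∧
      LinearMap.range b.mulVecLin = W := by
  let b : Basis (Fin d) ℂ W := (finBasis ℂ W).reindex (finCongr h)
  let Bn : Matrix (Fin N) (Fin d) ℂ := Matrix.of fun i k => (b k : Fin N → ℂ) i
  have hcol : Bn.col = W.subtype ∘ b := by ext k i; simp [Bn, Matrix.col]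
  have hBn : LinearIndependent ℂ Bn.col := by
    rw [hcol]
    exact b.linearIndependent.map' _ (Submodule.ker_subtype W)
  obtain ⟨L, hL⟩ := exists_left_inv _ hBn
  refine ⟨Bn, L, hL, ?_⟩
  rw [Matrix.range_mulVecLin, hcol, Set.range_comp, Submodule.span_image, b.span_eq]
  simp

theorem inter_of_surj {I : Fin s → Fin r → Fin (m+1)} (hI : ∀ l, StrictMono (I l)) (hr : r ≤ m + 1)
    (K : Rep (stl s m) (shd s m) (fun x => Fin (kd I x)))
    (C : Rep (stl s m) (shd s m) (fun x => Fin (cd I x)))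
    (hs : Function.Surjective (Dm K C)) : Intersecting I := by
  intro F
  choose b bL hbL hbr using fun l (j : Fin (m+1)) => exists_basis_matrix _ ((F l).rank_eq j)
  have hT : ∀ l (j : Fin m), ∃ T : Matrix (Fin ((j.succ : Fin (m+1)) + 1)) (Fin ((j.castSucc : Fin (m+1)) + 1)) ℂ,
      b l j.succ * T = b l j.castSucc := by
    intro l j
    have h1 : ∀ k, ∃ w, b l j.succ *ᵥ w = (b l j.castSucc).col k := by
      intro k
      have h2 : (b l j.castSucc).col k ∈ (F l).F j.succ := by
        refine (F l).mono (Fin.castSucc_lt_succ (i := j)).le ?_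
        rw [← hbr, Matrix.range_mulVecLin]
        exact Submodule.subset_span ⟨k, rfl⟩
      rw [← hbr] at h2
      exact h2
    choose w hw using h1
    refine ⟨Matrix.of fun i k => w k i, ?_⟩
    ext i k
    exact congrFun (hw k) i
  choose T hT using hT
  let R : Rep (stl s m) (shd s m) (fun x => Fin (xd s m x)) := fun a => match a with
    | .inl (l, j) => T l j
    | .inr l => b l (Fin.last m)
  obtain ⟨Y, B, L, hL, hB⟩ := S1 K C hs
    (fun x => finSumFinEquiv.trans (finCongr (kd_add_cd hI hr x))) R
  let Bn : Matrix (Fin (m+1)) (Fin r) ℂ := B none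
  let Bi : ∀ l (j : Fin (m+1)), Matrix (Fin ((j : ℕ) + 1)) (Fin (kk (I l) j)) ℂ :=
    fun l j => B (some (l, j))
  have hBn : (L none : Matrix (Fin r) (Fin (m+1)) ℂ) * Bn = 1 := hL none
  have hBi : ∀ l (j : Fin (m+1)),
    (L (some (l, j)) : Matrix (Fin (kk (I l) j)) (Fin ((j : ℕ) + 1)) ℂ) * Bi l j = 1 :=
    fun l j => hL (some (l, j))
  have hpath : ∀ l (j : Fin (m+1)), ∃ Z : Matrix (Fin r) (Fin (kk (I l) j)) ℂ,
      b l j * Bi l j = Bn * Z := by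
    intro l j
    induction j using Fin.reverseInduction with
    | last => exact ⟨Y (.inr l), hB (.inr l)⟩
    | cast j ih =>
      obtain ⟨Z, hZ⟩ := ih
      have h1 : T l j * Bi l j.castSucc = Bi l j.succ *
        (Y (.inl (l, j)) : Matrix (Fin (kk (I l) j.succ)) (Fin (kk (I l) j.castSucc)) ℂ) := hB (.inl (l, j))
      exact ⟨Z * (Y (.inl (l, j)) : Matrix (Fin (kk (I l) j.succ)) (Fin (kk (I l) j.castSucc)) ℂ), by
        rw [← hT, Matrix.mul_assoc, h1, ← Matrix.mul_assoc, hZ, Matrix.mul_assoc]⟩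
  refine ⟨LinearMap.range Bn.mulVecLin, ?_, fun l k => ?_⟩
  · rw [LinearMap.finrank_range_of_inj (indep_of_left_inv _ _ hBn)]; simp
  · obtain ⟨Z, hZ⟩ := hpath l (I l k)
    have h1 : LinearMap.range (b l (I l k) * Bi l (I l k)).mulVecLin ≤
        LinearMap.range Bn.mulVecLin ⊓ (F l).F (I l k) := by
      refine le_inf ?_ ?_
      · rw [hZ, Matrix.mulVecLin_mul]; exact LinearMap.range_comp_le_range _ _
      · rw [← hbr, Matrix.mulVecLin_mul]; exact LinearMap.range_comp_le_range _ _
    refine le_trans ?_ (Submodule.finrank_mono h1)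
    have h2 : (L (some (l, I l k)) : Matrix (Fin (kk (I l) (I l k))) (Fin (((I l k) : ℕ) + 1)) ℂ) * bL l (I l k) *
        (b l (I l k) * Bi l (I l k)) = 1 := by
      rw [Matrix.mul_assoc, ← Matrix.mul_assoc (bL l (I l k)), hbL, Matrix.one_mul, hBi]
    rw [LinearMap.finrank_range_of_inj (indep_of_left_inv _ _ h2)]
    simp [kk_self (hI l)]

open ComplexOrder in
theorem trace_ge {a b z r : Type} [Fintype a] [Fintype b] [Fintype z] [Fintype r] [DecidableEq a]
    [DecidableEq b] [DecidableEq z] [DecidableEq r] (E : Matrix r a ℂ) (Z : Matrix r z ℂ)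
    (B : Matrix a b ℂ) (T : Matrix z b ℂ) (hE : Eᴴ * E = 1) (hZ : Zᴴ * Z = 1) (hB : Bᴴ * B = 1)
    (h : E * B = Z * T) : (Fintype.card b : ℝ) ≤ (Zᴴ * (E * Eᴴ) * Z).trace.re := by
  have hT : Tᴴ * T = 1 := by
    calc Tᴴ * T = Tᴴ * (Zᴴ * Z) * T := by rw [hZ, Matrix.mul_one]
      _ = (Z * T)ᴴ * (Z * T) := by simp only [Matrix.conjTranspose_mul, Matrix.mul_assoc]
      _ = (E * B)ᴴ * (E * B) := by rw [h]
      _ = Bᴴ * (Eᴴ * E) * B := by simp only [Matrix.conjTranspose_mul, Matrix.mul_assoc]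
      _ = 1 := by rw [hE, Matrix.mul_one, hB]
  have hGB : Eᴴ * Z * T = B := by
    rw [Matrix.mul_assoc, ← h, ← Matrix.mul_assoc, hE, Matrix.one_mul]
  set G := Eᴴ * Z with hG
  have hGG : Zᴴ * (E * Eᴴ) * Z = Gᴴ * G := by
    simp only [hG, Matrix.conjTranspose_mul, Matrix.conjTranspose_conjTranspose, Matrix.mul_assoc]
  rw [hGG]
  have hQ : (1 - T * Tᴴ) * (1 - T * Tᴴ)ᴴ = 1 - T * Tᴴ := by
    have : T * Tᴴ * (T * Tᴴ) = T * Tᴴ := by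
      rw [Matrix.mul_assoc, ← Matrix.mul_assoc Tᴴ, hT, Matrix.one_mul]
    simp only [Matrix.conjTranspose_sub, Matrix.conjTranspose_one, Matrix.conjTranspose_mul,
      Matrix.conjTranspose_conjTranspose, Matrix.mul_sub, Matrix.sub_mul, Matrix.one_mul, Matrix.mul_one,
      this]
    abel
  have h1 : 0 ≤ ((G * (1 - T * Tᴴ))ᴴ * (G * (1 - T * Tᴴ))).trace :=
    (Matrix.posSemidef_conjTranspose_mul_self _).trace_nonneg
  have h2 : ((G * (1 - T * Tᴴ))ᴴ * (G * (1 - T * Tᴴ))).trace = (Gᴴ * G).trace - (Fintype.card b : ℂ) := by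
    calc ((G * (1 - T * Tᴴ))ᴴ * (G * (1 - T * Tᴴ))).trace
        = ((G * (1 - T * Tᴴ)) * (G * (1 - T * Tᴴ))ᴴ).trace := Matrix.trace_mul_comm _ _
      _ = (G * ((1 - T * Tᴴ) * (1 - T * Tᴴ)ᴴ) * Gᴴ).trace := by
          rw [Matrix.conjTranspose_mul]; simp only [Matrix.mul_assoc]
      _ = (G * Gᴴ).trace - ((G * T) * (G * T)ᴴ).trace := by
          rw [hQ, ← Matrix.trace_sub]
          simp only [Matrix.mul_sub, Matrix.sub_mul, Matrix.mul_one, Matrix.conjTranspose_mul,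
            Matrix.mul_assoc]
      _ = (Gᴴ * G).trace - (Fintype.card b : ℂ) := by
          rw [Matrix.trace_mul_comm G, hGB, Matrix.trace_mul_comm B, hB, Matrix.trace_one]
  rw [h2] at h1
  have := (Complex.le_def.1 h1).1
  simp at this
  linarith

theorem inc_apply {a b : ℕ} (h : a ≤ b) (i : Fin b) (t : Fin a) :
    inc h i t = if i = Fin.castLE h t then 1 else 0 := by
  unfold inc; rw [Matrix.submatrix_apply, Matrix.one_apply]; rfl

theorem diag_decomp {I : Fin r → Fin (m+1)} (hI : StrictMono I) :
    Matrix.diagonal (fun k : Fin r => (((m : ℤ) + 1 - r - ((I k : ℤ) - k) : ℤ) : ℂ)) =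
      ∑ j : Fin m, ((cz I (j+1) - cz I j : ℤ) : ℂ) •
        (inc (kk_le_r I (j.castSucc : Fin (m+1))) * (inc (kk_le_r I (j.castSucc : Fin (m+1))))ᴴ) := by
  have hinc : ∀ {a b : ℕ} (h : a ≤ b), inc h * (inc h)ᴴ =
      Matrix.diagonal (fun k : Fin b => if (k : ℕ) < a then (1 : ℂ) else 0) := by
    intro a b h
    ext i k
    rw [Matrix.mul_apply]
    by_cases hk : (k : ℕ) < a
    · rw [Finset.sum_eq_single ⟨k, hk⟩]
      · by_cases hik : i = k
        · subst hik
          have h9 : i = Fin.castLE h ⟨i, hk⟩ := by ext; simp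
          simp [inc_apply, hk, ← h9]
        · have h9 : k = Fin.castLE h ⟨k, hk⟩ := by ext; simp
          simp [inc_apply, hik, ← h9]
      · intro t _ ht
        have : k ≠ Fin.castLE h t := by
          intro hh; apply ht; ext; simp [hh]
        simp [inc_apply, this]
      · simp
    · rw [Finset.sum_eq_zero]
      · by_cases hik : i = k
        · subst hik; simp [hk]
        · simp [hik]
      · intro t _
        have : k ≠ Fin.castLE h t := by
          intro hh; apply hk; rw [hh]; simp
        simp [inc_apply, this]
  simp only [hinc]
  ext i k
  rw [Matrix.sum_apply]
  by_cases hik : i = k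
  · subst hik
    rw [Matrix.diagonal_apply_eq, ← gam_sum hI, Int.cast_sum]
    refine Finset.sum_congr rfl fun j _ => ?_
    simp only [Matrix.smul_apply, Matrix.diagonal_apply_eq, Fin.val_castSucc, smul_eq_mul]
    split_ifs <;> simp
  · simp [hik]

end HK
end

open Module
set_option linter.unusedSectionVars false
noncomputable section
namespace HK
open Matrix
variable {s r m : ℕ}

theorem exists_eig {A : Matrix (Fin r) (Fin r) ℂ} (hA : A.IsHermitian) (e : Equiv.Perm (Fin r)) :
    ∃ U : Matrix (Fin r) (Fin r) ℂ, Uᴴ * U = 1 ∧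
      A = U * Matrix.diagonal (fun k => (hA.eigenvalues (e k) : ℂ)) * Uᴴ := by
  let U0 : Matrix (Fin r) (Fin r) ℂ := hA.eigenvectorUnitary
  have h0 : U0ᴴ * U0 = 1 := Unitary.coe_star_mul_self hA.eigenvectorUnitary
  have h1 : A = U0 * Matrix.diagonal (fun k => (hA.eigenvalues k : ℂ)) * U0ᴴ := by
    conv_lhs => rw [hA.spectral_theorem, Unitary.conjStarAlgAut_apply]
    rfl
  refine ⟨U0.submatrix id e, ?_, ?_⟩
  · rw [Matrix.conjTranspose_submatrix, ← Matrix.submatrix_mul _ _ _ _ _ Function.bijective_id, h0]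
    exact Matrix.submatrix_one _ e.injective
  · have h2 : Matrix.diagonal (fun k => (hA.eigenvalues (e k) : ℂ)) =
      (Matrix.diagonal (fun k => (hA.eigenvalues k : ℂ))).submatrix e e :=
      (Matrix.submatrix_diagonal (fun k => (hA.eigenvalues k : ℂ)) e e.injective).symm
    rw [h2, Matrix.conjTranspose_submatrix, Matrix.submatrix_mul_equiv, Matrix.submatrix_mul_equiv]
    simpa using h1

theorem kirwan_edim {I : Fin s → Fin r → Fin (m+1)}
    (hK : KirwanMem (GammaT I) (((m+1 : ℕ) : ℝ) - (r : ℝ))) : edim I = 0 := by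
  obtain ⟨_, A, hA, hsum, he⟩ := hK
  have h1 := congrArg (fun M => (Matrix.trace M).re) hsum
  simp only [Matrix.trace_sum, Matrix.trace_smul, Matrix.trace_one, Fintype.card_fin] at h1
  have h2 : ∀ l, (A l).trace.re = ∑ k, GammaT I l k := by
    intro l
    obtain ⟨e, he⟩ := he l
    rw [(hA l).trace_eq_sum_eigenvalues]
    simp only [he]
    rw [Equiv.sum_comp e (fun i => (hA l).eigenvalues i), Complex.re_sum]
    simp
  rw [Complex.re_sum, Finset.sum_congr rfl fun l _ => h2 l] at h1
  have h3 : (edim I : ℝ) = 0 := by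
    unfold edim dimI
    unfold GammaT at h1
    simp only [Finset.sum_add_distrib, Finset.sum_sub_distrib, Finset.sum_const, Finset.card_univ,
      Fintype.card_fin, nsmul_eq_mul, smul_eq_mul] at h1
    have h4 : (((((m + 1 : ℕ) : ℝ) - (r : ℝ) : ℝ) : ℂ) * (r : ℂ)).re = (((m + 1 : ℕ) : ℝ) - (r : ℝ)) * r := by
      rw [Complex.re_ofReal_mul, Complex.natCast_re]
    rw [h4] at h1
    push_cast at h1 ⊢
    simp only [Finset.sum_sub_distrib, Finset.sum_const, Finset.card_univ,
      Fintype.card_fin, nsmul_eq_mul]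
    linarith
  exact_mod_cast h3

theorem inter_of_kirwan {I : Fin s → Fin r → Fin (m+1)} (hI : ∀ l, StrictMono (I l)) (hr : r ≤ m + 1)
    (hK : KirwanMem (GammaT I) (((m+1 : ℕ) : ℝ) - (r : ℝ))) : Intersecting I := by
  by_contra hcon
  have he0 := kirwan_edim hK
  have h0 : euler (stl s m) (shd s m) (crd fun x => Fin (kd I x)) (crd fun x => Fin (cd I x)) = 0 := by
    rw [crd_fin, crd_fin, edim_eq hI hr, he0]
  have hfr : finrank ℂ (∀ x, Matrix (Fin (cd I x)) (Fin (kd I x)) ℂ) =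
      finrank ℂ (∀ a, Matrix (Fin (cd I (shd s m a))) (Fin (kd I (stl s m a))) ℂ) := by
    have := euler_eq (tl := stl s m) (hd := shd s m) (fun x => Fin (kd I x)) (fun x => Fin (cd I x))
    rw [h0] at this
    omega
  have hhom : ∀ (R : Rep (stl s m) (shd s m) (fun x => Fin (kd I x)))
      (S : Rep (stl s m) (shd s m) (fun x => Fin (cd I x))), (1 : ℤ) ≤ hom R S -
        euler (stl s m) (shd s m) (crd fun x => Fin (kd I x)) (crd fun x => Fin (cd I x)) := by
    intro R S
    rw [h0]
    by_contra hc
    have hz : hom R S = 0 := by omega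
    unfold hom at hz
    rw [Submodule.finrank_eq_zero] at hz
    have hinj : Function.Injective (Dm R S) := LinearMap.ker_eq_bot.1 hz
    exact hcon (inter_of_surj hI hr R S
      ((LinearMap.injective_iff_surjective_of_finrank_eq_finrank hfr).1 hinj))
  obtain ⟨_, A, hA, hsum, he⟩ := hK
  choose e he using he
  choose U hU hAU using fun l => exists_eig (hA l) (e l)
  have hmono : ∀ l (j : Fin m), kk (I l) (j.castSucc : Fin (m+1)) ≤ kk (I l) (j.succ : Fin (m+1)) :=
    fun l j => kk_mono (I l) j
  let E : ∀ l (j : Fin (m+1)), Matrix (Fin r) (Fin (kk (I l) j)) ℂ := fun l j =>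
    U l * inc (kk_le_r (I l) j)
  have hE : ∀ l j, (E l j)ᴴ * E l j = 1 := by
    intro l j
    simp only [E, Matrix.conjTranspose_mul]
    rw [Matrix.mul_assoc, ← Matrix.mul_assoc (U l)ᴴ, hU, Matrix.one_mul, inc_left_inv]
  have hEs : ∀ l (j : Fin m), E l j.succ * inc (hmono l j) = E l j.castSucc := by
    intro l j
    simp only [E, Matrix.mul_assoc]
    rw [mul_inc]
    rfl
  have hAE : ∀ l, A l = ∑ j : Fin m, ((cz (I l) (j+1) - cz (I l) j : ℤ) : ℂ) •
      (E l j.castSucc * (E l j.castSucc)ᴴ) := by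
    intro l
    have h1 : (fun k => ((hA l).eigenvalues (e l k) : ℂ)) =
        fun k : Fin r => (((m : ℤ) + 1 - r - ((I l k : ℤ) - k) : ℤ) : ℂ) := by
      funext k
      rw [← he l k]
      unfold GammaT
      push_cast
      ring
    rw [hAU l, h1, diag_decomp (hI l), Matrix.mul_sum, Matrix.sum_mul]
    refine Finset.sum_congr rfl fun j _ => ?_
    simp only [E, Matrix.conjTranspose_mul, Matrix.mul_assoc, Matrix.mul_smul, Matrix.smul_mul]
  let R : Rep (stl s m) (shd s m) (fun x => Fin (kd I x)) := fun a => match a with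
    | .inl (l, j) => inc (hmono l j)
    | .inr l => E l (Fin.last m)
  obtain ⟨k', hsub, hk'⟩ := thmQ (tl := stl s m) (hd := shd s m) (fun x => Fin (cd I x)) 1 _
    (fun x => Fin (kd I x)) rfl hhom R
  rw [crd_fin, euler_star hI hr] at hk'
  obtain ⟨Y, B, hB, hYB⟩ := hsub.ortho
  let Z : Matrix (Fin r) (Fin (k' none)) ℂ := B none
  let Bi : ∀ l (j : Fin (m+1)), Matrix (Fin (kk (I l) j)) (Fin (k' (some (l, j)))) ℂ :=
    fun l j => B (some (l, j))
  have hZ : Zᴴ * Z = 1 := hB none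
  have hBi : ∀ l j, (Bi l j)ᴴ * Bi l j = 1 := fun l j => hB (some (l, j))
  have hpath : ∀ l (j : Fin (m+1)), ∃ T : Matrix (Fin (k' none)) (Fin (k' (some (l, j)))) ℂ,
      E l j * Bi l j = Z * T := by
    intro l j
    induction j using Fin.reverseInduction with
    | last => exact ⟨Y (.inr l), hYB (.inr l)⟩
    | cast j ih =>
      obtain ⟨T, hT⟩ := ih
      let Yj : Matrix (Fin (k' (some (l, j.succ)))) (Fin (k' (some (l, j.castSucc)))) ℂ := Y (.inl (l, j))
      have h1 : inc (hmono l j) * Bi l j.castSucc = Bi l j.succ * Yj := hYB (.inl (l, j))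
      exact ⟨T * Yj, by
        rw [← hEs, Matrix.mul_assoc, h1, ← Matrix.mul_assoc, hT, Matrix.mul_assoc]⟩
  have hge : ∀ l (j : Fin (m+1)), (k' (some (l, j)) : ℝ) ≤ (Zᴴ * (E l j * (E l j)ᴴ) * Z).trace.re := by
    intro l j
    obtain ⟨T, hT⟩ := hpath l j
    simpa using trace_ge (E l j) Z (Bi l j) T (hE l j) hZ (hBi l j) hT
  have htot : ∑ l, (Zᴴ * A l * Z).trace.re = (k' none : ℝ) * ((m : ℝ) + 1 - r) := by
    rw [← Complex.re_sum, ← Matrix.trace_sum, ← Matrix.sum_mul, ← Matrix.mul_sum, hsum]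
    simp only [Matrix.mul_smul, Matrix.smul_mul, Matrix.mul_one, hZ, Matrix.trace_smul, Matrix.trace_one,
      Fintype.card_fin, smul_eq_mul]
    rw [Complex.re_ofReal_mul, Complex.natCast_re]
    push_cast; ring
  have hl : ∀ l, ∑ j : Fin m, (k' (some (l, j.castSucc)) : ℝ) * ((cz (I l) (j+1) - cz (I l) j : ℤ) : ℝ) ≤
      (Zᴴ * A l * Z).trace.re := by
    intro l
    rw [hAE l, Matrix.mul_sum, Matrix.sum_mul, Matrix.trace_sum, Complex.re_sum]
    refine Finset.sum_le_sum fun j _ => ?_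
    rw [Matrix.mul_smul, Matrix.smul_mul, Matrix.trace_smul, smul_eq_mul, mul_comm]
    have hr2 : ∀ (c : ℤ) (z : ℂ), ((c : ℂ) * z).re = (c : ℝ) * z.re := by
      intro c z; simp
    rw [hr2]
    refine mul_le_mul_of_nonneg_left (hge l _) ?_
    have := cz_mono (hI l) j
    exact_mod_cast sub_nonneg.2 this
  have hfin := Finset.sum_le_sum fun l (_ : l ∈ (Finset.univ : Finset (Fin s))) => hl l
  rw [htot] at hfin
  have hfin2 : ∑ l, ∑ j : Fin m, (k' (some (l, j.castSucc)) : ℤ) * (cz (I l) (j+1) - cz (I l) j) ≤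
    (k' none : ℤ) * ((m : ℤ) + 1 - r) := by exact_mod_cast hfin
  omega

theorem gamma_inj {n : ℕ} {I J : Fin r → Fin n}
    (h : ∀ k : Fin r, (k : ℝ) - (I k : ℝ) + ((n : ℝ) - (r : ℝ)) = (k : ℝ) - (J k : ℝ) + ((n : ℝ) - (r : ℝ))) :
    I = J := by
  funext k
  have := h k
  have h2 : ((I k : ℕ) : ℝ) = ((J k : ℕ) : ℝ) := by linarith
  exact Fin.ext (by exact_mod_cast h2)

end HK
end

/-- `𝐈 ∈ Intersecting⁰(r,n,s)^σ` iff `(Γ(𝐈), n-r) ∈ 𝒦(r,s)^σ`. -/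
theorem inter0_iff_kirwan (s r n : ℕ) (hs : 2 ≤ s) (hr : 1 ≤ r) (hrn : r ≤ n)
    (σ : Equiv.Perm (Fin s))
    (I : Fin s → Fin r → Fin n) (hI : ∀ l, StrictMono (I l)) :
    (Intersecting I ∧ edim I = 0 ∧ (fun l => I (σ⁻¹ l)) = I) ↔
      (KirwanMem (GammaT I) ((n : ℝ) - (r : ℝ)) ∧
        (fun l => GammaT I (σ⁻¹ l)) = GammaT I) := by
  obtain ⟨m, rfl⟩ : ∃ m, n = m + 1 := ⟨n - 1, by omega⟩
  constructor
  · rintro ⟨h1, h2, h3⟩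
    refine ⟨HK.kirwan_of_inter hI hrn h1 h2, ?_⟩
    funext l
    have : I (σ⁻¹ l) = I l := congrFun h3 l
    unfold GammaT
    rw [this]
  · rintro ⟨h1, h2⟩
    refine ⟨HK.inter_of_kirwan hI hrn h1, HK.kirwan_edim h1, ?_⟩
    funext l
    exact HK.gamma_inj fun k => congrFun (congrFun h2 l) k
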